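/- (Yoccoz) For any Liouville number α, the set of diffeomorphisms f ∈ F_α^∞ for which the closure Z_0^∞(f) (in the C^∞ topology) of the group of iterates {fⁿ : n ∈ Z} is uncountable is generic (contains a dense G_δ set) in F_α^∞ for the C^∞ topology. -/

import Mathlib

open Filter Topology

/-- `ρ` is the rotation (translation) number of the lift `F`. -/
def IsRotNumber (F : ℝ → ℝ) (ρ : ℝ) : Prop :=
  ∀ x : ℝ, Tendsto (fun n : ℕ => (F^[n] x - x) / (n : ℝ)) atTop (𝓝 ρ)

/-- `α` is Diophantine with exponent `σ` and constant `γ`: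
`|α - p/q| ≥ γ / q^(2+σ)` for all rationals `p/q`. -/
def IsDiophantineWith (γ σ α : ℝ) : Prop :=
  ∀ (p : ℤ) (q : ℕ), 0 < q → γ / (q : ℝ) ^ ((2 : ℝ) + σ) ≤ |α - (p : ℝ) / (q : ℝ)|

/-- `α` is a Diophantine number. -/
def IsDiophantine (α : ℝ) : Prop :=
  ∃ γ > (0 : ℝ), ∃ σ ≥ (0 : ℝ), IsDiophantineWith γ σ α

/-- The space of lifts of orientation-preserving `C^∞` circle diffeomorphisms. -/
def SmoothLift : Type :=
  {F : ℝ → ℝ // ContDiff ℝ (⊤ : ℕ∞) F ∧ (∀ x, 0 < deriv F x) ∧ ∀ x, F (x + 1) = F x + 1}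

/-- The `C^∞` topology on lifts of smooth circle diffeomorphisms: the topology induced
by the uniform (= compact-open, by periodicity) convergence of all derivatives. -/
noncomputable instance : TopologicalSpace SmoothLift :=
  TopologicalSpace.induced
    (fun F => fun r : ℕ =>
      (⟨iteratedDeriv r F.1, F.2.1.continuous_iteratedDeriv r (by exact_mod_cast le_top)⟩ :
        C(ℝ, ℝ)))
    inferInstance

/-- `G` is (a lift of) an integer iterate `fⁿ`, `n ∈ ℤ`, of the circle diffeomorphism
with lift `F` : either `G = F^[n] + k` (positive iterates) or `F^[n] ∘ G = id + k`
(negative iterates), for some `n ∈ ℕ`, `k ∈ ℤ`. -/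
def IsIterateLift (F G : ℝ → ℝ) : Prop :=
  ∃ (n : ℕ) (k : ℤ), (∀ x, G x = F^[n] x + k) ∨ (∀ x, F^[n] (G x) = x + k)

namespace Yoccoz

open scoped ContDiff

/-! ### Pointwise bounds on derivatives -/

/-- The derivatives of `f` at `x` up to order `n` are bounded by `B * s ^ i`. -/
def DerivBound (f : ℝ → ℝ) (x : ℝ) (n : ℕ) (s B : ℝ) : Prop :=
  ∀ i ≤ n, |iteratedDeriv i f x| ≤ B * s ^ i

lemma smooth_deriv {f : ℝ → ℝ} (hf : ContDiff ℝ ∞ f) : ContDiff ℝ ∞ (deriv f) :=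
  (contDiff_infty_iff_deriv.1 hf).2

lemma smooth_differentiable {f : ℝ → ℝ} (hf : ContDiff ℝ ∞ f) : Differentiable ℝ f :=
  (contDiff_infty_iff_deriv.1 hf).1

lemma smooth_iteratedDeriv {f : ℝ → ℝ} (hf : ContDiff ℝ ∞ f) (n : ℕ) :
    ContDiff ℝ ∞ (iteratedDeriv n f) := by
  induction n generalizing f with
  | zero => simpa using hf
  | succ n ih => rw [iteratedDeriv_succ']; exact ih (smooth_deriv hf)

lemma smooth_at {f : ℝ → ℝ} (hf : ContDiff ℝ ∞ f) (n : ℕ) (x : ℝ) : ContDiffAt ℝ n f x :=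
  (hf.of_le (by exact_mod_cast le_top)).contDiffAt

namespace DerivBound

variable {f g : ℝ → ℝ} {x s B C : ℝ} {n m : ℕ}

lemma mono (h : DerivBound f x n s B) (hs : 0 ≤ s) (hBC : B ≤ C) (hm : m ≤ n) :
    DerivBound f x m s C := fun i hi =>
  (h i (hi.trans hm)).trans (mul_le_mul_of_nonneg_right hBC (pow_nonneg hs i))

lemma nonneg (h : DerivBound f x n s B) : 0 ≤ B := by
  have := h 0 (Nat.zero_le _)
  simp only [pow_zero, mul_one] at this
  exact (abs_nonneg _).trans this

lemma add (hf : ContDiff ℝ ∞ f) (hg : ContDiff ℝ ∞ g)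
    (h : DerivBound f x n s B) (h' : DerivBound g x n s C) :
    DerivBound (fun y => f y + g y) x n s (B + C) := fun i hi => by
  have := iteratedDeriv_add (smooth_at hf i x) (smooth_at hg i x)
  change |iteratedDeriv i (f + g) x| ≤ _
  rw [this, add_mul]
  exact (abs_add_le _ _).trans (add_le_add (h i hi) (h' i hi))

lemma sub (hf : ContDiff ℝ ∞ f) (hg : ContDiff ℝ ∞ g)
    (h : DerivBound f x n s B) (h' : DerivBound g x n s C) :
    DerivBound (fun y => f y - g y) x n s (B + C) := fun i hi => by
  have := iteratedDeriv_sub (smooth_at hf i x) (smooth_at hg i x)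
  change |iteratedDeriv i (f - g) x| ≤ _
  rw [this, add_mul]
  exact (abs_sub _ _).trans (add_le_add (h i hi) (h' i hi))

lemma neg (h : DerivBound f x n s B) : DerivBound (fun y => - f y) x n s B := fun i hi => by
  rw [iteratedDeriv_fun_neg, abs_neg]; exact h i hi

lemma sum {ι : Type*} (I : Finset ι) {F : ι → ℝ → ℝ} {b : ι → ℝ}
    (hF : ∀ j ∈ I, ContDiff ℝ ∞ (F j)) (h : ∀ j ∈ I, DerivBound (F j) x n s (b j)) :
    DerivBound (fun y => ∑ j ∈ I, F j y) x n s (∑ j ∈ I, b j) := fun i hi => by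
  rw [iteratedDeriv_fun_sum (fun j hj => smooth_at (hF j hj) i x), Finset.sum_mul]
  exact (Finset.abs_sum_le_sum_abs _ _).trans (Finset.sum_le_sum fun j hj => h j hj i hi)

lemma mul (hf : ContDiff ℝ ∞ f) (hg : ContDiff ℝ ∞ g) (hs : 0 ≤ s)
    (h : DerivBound f x n s B) (h' : DerivBound g x n s C) :
    DerivBound (fun y => f y * g y) x n s (2 ^ n * (B * C)) := fun i hi => by
  have hB := h.nonneg
  have hC := h'.nonneg
  have e := iteratedDeriv_mul (smooth_at hf i x) (smooth_at hg i x)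
  change |iteratedDeriv i (f * g) x| ≤ _
  rw [e]
  calc |∑ j ∈ Finset.range (i + 1), (i.choose j : ℝ) * iteratedDeriv j f x
          * iteratedDeriv (i - j) g x|
      ≤ ∑ j ∈ Finset.range (i + 1), (i.choose j : ℝ) * (B * C * s ^ i) := by
        refine (Finset.abs_sum_le_sum_abs _ _).trans (Finset.sum_le_sum fun j hj => ?_)
        have hj' : j ≤ i := Nat.lt_succ_iff.1 (Finset.mem_range.1 hj)
        rw [mul_assoc, abs_mul, abs_mul, Nat.abs_cast]
        refine mul_le_mul_of_nonneg_left ?_ (Nat.cast_nonneg _)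
        calc _ ≤ (B * s ^ j) * (C * s ^ (i - j)) :=
              mul_le_mul (h j (hj'.trans hi)) (h' _ ((Nat.sub_le _ _).trans hi)) (abs_nonneg _)
                (by positivity)
          _ = B * C * (s ^ j * s ^ (i - j)) := by ring
          _ = _ := by rw [← pow_add, Nat.add_sub_cancel' hj']
    _ = (2 : ℝ) ^ i * (B * C * s ^ i) := by
        rw [← Finset.sum_mul]
        congr 1
        exact_mod_cast Nat.sum_range_choose i
    _ ≤ 2 ^ n * (B * C * s ^ i) := by
        refine mul_le_mul_of_nonneg_right ?_ (by positivity)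
        exact pow_le_pow_right₀ (by norm_num) hi
    _ = _ := by ring

lemma comp {u y : ℝ → ℝ} (hu : ContDiff ℝ ∞ u) (hy : ContDiff ℝ ∞ y) (hs : 0 ≤ s) {E : ℝ}
    (hE : 1 ≤ E) (hC : ∀ i ≤ n, |iteratedDeriv i u (y x)| ≤ C)
    (hD : ∀ i, 1 ≤ i → i ≤ n → |iteratedDeriv i y x| ≤ E * s ^ i) :
    DerivBound (fun z => u (y z)) x n s (n.factorial * C * E ^ n) := fun i hi => by
  have hC0 : 0 ≤ C := (abs_nonneg _).trans (hC 0 (Nat.zero_le _))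
  have := norm_iteratedFDeriv_comp_le (n := i) (N := ∞) (𝕜 := ℝ) hu hy
    (by exact_mod_cast le_top) x (C := C) (D := E * s)
    (fun j hj => by
      rw [norm_iteratedFDeriv_eq_norm_iteratedDeriv]; exact hC j (hj.trans hi))
    (fun j hj hj' => by
      rw [norm_iteratedFDeriv_eq_norm_iteratedDeriv]
      refine (hD j hj (hj'.trans hi)).trans ?_
      rw [mul_pow]
      exact mul_le_mul_of_nonneg_right (le_self_pow₀ hE (by omega)) (by positivity))
  rw [norm_iteratedFDeriv_eq_norm_iteratedDeriv] at this
  refine (show |iteratedDeriv i (fun z => u (y z)) x| ≤ _ from this).trans ?_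
  rw [mul_pow, ← mul_assoc]
  refine mul_le_mul_of_nonneg_right ?_ (by positivity)
  gcongr

lemma of_succ (h0 : |f x| ≤ B) (h : DerivBound (deriv f) x n s (B * s)) :
    DerivBound f x (n + 1) s B := by
  rintro (_ | i) hi
  · simpa using h0
  · rw [iteratedDeriv_succ']
    refine (h i (by omega)).trans (le_of_eq ?_)
    ring

lemma deriv (h : DerivBound f x (n + 1) s B) : DerivBound (deriv f) x n s (B * s) := fun i hi => by
  rw [← iteratedDeriv_succ']
  refine (h (i + 1) (by omega)).trans (le_of_eq ?_)
  ring

lemma const (c : ℝ) (hs : 0 ≤ s) : DerivBound (fun _ => c) x n s |c| := by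
  rintro (_ | i) hi
  · simp
  · rw [iteratedDeriv_const]; simp; positivity

end DerivBound

lemma pow_bound_mono {B : ℝ} (hB : 2 ≤ B) {a b : ℕ} (h : a ≤ b) : B ^ a ≤ B ^ b :=
  pow_le_pow_right₀ (by linarith) h

lemma two_pow_le {B : ℝ} (hB : 2 ≤ B) (n : ℕ) : (2 : ℝ) ^ n ≤ B ^ n :=
  pow_le_pow_left₀ (by norm_num) hB n

lemma factorial_le_pow {B : ℝ} (hB : 2 ≤ B) (n : ℕ) : (n.factorial : ℝ) ≤ B ^ (n * n) := by
  have h1 : (n.factorial : ℝ) ≤ (n : ℝ) ^ n := by exact_mod_cast Nat.factorial_le_pow n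
  have h2 : (n : ℝ) ≤ B ^ n :=
    (by exact_mod_cast Nat.lt_two_pow_self.le : (n : ℝ) ≤ 2 ^ n).trans (two_pow_le hB n)
  calc (n.factorial : ℝ) ≤ (n : ℝ) ^ n := h1
    _ ≤ (B ^ n) ^ n := pow_le_pow_left₀ (Nat.cast_nonneg _) h2 n
    _ = B ^ (n * n) := (pow_mul _ _ _).symm

/-- Bound for a composition with all derivatives at most `B ≥ 2`. -/
lemma comp_bound {n : ℕ} {u y : ℝ → ℝ} {x B : ℝ} (hu : ContDiff ℝ ∞ u) (hy : ContDiff ℝ ∞ y)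
    (hB : 2 ≤ B) (hC : ∀ i ≤ n, |iteratedDeriv i u (y x)| ≤ B)
    (hD : ∀ i, 1 ≤ i → i ≤ n → |iteratedDeriv i y x| ≤ B) :
    DerivBound (fun z => u (y z)) x n 1 (B ^ (n * n + 1 + n)) := by
  refine (DerivBound.comp hu hy zero_le_one (by linarith : (1 : ℝ) ≤ B) hC
    (by simpa using hD)).mono zero_le_one ?_ le_rfl
  rw [pow_add, pow_add, pow_one]
  have := factorial_le_pow hB n
  gcongr

/-- Mean value estimate on an unordered interval. -/
lemma abs_sub_le_of_deriv_le {u : ℝ → ℝ} (hu : Differentiable ℝ u) {a b C : ℝ}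
    (h : ∀ z ∈ Set.uIcc a b, |deriv u z| ≤ C) : |u a - u b| ≤ C * |a - b| := by
  have := Convex.norm_image_sub_le_of_norm_deriv_le (f := u) (s := Set.uIcc a b) (C := C)
    (fun z _ => hu z) (fun z hz => h z hz) (convex_uIcc a b) Set.right_mem_uIcc Set.left_mem_uIcc
  simpa using this

/-- Derivative bounds for the difference of two compositions with the same outer function. -/
lemma comp_sub_comp_bound (n : ℕ) : ∃ c : ℕ, ∀ (u y y₀ : ℝ → ℝ) (x B τ : ℝ),
    ContDiff ℝ ∞ u → ContDiff ℝ ∞ y → ContDiff ℝ ∞ y₀ → 2 ≤ B →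
    (∀ i, 1 ≤ i → i ≤ n + 1 → ∀ z ∈ Set.uIcc (y x) (y₀ x), |iteratedDeriv i u z| ≤ B) →
    (∀ i, 1 ≤ i → i ≤ n → |iteratedDeriv i y x| ≤ B) →
    (∀ i, 1 ≤ i → i ≤ n → |iteratedDeriv i y₀ x| ≤ B) →
    DerivBound (fun z => y z - y₀ z) x n 1 τ →
    DerivBound (fun z => u (y z) - u (y₀ z)) x n 1 (B ^ c * τ) := by
  induction n with
  | zero =>
    refine ⟨1, fun u y y₀ x B τ hu hy hy₀ hB h1 _ _ h4 => ?_⟩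
    intro i hi
    obtain rfl : i = 0 := by omega
    have h5 := h4 0 le_rfl
    simp only [iteratedDeriv_zero, pow_zero, mul_one, pow_one] at h5 ⊢
    refine (abs_sub_le_of_deriv_le (smooth_differentiable hu) (C := B) fun z hz => ?_).trans
      (mul_le_mul_of_nonneg_left h5 (by linarith))
    simpa using h1 1 le_rfl le_rfl z hz
  | succ n ih =>
    obtain ⟨c, hc⟩ := ih
    set c' := (n + c + 1) + (n + (n * n + 1 + n)) + 2 with hc'
    refine ⟨c', fun u y y₀ x B τ hu hy hy₀ hB h1 h2 h3 h4 => ?_⟩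
    have hτ : 0 ≤ τ := h4.nonneg
    have hB1 : (1 : ℝ) ≤ B := by linarith
    have hB0 : (0 : ℝ) ≤ B := by linarith
    have du := smooth_differentiable hu
    have dy := smooth_differentiable hy
    have dy₀ := smooth_differentiable hy₀
    have hu' := smooth_deriv hu
    apply DerivBound.of_succ
    · have h5 := h4 0 (Nat.zero_le _)
      simp only [iteratedDeriv_zero, pow_zero, mul_one] at h5
      have h6 := abs_sub_le_of_deriv_le du (C := B) (a := y x) (b := y₀ x) fun z hz => by
        simpa using h1 1 le_rfl (by omega) z hz
      refine h6.trans (mul_le_mul ?_ h5 (abs_nonneg _) (by positivity))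
      exact le_self_pow₀ hB1 (by omega)
    · have e : deriv (fun z => u (y z) - u (y₀ z)) = fun z =>
          (deriv u (y z) - deriv u (y₀ z)) * deriv y z
            + deriv u (y₀ z) * (deriv (fun z => y z - y₀ z) z) := by
        funext z
        have a1 : HasDerivAt (fun z => u (y z)) (deriv u (y z) * deriv y z) z :=
          (du (y z)).hasDerivAt.comp z (dy z).hasDerivAt
        have a2 : HasDerivAt (fun z => u (y₀ z)) (deriv u (y₀ z) * deriv y₀ z) z :=
          (du (y₀ z)).hasDerivAt.comp z (dy₀ z).hasDerivAt
        have a3 : HasDerivAt (fun z => y z - y₀ z) (deriv y z - deriv y₀ z) z :=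
          (dy z).hasDerivAt.sub (dy₀ z).hasDerivAt
        rw [(a1.fun_sub a2).deriv, a3.deriv]
        ring
      rw [e]
      have k1 := hc (deriv u) y y₀ x B τ hu' hy hy₀ hB
        (fun i hi hi' z hz => by rw [← iteratedDeriv_succ']; exact h1 _ (by omega) (by omega) z hz)
        (fun i hi hi' => h2 i hi (by omega)) (fun i hi hi' => h3 i hi (by omega))
        (h4.mono zero_le_one le_rfl (by omega))
      have k2 : DerivBound (deriv y) x n 1 B := fun i hi => by
        rw [← iteratedDeriv_succ']; simpa using h2 _ (by omega) (by omega)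
      have k3 := comp_bound (n := n) (x := x) hu' hy₀ hB
        (fun i hi => by
          rw [← iteratedDeriv_succ']; exact h1 _ (by omega) (by omega) _ Set.right_mem_uIcc)
        (fun i hi hi' => h3 i hi (by omega))
      have k4 := h4.deriv
      have s1 : ContDiff ℝ ∞ fun z => deriv u (y z) - deriv u (y₀ z) :=
        (hu'.comp hy).sub (hu'.comp hy₀)
      have s2 : ContDiff ℝ ∞ (deriv fun z => y z - y₀ z) := smooth_deriv (hy.sub hy₀)
      have t1 := k1.mul s1 (smooth_deriv hy) zero_le_one k2
      have t2 := k3.mul (hu'.comp hy₀) s2 zero_le_one k4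
      refine (t1.add (s1.mul (smooth_deriv hy)) ((hu'.comp hy₀).mul s2) t2).mono zero_le_one ?_
        le_rfl
      have w1 : 2 ^ n * (B ^ c * τ * B) ≤ B ^ (c' - 1) * τ := by
        calc 2 ^ n * (B ^ c * τ * B) ≤ B ^ n * (B ^ c * τ * B) := by
              gcongr
          _ = B ^ (n + c + 1) * τ := by rw [pow_add, pow_add, pow_one]; ring
          _ ≤ _ := mul_le_mul_of_nonneg_right (pow_bound_mono hB (by omega)) hτ
      have w2 : 2 ^ n * (B ^ (n * n + 1 + n) * (τ * 1)) ≤ B ^ (c' - 1) * τ := by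
        calc _ ≤ B ^ n * (B ^ (n * n + 1 + n) * (τ * 1)) := by gcongr
          _ = B ^ (n + (n * n + 1 + n)) * τ := by rw [pow_add B n]; ring
          _ ≤ _ := mul_le_mul_of_nonneg_right (pow_bound_mono hB (by omega)) hτ
      calc _ ≤ 2 * (B ^ (c' - 1) * τ) := by linarith
        _ ≤ B * (B ^ (c' - 1) * τ) := by gcongr
        _ = B ^ (c' - 1 + 1) * τ * 1 := by rw [pow_succ]; ring
        _ = _ := by rw [Nat.sub_add_cancel (by omega)]

/-- Derivative bounds for the reciprocal. -/
lemma inv_bound (n : ℕ) : ∃ c : ℕ, ∀ (φ : ℝ → ℝ) (x B : ℝ), ContDiff ℝ ∞ φ → (∀ z, 0 < φ z) →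
    2 ≤ B → 1 / B ≤ φ x → DerivBound φ x n 1 B → DerivBound (fun z => (φ z)⁻¹) x n 1 (B ^ c) := by
  have base : ∀ (φ : ℝ → ℝ) (x B : ℝ), 2 ≤ B → 0 < φ x → 1 / B ≤ φ x → |(φ x)⁻¹| ≤ B := by
    intro φ x B hB h h'
    rw [abs_of_pos (inv_pos.2 h)]
    have := inv_anti₀ (by positivity) h'
    simpa using this
  induction n with
  | zero =>
    refine ⟨1, fun φ x B _ hp hB h1 _ i hi => ?_⟩
    obtain rfl : i = 0 := by omega
    simpa using base φ x B hB (hp x) h1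
  | succ n ih =>
    obtain ⟨c, hc⟩ := ih
    refine ⟨n + 1 + (n + c + c) + 1, fun φ x B hφ hp hB h1 h2 => ?_⟩
    have hB1 : (1 : ℝ) ≤ B := by linarith
    have hinv : ContDiff ℝ ∞ fun z => (φ z)⁻¹ := hφ.inv fun z => (hp z).ne'
    apply DerivBound.of_succ
    · exact (base φ x B hB (hp x) h1).trans (le_self_pow₀ hB1 (by omega))
    · have e : deriv (fun z => (φ z)⁻¹) = fun z => - (deriv φ z * ((φ z)⁻¹ * (φ z)⁻¹)) := by
        funext z
        have := ((smooth_differentiable hφ z).hasDerivAt.inv (hp z).ne').deriv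
        change deriv (φ⁻¹) z = _
        rw [this]
        field_simp
      rw [e]
      have k := hc φ x B hφ hp hB h1 (h2.mono zero_le_one le_rfl (by omega))
      have k2 := k.mul hinv hinv zero_le_one k
      have k3 := (h2.deriv.mul (smooth_deriv hφ) (hinv.mul hinv) zero_le_one k2).neg
      refine k3.mono zero_le_one ?_ le_rfl
      calc 2 ^ n * (B * 1 * (2 ^ n * (B ^ c * B ^ c)))
          ≤ B ^ n * (B * 1 * (B ^ n * (B ^ c * B ^ c))) := by gcongr
        _ = B ^ (n + 1 + (n + c + c)) := by simp only [pow_add]; ring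
        _ ≤ _ := by rw [mul_one]; exact pow_bound_mono hB (by omega)

/-- If `Φ ∘ y = Φ ∘ y₀ + ε`, the derivatives of `y - y₀` are controlled by those of `ε`. -/
lemma implicit_sub_bound (n : ℕ) : ∃ c : ℕ, ∀ (Φ y y₀ ε : ℝ → ℝ) (x B τ : ℝ),
    ContDiff ℝ ∞ Φ → ContDiff ℝ ∞ y → ContDiff ℝ ∞ y₀ → ContDiff ℝ ∞ ε → (∀ z, 0 < deriv Φ z) →
    (∀ z, Φ (y z) = Φ (y₀ z) + ε z) → 2 ≤ B → τ ≤ 1 →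
    (∀ i, 1 ≤ i → i ≤ n + 1 → ∀ z ∈ Set.uIcc (y x) (y₀ x), |iteratedDeriv i Φ z| ≤ B) →
    (∀ z ∈ Set.uIcc (y x) (y₀ x), 1 / B ≤ deriv Φ z) →
    (∀ i, 1 ≤ i → i ≤ n → |iteratedDeriv i y₀ x| ≤ B) →
    DerivBound ε x n 1 τ →
    DerivBound (fun z => y z - y₀ z) x n 1 (B ^ c * τ) := by
  have base : ∀ (Φ y y₀ ε : ℝ → ℝ) (x B τ : ℝ), ContDiff ℝ ∞ Φ → (∀ z, 0 < deriv Φ z) → 2 ≤ B →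
      (∀ z, Φ (y z) = Φ (y₀ z) + ε z) →
      (∀ z ∈ Set.uIcc (y x) (y₀ x), 1 / B ≤ deriv Φ z) → |ε x| ≤ τ → |y x - y₀ x| ≤ B * τ := by
    intro Φ y y₀ ε x B τ hΦ hp hB he h1 h2
    have key : 1 / B * |y x - y₀ x| ≤ |Φ (y x) - Φ (y₀ x)| := by
      rcases lt_trichotomy (y x) (y₀ x) with h | h | h
      · obtain ⟨z, hz, hz'⟩ := exists_deriv_eq_slope Φ h hΦ.continuous.continuousOn
          (smooth_differentiable hΦ).differentiableOn
        have := h1 z (Set.Icc_subset_uIcc ⟨hz.1.le, hz.2.le⟩)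
        rw [hz', le_div_iff₀ (by linarith)] at this
        rw [abs_sub_comm, abs_of_pos (by linarith), abs_sub_comm]
        exact this.trans (le_abs_self _)
      · simp [h]
      · obtain ⟨z, hz, hz'⟩ := exists_deriv_eq_slope Φ h hΦ.continuous.continuousOn
          (smooth_differentiable hΦ).differentiableOn
        have := h1 z (Set.Icc_subset_uIcc' ⟨hz.1.le, hz.2.le⟩)
        rw [hz', le_div_iff₀ (by linarith)] at this
        rw [abs_of_pos (by linarith)]
        exact this.trans (le_abs_self _)
    rw [he x, add_sub_cancel_left, one_div, inv_mul_le_iff₀ (by linarith)] at key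
    exact key.trans (mul_le_mul_of_nonneg_left h2 (by linarith))
  induction n with
  | zero =>
    refine ⟨1, fun Φ y y₀ ε x B τ hΦ hy hy₀ hε hp he hB hτ h1 h2 h3 h4 i hi => ?_⟩
    obtain rfl : i = 0 := by omega
    have := h4 0 le_rfl
    simp only [iteratedDeriv_zero, pow_zero, mul_one, pow_one] at this ⊢
    exact base Φ y y₀ ε x B τ hΦ hp hB he h2 this
  | succ n ih =>
    obtain ⟨c, hc⟩ := ih
    obtain ⟨c₁, hc₁⟩ := comp_sub_comp_bound n
    obtain ⟨c₂, hc₂⟩ := inv_bound n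
    set p₁ := (c + 2) * c₁ + c with hp₁
    set p₂ := (c + 2 + c₂) * (n * n + 1 + n) with hp₂
    refine ⟨n + (n + p₁ + 2) + p₂ + 1,
      fun Φ y y₀ ε x B τ hΦ hy hy₀ hε hp he hB hτ h1 h2 h3 h4 => ?_⟩
    have hB1 : (1 : ℝ) ≤ B := by linarith
    have hτ0 : 0 ≤ τ := h4.nonneg
    have hΦ' := smooth_deriv hΦ
    have dΦ := smooth_differentiable hΦ
    have dy := smooth_differentiable hy
    have dy₀ := smooth_differentiable hy₀
    have dε := smooth_differentiable hε
    have kΔ := hc Φ y y₀ ε x B τ hΦ hy hy₀ hε hp he hB hτ (fun i hi hi' => h1 i hi (by omega)) h2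
      (fun i hi hi' => h3 i hi (by omega)) (h4.mono zero_le_one le_rfl (by omega))
    have ky : ∀ i, 1 ≤ i → i ≤ n → |iteratedDeriv i y x| ≤ B ^ (c + 2) := by
      intro i hi hi'
      have e2 := iteratedDeriv_add (smooth_at (hy.sub hy₀) i x) (smooth_at hy₀ i x)
      have e3 : iteratedDeriv i y x
          = iteratedDeriv i (fun z => y z - y₀ z) x + iteratedDeriv i y₀ x := by
        rw [← e2]; congr 1; funext z; simp
      rw [e3]
      have a1 := kΔ i hi'
      rw [one_pow, mul_one] at a1
      have a2 := h3 i hi (by omega)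
      have b1 : B ^ c * τ ≤ B ^ c := mul_le_of_le_one_right (by positivity) hτ
      have b2 : B ≤ B ^ (c + 1) := le_self_pow₀ hB1 (by omega)
      have b3 : B ^ c ≤ B ^ (c + 1) := pow_bound_mono hB (by omega)
      have b4 : 2 * B ^ (c + 1) ≤ B * B ^ (c + 1) := by gcongr
      refine (abs_add_le _ _).trans ?_
      rw [pow_succ]; linarith
    have hBc : 2 ≤ B ^ (c + 2) := hB.trans (le_self_pow₀ hB1 (by omega))
    have hBc₂ : 2 ≤ B ^ (c + 2 + c₂) := hB.trans (le_self_pow₀ hB1 (by omega))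
    have hBle : B ≤ B ^ (c + 2) := le_self_pow₀ hB1 (by omega)
    have k1 := hc₁ (deriv Φ) y y₀ x (B ^ (c + 2)) (B ^ c * τ) hΦ' hy hy₀ hBc
      (fun i hi hi' z hz => by
        rw [← iteratedDeriv_succ']; exact (h1 _ (by omega) (by omega) z hz).trans hBle)
      ky (fun i hi hi' => (h3 i hi (by omega)).trans hBle) kΔ
    have hw : ContDiff ℝ ∞ fun z => (deriv Φ z)⁻¹ := hΦ'.inv fun z => (hp z).ne'
    have kw := hc₂ (deriv Φ) (y x) B hΦ' hp hB (h2 _ Set.left_mem_uIcc) (fun i hi => by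
      rw [← iteratedDeriv_succ', one_pow, mul_one]
      exact h1 _ (by omega) (by omega) _ Set.left_mem_uIcc)
    have kwy := comp_bound (n := n) (x := x) hw hy hBc₂
      (fun i hi => by
        refine (kw i hi).trans ?_
        rw [one_pow, mul_one]; exact pow_bound_mono hB (by omega))
      (fun i hi hi' => (ky i hi hi').trans (pow_bound_mono hB (by omega)))
    rw [← pow_mul, ← hp₂] at kwy
    have e1 : B ^ p₁ * τ = (B ^ (c + 2)) ^ c₁ * (B ^ c * τ) := by
      rw [hp₁, pow_add, pow_mul]; ring
    rw [← e1] at k1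
    have ky₀ : DerivBound (deriv y₀) x n 1 B := fun i hi => by
      rw [← iteratedDeriv_succ']; simpa using h3 _ (by omega) (by omega)
    have s1 : ContDiff ℝ ∞ fun z => deriv Φ (y z) - deriv Φ (y₀ z) :=
      (hΦ'.comp hy).sub (hΦ'.comp hy₀)
    have s2 := s1.mul (smooth_deriv hy₀)
    have s3 := (smooth_deriv hε).sub s2
    have s4 : ContDiff ℝ ∞ fun z => (deriv Φ (y z))⁻¹ := hw.comp hy
    have t1 := k1.mul s1 (smooth_deriv hy₀) zero_le_one ky₀
    have t2 := h4.deriv.sub (smooth_deriv hε) s2 t1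
    have t3 := t2.mul s3 s4 zero_le_one kwy
    apply DerivBound.of_succ
    · have := base Φ y y₀ ε x B τ hΦ hp hB he h2 (by simpa using h4 0 (Nat.zero_le _))
      exact this.trans (mul_le_mul_of_nonneg_right (le_self_pow₀ hB1 (by omega)) hτ0)
    · have e : deriv (fun z => y z - y₀ z) = fun z =>
          (deriv ε z - (deriv Φ (y z) - deriv Φ (y₀ z)) * deriv y₀ z) * (deriv Φ (y z))⁻¹ := by
        funext z
        have a1 : HasDerivAt (fun z => Φ (y z)) (deriv Φ (y z) * deriv y z) z :=
          (dΦ (y z)).hasDerivAt.comp z (dy z).hasDerivAt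
        have a2 : HasDerivAt (fun z => Φ (y₀ z)) (deriv Φ (y₀ z) * deriv y₀ z) z :=
          (dΦ (y₀ z)).hasDerivAt.comp z (dy₀ z).hasDerivAt
        have a3 := a2.fun_add (dε z).hasDerivAt
        have a4 : deriv Φ (y z) * deriv y z = deriv Φ (y₀ z) * deriv y₀ z + deriv ε z := by
          rw [← a1.deriv, ← a3.deriv]; congr 1; funext w; exact he w
        rw [((dy z).hasDerivAt.fun_sub (dy₀ z).hasDerivAt).deriv, eq_mul_inv_iff_mul_eq₀ (hp _).ne']
        linear_combination a4
      rw [e]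
      refine t3.mono zero_le_one ?_ le_rfl
      have u1 : 2 ^ n * (B ^ p₁ * τ * B) ≤ B ^ (n + p₁ + 1) * τ := by
        calc 2 ^ n * (B ^ p₁ * τ * B) ≤ B ^ n * (B ^ p₁ * τ * B) := by gcongr
          _ = _ := by simp only [pow_add]; ring
      have u2 : τ * 1 ≤ B ^ (n + p₁ + 1) * τ := by
        rw [mul_one]; exact le_mul_of_one_le_left hτ0 (one_le_pow₀ hB1)
      have u3 : τ * 1 + 2 ^ n * (B ^ p₁ * τ * B) ≤ B ^ (n + p₁ + 2) * τ := by
        calc _ ≤ 2 * (B ^ (n + p₁ + 1) * τ) := by linarith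
          _ ≤ B * (B ^ (n + p₁ + 1) * τ) := by gcongr
          _ = _ := by rw [pow_succ B (n + p₁ + 1)]; ring
      calc _ ≤ B ^ n * (B ^ (n + p₁ + 2) * τ * B ^ p₂) := by gcongr
        _ = B ^ (n + (n + p₁ + 2) + p₂) * τ := by simp only [pow_add]; ring
        _ ≤ _ := by
          rw [mul_one]; exact mul_le_mul_of_nonneg_right (pow_bound_mono hB (by omega)) hτ0

/-! ### Lifts, iterates and distortion -/

/-- Lifts of smooth orientation-preserving circle diffeomorphisms. -/
structure IsLift (g : ℝ → ℝ) : Prop where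
  smooth : ContDiff ℝ ∞ g
  deriv_pos : ∀ x, 0 < deriv g x
  add_one : ∀ x, g (x + 1) = g x + 1

namespace IsLift

variable {g : ℝ → ℝ}

lemma strictMono (hg : IsLift g) : StrictMono g := strictMono_of_deriv_pos hg.deriv_pos

lemma add_nat (hg : IsLift g) (x : ℝ) (n : ℕ) : g (x + n) = g x + n := by
  induction n with
  | zero => simp
  | succ n ih => push_cast; rw [← add_assoc, hg.add_one, ih, add_assoc]

lemma add_int (hg : IsLift g) (x : ℝ) (m : ℤ) : g (x + m) = g x + m := by
  obtain ⟨n, rfl | rfl⟩ := m.eq_nat_or_neg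
  · exact_mod_cast hg.add_nat x n
  · have := hg.add_nat (x + ((-(n : ℤ) : ℤ) : ℝ)) n
    push_cast at this ⊢
    rw [neg_add_cancel_right] at this
    linarith

lemma comp {f : ℝ → ℝ} (hf : IsLift f) (hg : IsLift g) : IsLift (f ∘ g) where
  smooth := hf.smooth.comp hg.smooth
  deriv_pos x := by
    rw [deriv_comp x (smooth_differentiable hf.smooth _) (smooth_differentiable hg.smooth _)]
    exact mul_pos (hf.deriv_pos _) (hg.deriv_pos _)
  add_one x := by simp [hg.add_one, hf.add_one]

lemma id : IsLift id where
  smooth := contDiff_id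
  deriv_pos x := by simp
  add_one x := by simp

lemma iterate (hg : IsLift g) (n : ℕ) : IsLift g^[n] := by
  induction n with
  | zero => exact IsLift.id
  | succ n ih => rw [Function.iterate_succ']; exact hg.comp ih

lemma add_const (hg : IsLift g) (t : ℝ) : IsLift fun x => g x + t where
  smooth := hg.smooth.add contDiff_const
  deriv_pos x := by simpa using hg.deriv_pos x
  add_one x := by simp only [hg.add_one]; ring

lemma deriv_iterate_add (hg : IsLift g) (m n : ℕ) (x : ℝ) :
    deriv g^[m + n] x = deriv g^[m] (g^[n] x) * deriv g^[n] x := by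
  rw [Function.iterate_add, deriv_comp x (smooth_differentiable (hg.iterate m).smooth _)
    (smooth_differentiable (hg.iterate n).smooth _)]

lemma deriv_iterate_succ (hg : IsLift g) (n : ℕ) (x : ℝ) :
    deriv g^[n + 1] x = deriv g (g^[n] x) * deriv g^[n] x := by
  rw [add_comm, hg.deriv_iterate_add 1 n x, Function.iterate_one]

lemma smooth_log_deriv (hg : IsLift g) : ContDiff ℝ ∞ fun x => Real.log (deriv g x) :=
  (smooth_deriv hg.smooth).log fun x => (hg.deriv_pos x).ne'

lemma log_deriv_iterate (hg : IsLift g) (n : ℕ) (x : ℝ) :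
    Real.log (deriv g^[n] x) = ∑ i ∈ Finset.range n, Real.log (deriv g (g^[i] x)) := by
  induction n with
  | zero => simp
  | succ n ih =>
    rw [Finset.sum_range_succ, hg.deriv_iterate_succ, Real.log_mul (hg.deriv_pos _).ne'
      ((hg.iterate n).deriv_pos _).ne', ih, add_comm]

end IsLift

/-- `K` bounds the derivative of the logarithm of the derivative of `g`. -/
def DistBound (g : ℝ → ℝ) (K : ℝ) : Prop :=
  ∀ x, |deriv (fun x => Real.log (deriv g x)) x| ≤ K

section

variable {g : ℝ → ℝ} {K : ℝ}

lemma DistBound.nonneg (hK : DistBound g K) : 0 ≤ K := (abs_nonneg _).trans (hK 0)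

lemma distortion (hg : IsLift g) (hK : DistBound g K) (n : ℕ) (x z : ℝ) :
    |Real.log (deriv g^[n] x) - Real.log (deriv g^[n] z)|
      ≤ K * ∑ i ∈ Finset.range n, |g^[i] x - g^[i] z| := by
  rw [hg.log_deriv_iterate, hg.log_deriv_iterate, ← Finset.sum_sub_distrib, Finset.mul_sum]
  refine (Finset.abs_sum_le_sum_abs _ _).trans (Finset.sum_le_sum fun i _ => ?_)
  exact abs_sub_le_of_deriv_le (u := fun x => Real.log (deriv g x))
    (smooth_differentiable hg.smooth_log_deriv) fun z _ => hK z

/-! ### Periodic orbits -/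

/-- `y` enumerates, in increasing order, a periodic orbit of `g` of rotation number `p / q`. -/
structure PerOrbit (g : ℝ → ℝ) (p : ℤ) (q : ℕ) (y : ℤ → ℝ) : Prop where
  lift : IsLift g
  q_pos : 0 < q
  coprime : IsCoprime p q
  mono : StrictMono y
  add_q : ∀ k, y (k + q) = y k + 1
  map : ∀ k, g (y k) = y (k + p)

lemma exists_perOrbit {p : ℤ} {q : ℕ} (hg : IsLift g) (hq : 0 < q) (hpq : IsCoprime p (q : ℤ))
    (h0 : g^[q] 0 = p) : ∃ y, PerOrbit g p q y := by
  obtain ⟨a', m', h'⟩ := hpq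
  obtain ⟨a, m, ha, ham⟩ : ∃ (a : ℕ) (m : ℤ), 0 < a ∧ a * p + m * q = 1 := by
    refine ⟨(a' % q).toNat + q, m' + (a' / q) * p - p, by omega, ?_⟩
    push_cast
    rw [Int.toNat_of_nonneg (Int.emod_nonneg _ (by omega))]
    have := Int.emod_add_mul_ediv a' q
    linear_combination h' + p * this
  have hG := hg.iterate a
  set Φ : ℝ → ℝ := fun x => g^[a] x + m with hΦ
  have hΦl : IsLift Φ := hG.add_const m
  have hmul : ∀ l : ℕ, g^[q * l] 0 = l * p := by
    intro l
    induction l with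
    | zero => simp
    | succ l ih =>
      rw [Nat.mul_succ, add_comm, Function.iterate_add_apply, ih]
      have := (hg.iterate q).add_int 0 (l * p)
      push_cast at this ⊢
      rw [zero_add] at this
      rw [this, h0]; ring
  have hΦn : ∀ (n : ℕ) (x : ℝ), Φ^[n] x = g^[a * n] x + n * m := by
    intro n x
    induction n with
    | zero => simp
    | succ n ih =>
      rw [Function.iterate_succ_apply', ih, hΦ]
      have := hG.add_int (g^[a * n] x) (n * m)
      push_cast at this ⊢
      simp only [this]
      rw [← Function.iterate_add_apply, Nat.mul_succ, add_comm a]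
      ring
  have hΦq : Φ^[q] 0 = 1 := by
    rw [hΦn, mul_comm a q, hmul]
    have : ((a * p + m * q : ℤ) : ℝ) = 1 := by rw [ham]; simp
    push_cast at this
    linarith
  have hq' : (q : ℤ) ≠ 0 := by omega
  set y : ℤ → ℝ := fun k => Φ^[(k % q).toNat] 0 + (k / q : ℤ) with hy
  have hyq : ∀ k, y (k + q) = y k + 1 := by
    intro k
    simp only [hy, Int.add_emod_right, Int.add_ediv_of_dvd_right (dvd_refl (q : ℤ)),
      Int.ediv_self hq']
    push_cast; ring
  have hsucc : ∀ k, y (k + 1) = Φ (y k) := by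
    intro k
    have h1 := Int.emod_nonneg k hq'
    have h2 := Int.emod_lt_of_pos k (by omega : (0 : ℤ) < q)
    have h3 := Int.emod_add_mul_ediv k q
    have hr : Φ (y k) = Φ^[(k % q).toNat + 1] 0 + (k / q : ℤ) := by
      simp only [hy]
      rw [hΦl.add_int, Function.iterate_succ_apply']
    rw [hr]
    by_cases hlt : k % q + 1 < q
    · have e1 : (k + 1) % q = k % q + 1 := by
        rw [Int.add_emod, Int.emod_eq_of_lt (by omega : (0 : ℤ) ≤ 1) (by omega),
          Int.emod_eq_of_lt (by omega) hlt]
      have e2 : (k + 1) / q = k / q := by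
        have := Int.emod_add_mul_ediv (k + 1) q
        rw [e1] at this
        have h4 : (q : ℤ) * ((k + 1) / q) = q * (k / q) := by linarith
        exact mul_left_cancel₀ hq' h4
      simp only [hy, e1, e2]
      rw [show (k % q + 1).toNat = (k % q).toNat + 1 by omega]
    · have e0 : k % q + 1 = q := by omega
      have e1 : k + 1 = q * (k / q + 1) := by linear_combination (-1) * h3 + e0
      have e2 : (k + 1) % q = 0 := by rw [e1]; simp
      have e3 : (k + 1) / q = k / q + 1 := by rw [e1]; exact Int.mul_ediv_cancel_left _ hq'
      simp only [hy, e2, e3]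
      rw [show (k % q).toNat + 1 = q by omega, hΦq]
      push_cast; simp; ring
  have hyn : ∀ (k : ℤ) (n : ℕ), y (k + n) = Φ^[n] (y k) := by
    intro k n
    induction n with
    | zero => simp
    | succ n ih => push_cast; rw [← add_assoc, hsucc, ih, Function.iterate_succ_apply']
  have hmono : StrictMono y := by
    refine strictMono_int_of_lt_succ fun k => ?_
    rw [hsucc]
    by_contra hle
    push Not at hle
    have : Φ^[q] (y k) ≤ y k := by
      have := hΦl.strictMono.monotone.antitone_iterate_of_map_le hle (Nat.zero_le q)
      simpa using this
    rw [← hyn, hyq] at this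
    linarith
  have hy0 : y 0 = 0 := by simp [hy]
  have hyint : ∀ (k : ℤ) (n : ℕ), y (k + n * q) = y k + n := by
    intro k n
    induction n with
    | zero => simp
    | succ n ih => push_cast; rw [add_mul, ← add_assoc, one_mul, hyq, ih]; ring
  have hcomm : ∀ x, g (Φ x) = Φ (g x) := by
    intro x
    simp only [hΦ]
    rw [hg.add_int, ← Function.iterate_succ_apply, ← Function.iterate_succ_apply' (f := g)]
  have hg0 : g (y 0) = y p := by
    obtain ⟨n, hn1, hn2⟩ : ∃ n : ℕ, 0 ≤ p + n * q ∧ 0 ≤ (a : ℤ) * n - m := by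
      refine ⟨p.natAbs + m.natAbs, ?_, ?_⟩
      · have h3 := neg_abs_le p
        have : (1 : ℤ) ≤ q := by omega
        push_cast; nlinarith [abs_nonneg m, abs_nonneg p]
      · have : (1 : ℤ) ≤ a := by omega
        have h3 := le_abs_self m
        push_cast; nlinarith [abs_nonneg m, abs_nonneg p]
    obtain ⟨N, hN⟩ := Int.eq_ofNat_of_zero_le hn1
    obtain ⟨l, hl⟩ := Int.eq_ofNat_of_zero_le hn2
    have e1 : a * N = q * l + 1 := by
      zify
      rw [← hN, ← hl]
      linear_combination ham
    have e2 := hyn 0 N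
    rw [hΦn, hy0, zero_add, e1, Function.iterate_succ_apply', hmul] at e2
    have e3 := hg.add_int 0 (l * p)
    push_cast at e3
    rw [zero_add] at e3
    rw [e3, ← hN, hyint] at e2
    rw [hy0]
    have e4 : ((N * m + l * p : ℤ) : ℝ) = n := by
      have : (N : ℤ) * m + l * p = n := by
        rw [← hN, ← hl]; linear_combination n * ham
      exact_mod_cast this
    push_cast at e4
    linarith
  refine ⟨y, hg, hq, ⟨a', m', h'⟩, hmono, hyq, fun k => ?_⟩
  induction k using Int.induction_on with
  | zero => simpa using hg0
  | succ k ih => rw [hsucc, hcomm, ih, ← hsucc]; congr 1; ring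
  | pred k ih =>
    apply hΦl.strictMono.injective
    rw [← hcomm, ← hsucc, ← hsucc]
    rw [show -(k : ℤ) - 1 + 1 = -k by ring, ih]
    congr 1; ring

end

/-- The first `n` multiples of `p` are `c`-separated modulo `q`. -/
def Sep (p : ℤ) (q n c : ℕ) : Prop :=
  ∀ i : ℕ, 0 < i → i < n → ∀ m : ℤ, (c : ℤ) ≤ |i * p + m * q|

lemma Sep.mono {p : ℤ} {q n n' c : ℕ} (h : Sep p q n c) (hn : n' ≤ n) : Sep p q n' c :=
  fun i hi hi' m => h i hi (hi'.trans_le hn) m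

namespace PerOrbit

variable {g : ℝ → ℝ} {p : ℤ} {q : ℕ} {y : ℤ → ℝ} {K : ℝ}

lemma iterate_map (h : PerOrbit g p q y) (i : ℕ) (k : ℤ) : g^[i] (y k) = y (k + i * p) := by
  induction i with
  | zero => simp
  | succ i ih => rw [Function.iterate_succ_apply', ih, h.map]; congr 1; push_cast; ring

lemma add_mul_q (h : PerOrbit g p q y) (k m : ℤ) : y (k + m * q) = y k + m := by
  induction m using Int.induction_on with
  | zero => simp
  | succ m ih =>
    rw [add_mul, ← add_assoc, one_mul, h.add_q, ih]; push_cast; ring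
  | pred m ih =>
    have := h.add_q (k + (-m - 1) * q)
    rw [show k + (-(m : ℤ) - 1) * q + q = k + -m * q by ring, ih] at this
    push_cast at this ⊢
    linarith

lemma gap_congr (h : PerOrbit g p q y) {a b : ℤ} (hab : (q : ℤ) ∣ a - b) (L : ℤ) :
    y (a + L) - y a = y (b + L) - y b := by
  obtain ⟨m, hm⟩ := hab
  obtain rfl : a = b + m * q := by linarith
  rw [h.add_mul_q, show b + m * q + L = b + L + m * q by ring, h.add_mul_q]; ring

lemma sum_range_gap (y : ℤ → ℝ) (k : ℤ) (L : ℕ) :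
    ∑ e ∈ Finset.range L, (y (k + e + 1) - y (k + e)) = y (k + L) - y k := by
  have := Finset.sum_range_sub (fun e : ℕ => y (k + e)) L
  simp only [Nat.cast_zero, add_zero, Nat.cast_add, Nat.cast_one, ← add_assoc] at this
  exact this

lemma gap_sum_le_one (h : PerOrbit g p q y) {ι : Type*} [DecidableEq ι] (s : Finset ι) (φ : ι → ℤ)
    (hφ : ∀ a ∈ s, ∀ b ∈ s, (q : ℤ) ∣ φ a - φ b → a = b) :
    ∑ a ∈ s, (y (φ a + 1) - y (φ a)) ≤ 1 := by
  have hq : (q : ℤ) ≠ 0 := by have := h.q_pos; omega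
  have hr : ∀ a, ((φ a % q).toNat : ℤ) = φ a % q := fun a =>
    Int.toNat_of_nonneg (Int.emod_nonneg _ hq)
  have hd : ∀ a, (q : ℤ) ∣ φ a - (φ a % q).toNat := fun a => by
    rw [hr]; exact Int.dvd_self_sub_emod
  have e : ∑ a ∈ s, (y (φ a + 1) - y (φ a))
      = ∑ j ∈ s.image (fun a => (φ a % q).toNat), (y (0 + j + 1) - y (0 + j)) := by
    rw [Finset.sum_image]
    · refine Finset.sum_congr rfl fun a _ => ?_
      rw [zero_add]
      exact h.gap_congr (hd a) 1
    · intro a ha b hb hab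
      refine hφ a ha b hb ?_
      have hab' : ((φ a % q).toNat : ℤ) = (φ b % q).toNat := by exact_mod_cast hab
      have := dvd_sub (hd a) (hd b)
      rwa [hab', sub_sub_sub_cancel_right] at this
  rw [e]
  calc _ ≤ ∑ j ∈ Finset.range q, (y (0 + j + 1) - y (0 + j)) := by
        refine Finset.sum_le_sum_of_subset_of_nonneg ?_ fun j _ _ => ?_
        · intro j hj
          obtain ⟨a, _, rfl⟩ := Finset.mem_image.1 hj
          rw [Finset.mem_range]
          have := Int.emod_lt_of_pos (φ a) (show (0 : ℤ) < q by have := h.q_pos; omega)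
          have := hr a
          omega
        · exact sub_nonneg.2 (h.mono.monotone (by omega))
    _ = 1 := by
        rw [sum_range_gap]
        have := h.add_q 0
        linarith

lemma sep_sum (h : PerOrbit g p q y) {n c : ℕ} (hs : Sep p q n c) (hc : c ≤ q) (k : ℤ) :
    ∑ i ∈ Finset.range n, (y (k + i * p + c) - y (k + i * p)) ≤ 1 := by
  have e : ∑ i ∈ Finset.range n, (y (k + i * p + c) - y (k + i * p))
      = ∑ a ∈ Finset.range n ×ˢ Finset.range c,
          (y (k + a.1 * p + a.2 + 1) - y (k + a.1 * p + a.2)) := by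
    rw [Finset.sum_product]
    exact Finset.sum_congr rfl fun i _ => (sum_range_gap y _ _).symm
  rw [e]
  refine h.gap_sum_le_one _ (fun a : ℕ × ℕ => k + a.1 * p + a.2) ?_
  have key : ∀ a b : ℕ × ℕ, a ∈ Finset.range n ×ˢ Finset.range c →
      b ∈ Finset.range n ×ˢ Finset.range c → b.1 ≤ a.1 →
      (q : ℤ) ∣ (k + a.1 * p + a.2) - (k + b.1 * p + b.2) → a = b := by
    rintro ⟨i, e⟩ ⟨i', e'⟩ ha hb hle ⟨m, hm⟩
    simp only [Finset.mem_product, Finset.mem_range] at ha hb hle hm ⊢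
    rcases hle.eq_or_lt with hE | hlt
    · subst hE
      have hm' : (e : ℤ) - e' = q * m := by linarith
      have : (e : ℤ) - e' = 0 := by
        refine Int.eq_zero_of_abs_lt_dvd (m := q) ⟨m, hm'⟩ ?_
        rw [abs_lt]; omega
      have : e = e' := by omega
      rw [this]
    · exfalso
      have := hs (i - i') (by omega) (by omega) (-m)
      rw [Nat.cast_sub hle, show ((i : ℤ) - i') * p + -m * q = e' - e by linarith] at this
      have h2 : |(e' : ℤ) - e| < c := by rw [abs_lt]; omega
      omega
  intro a ha b hb hd
  rcases le_total b.1 a.1 with hle | hle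
  · exact key a b ha hb hle hd
  · exact (key b a hb ha hle (by rw [← neg_sub]; exact (dvd_neg).2 hd)).symm

lemma sep_sum_mul (h : PerOrbit g p q y) {n c : ℕ} (hs : Sep p q n c) (hc : c ≤ q) (t : ℕ)
    (k : ℤ) : ∑ i ∈ Finset.range n, (y (k + i * p + t * c) - y (k + i * p)) ≤ t := by
  induction t with
  | zero => simp
  | succ t ih =>
    have := h.sep_sum hs hc (k + t * c)
    have e : ∀ i : ℕ, y (k + i * p + (t + 1 : ℕ) * c) - y (k + i * p)
        = (y (k + t * c + i * p + c) - y (k + t * c + i * p))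
          + (y (k + i * p + t * c) - y (k + i * p)) := by
      intro i
      rw [show k + (t : ℤ) * c + i * p = k + i * p + t * c by ring]
      rw [show k + i * p + ((t + 1 : ℕ) : ℤ) * c = k + i * p + t * c + c by push_cast; ring]
      ring
    simp_rw [e]
    rw [Finset.sum_add_distrib]
    push_cast
    linarith

lemma exists_index (h : PerOrbit g p q y) (x : ℝ) : ∃ k, y k ≤ x ∧ x < y (k + 1) := by
  have hz : ∀ m : ℤ, y (m * q) = y 0 + m := fun m => by
    have := h.add_mul_q 0 m
    rwa [zero_add] at this
  obtain ⟨k, hk, hk'⟩ := Int.exists_greatest_of_bdd (P := fun k => y k ≤ x)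
    ⟨⌈x - y 0⌉ * q, fun k hk => by
      have h1 : y k ≤ y (⌈x - y 0⌉ * q) := by
        rw [hz]; have := Int.le_ceil (x - y 0); linarith
      exact h.mono.le_iff_le.1 h1⟩
    ⟨⌊x - y 0⌋ * q, by rw [hz]; have := Int.floor_le (x - y 0); linarith⟩
  refine ⟨k, hk, ?_⟩
  by_contra hx
  have := hk' (k + 1) (not_lt.1 hx)
  omega

lemma iterate_mem (h : PerOrbit g p q y) (i : ℕ) {k l : ℤ} {x : ℝ} (hx : x ∈ Set.Icc (y k) (y l)) :
    g^[i] x ∈ Set.Icc (y (k + i * p)) (y (l + i * p)) := by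
  rw [← h.iterate_map, ← h.iterate_map]
  have := (h.lift.iterate i).strictMono.monotone
  exact ⟨this hx.1, this hx.2⟩

lemma sum_abs_sub_le (h : PerOrbit g p q y) {n c t : ℕ} (hs : Sep p q n c) (hc : c ≤ q) {k l : ℤ}
    (hl : l ≤ k + t * c) {x z : ℝ} (hx : x ∈ Set.Icc (y k) (y l)) (hz : z ∈ Set.Icc (y k) (y l)) :
    ∑ i ∈ Finset.range n, |g^[i] x - g^[i] z| ≤ t := by
  refine (Finset.sum_le_sum fun i _ => ?_).trans (h.sep_sum_mul hs hc t k)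
  have h1 := h.iterate_mem i hx
  have h2 := h.iterate_mem i hz
  have h3 : y (l + i * p) ≤ y (k + i * p + t * c) := h.mono.monotone (by omega)
  exact (Set.abs_sub_le_of_uIcc_subset_uIcc (Set.uIcc_subset_Icc h2 h1 |>.trans
    Set.Icc_subset_uIcc)).trans (by
      rw [abs_of_nonneg (by linarith [h1.1, h1.2])]; linarith)

lemma dist_le (h : PerOrbit g p q y) (hK : DistBound g K) {n c t : ℕ} (hs : Sep p q n c)
    (hc : c ≤ q) {k l : ℤ} (hl : l ≤ k + t * c) {x z : ℝ} (hx : x ∈ Set.Icc (y k) (y l))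
    (hz : z ∈ Set.Icc (y k) (y l)) :
    |Real.log (deriv g^[n] x) - Real.log (deriv g^[n] z)| ≤ K * t :=
  (distortion h.lift hK n x z).trans
    (mul_le_mul_of_nonneg_left (h.sum_abs_sub_le hs hc hl hx hz) hK.nonneg)

lemma sep_one (h : PerOrbit g p q y) : Sep p q q 1 := by
  intro i hi hi' m
  rw [Nat.cast_one]
  refine Int.one_le_abs fun h0 => ?_
  have h1 : (q : ℤ) ∣ i * p := ⟨-m, by linarith⟩
  have h2 : (q : ℤ) ∣ i := h.coprime.symm.dvd_of_dvd_mul_right h1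
  have := Int.le_of_dvd (by omega) h2
  omega

end PerOrbit

/-- The distance from `j * p` to the multiples of `q`. -/
noncomputable def nrm (p : ℤ) (q j : ℕ) : ℕ := sInf (Set.range fun m : ℤ => (j * p + m * q).natAbs)

lemma nrm_le (p : ℤ) (q j : ℕ) (m : ℤ) : (nrm p q j : ℤ) ≤ |j * p + m * q| := by
  rw [Int.abs_eq_natAbs]
  exact_mod_cast Nat.sInf_le (Set.mem_range_self m)

lemma exists_nrm (p : ℤ) (q j : ℕ) : ∃ m : ℤ, |j * p + m * q| = nrm p q j := by
  obtain ⟨m, hm⟩ := Nat.sInf_mem (Set.range_nonempty fun m : ℤ => (j * p + m * q).natAbs)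
  refine ⟨m, ?_⟩
  rw [Int.abs_eq_natAbs]
  exact_mod_cast hm

lemma nrm_lt (p : ℤ) {q : ℕ} (hq : 0 < q) (j : ℕ) : nrm p q j < q := by
  have h := nrm_le p q j (-(j * p / q))
  have h1 := Int.emod_add_mul_ediv (j * p) q
  have h2 := Int.emod_nonneg (j * p) (show (q : ℤ) ≠ 0 by omega)
  have h3 := Int.emod_lt_of_pos (j * p) (show (0 : ℤ) < q by omega)
  rw [show (j : ℤ) * p + -(j * p / q) * q = j * p % q by linear_combination -h1,
    abs_of_nonneg h2] at h
  omega

/-- `b` is a time of best approach. -/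
structure IsRecord (p : ℤ) (q b : ℕ) : Prop where
  pos : 0 < b
  lt : b < q
  nrm_lt : ∀ i, 0 < i → i < b → nrm p q b < nrm p q i

/-- The optimal separation of the first `n` multiples of `p` is `q` or is attained at a record. -/
lemma exists_sep (p : ℤ) {q n : ℕ} (hq : 0 < q) (hn : 0 < n) (hnq : n ≤ q) :
    ∃ c a, Sep p q n c ∧ c ≤ q ∧ a < n ∧ (∃ m : ℤ, |a * p + m * q| = c) ∧
      (c = q ∨ (IsRecord p q a ∧ nrm p q a = c)) := by
  by_cases hn1 : n = 1
  · subst hn1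
    exact ⟨q, 0, fun i hi hi' => by omega, le_rfl, hn, ⟨1, by simp⟩, Or.inl rfl⟩
  · obtain ⟨a₀, ha₀, hmin⟩ := Finset.exists_min_image (Finset.Ioo 0 n) (nrm p q)
      ⟨1, by rw [Finset.mem_Ioo]; omega⟩
    rw [Finset.mem_Ioo] at ha₀
    have hex : ∃ a, 0 < a ∧ a < n ∧ nrm p q a = nrm p q a₀ := ⟨a₀, ha₀.1, ha₀.2, rfl⟩
    classical
    obtain ⟨h1, h2, h3⟩ := Nat.find_spec hex
    refine ⟨nrm p q a₀, Nat.find hex, fun i hi hi' m => ?_, (nrm_lt p hq a₀).le, h2, ?_,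
      Or.inr ⟨⟨h1, by omega, fun i hi hi' => ?_⟩, h3⟩⟩
    · have := hmin i (by rw [Finset.mem_Ioo]; omega)
      have := nrm_le p q i m
      omega
    · obtain ⟨m, hm⟩ := exists_nrm p q (Nat.find hex)
      exact ⟨m, by rw [hm]; exact_mod_cast h3⟩
    · have hle := hmin i (by rw [Finset.mem_Ioo]; omega)
      rw [h3]
      refine lt_of_le_of_ne hle fun he => ?_
      exact Nat.find_min hex hi' ⟨hi, by omega, he.symm⟩

namespace PerOrbit

variable {g : ℝ → ℝ} {p : ℤ} {q : ℕ} {y : ℤ → ℝ} {K : ℝ}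

lemma nrm_pos (h : PerOrbit g p q y) {b : ℕ} (hb : 0 < b) (hbq : b < q) : 0 < nrm p q b := by
  obtain ⟨m, hm⟩ := exists_nrm p q b
  have := h.sep_one b hb hbq m
  omega

lemma syndetic (h : PerOrbit g p q y) {b c a : ℕ} (hb : IsRecord p q b) (hc : c ≤ q)
    (ha : a < b) (hac : ∃ m : ℤ, |a * p + m * q| = c) (hbc : nrm p q b < c) (k k' : ℤ) :
    ∃ (j : ℕ) (m : ℤ), j < b ∧ k' - 2 * c ≤ k + j * p + m * q ∧ k + j * p + m * q ≤ k' := by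
  have hq := h.q_pos
  obtain ⟨s, ⟨j, m, hj, rfl, hs⟩, hmax⟩ := Int.exists_greatest_of_bdd
    (P := fun s => ∃ (j : ℕ) (m : ℤ), j < b ∧ s = k + j * p + m * q ∧ s ≤ k')
    ⟨k', fun s ⟨_, _, _, _, hs⟩ => hs⟩
    ⟨k + (0 : ℕ) * p + (-(|k| + |k'|)) * q, 0, _, hb.pos, rfl, by
      have h1 := le_abs_self k
      have h2 := neg_abs_le k'
      have h3 : (1 : ℤ) ≤ q := by omega
      push_cast
      nlinarith [abs_nonneg k, abs_nonneg k']⟩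
  refine ⟨j, m, hj, ?_, hs⟩
  obtain ⟨ma, hma⟩ := hac
  obtain ⟨mb, hmb⟩ := exists_nrm p q b
  by_contra hlt
  push Not at hlt
  have step : ∀ (j' : ℕ) (m' : ℤ), j' < b → 0 < k + j' * p + m' * q - (k + j * p + m * q) →
      k + j' * p + m' * q - (k + j * p + m * q) ≤ 2 * c → False := by
    intro j' m' hj' h1 h2
    have := hmax (k + j' * p + m' * q) ⟨j', m', hj', rfl, by omega⟩
    omega
  have hbc' : |(b : ℤ) * p + mb * q| < c := by omega
  rw [abs_lt] at hbc'
  rcases abs_choice ((a : ℤ) * p + ma * q) with he | he <;> rw [he] at hma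
  · by_cases hjb : j + a < b
    · apply step (j + a) (m + ma) hjb <;> push_cast <;> nlinarith
    · apply step (j + a - b) (m + ma - mb) (by omega) <;>
        rw [Nat.cast_sub (by omega)] <;> push_cast <;> nlinarith
  · by_cases hjb : a ≤ j
    · apply step (j - a) (m - ma) (by omega) <;> rw [Nat.cast_sub hjb] <;> nlinarith
    · apply step (j + b - a) (m - ma + mb) (by omega) <;>
        rw [Nat.cast_sub (by omega)] <;> push_cast <;> nlinarith

/-- Denjoy's inequality at record times. -/
lemma denjoy (h : PerOrbit g p q y) (hK : DistBound g K) {b : ℕ} (hb : IsRecord p q b) (x : ℝ) :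
    |Real.log (deriv g^[b] x)| ≤ 5 * K := by
  have hK0 := hK.nonneg
  obtain ⟨c, a, hs, hc, ha, hac, hor⟩ := exists_sep p h.q_pos hb.pos hb.lt.le
  have hbc : nrm p q b < c := by
    rcases hor with rfl | ⟨hr, rfl⟩
    · exact nrm_lt p h.q_pos b
    · exact hb.nrm_lt a hr.pos ha
  obtain ⟨x₀, hx₀⟩ : ∃ x₀, deriv g^[b] x₀ = 1 := by
    have hl := h.lift.iterate b
    obtain ⟨z, _, hz⟩ := exists_deriv_eq_slope g^[b] (zero_lt_one' ℝ)
      hl.smooth.continuous.continuousOn (smooth_differentiable hl.smooth).differentiableOn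
    refine ⟨z, ?_⟩
    have := hl.add_one 0
    rw [zero_add] at this
    rw [hz, this]; simp
  obtain ⟨k, hk, hk'⟩ := h.exists_index x
  obtain ⟨k₀, hk₀, hk₀'⟩ := h.exists_index x₀
  obtain ⟨j, m, hj, hj1, hj2⟩ := h.syndetic hb hc ha hac hbc k k₀
  have hper : ∀ (n : ℕ) (x : ℝ) (m : ℤ), deriv g^[n] (x + m) = deriv g^[n] x := by
    intro n x m
    have : (fun z => g^[n] (z + m)) = fun z => g^[n] z + m :=
      funext fun z => (h.lift.iterate n).add_int z m
    rw [← deriv_comp_add_const, this, deriv_add_const]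
  -- the point `g^j x + m` is close to `x₀`
  have d1 : |Real.log (deriv g^[b] (g^[j] x)) - Real.log (deriv g^[b] x₀)| ≤ K * (3 : ℕ) := by
    rw [← hper b (g^[j] x) m]
    have hx := h.iterate_mem j (k := k) (l := k + 1) ⟨hk, hk'.le⟩
    refine h.dist_le hK hs hc (k := k₀ - 2 * c) (l := k₀ + 1) (by push_cast; omega) ⟨?_, ?_⟩
      ⟨?_, ?_⟩
    · refine le_trans ?_ (add_le_add_left hx.1 m)
      rw [← h.add_mul_q]; exact h.mono.monotone (by omega)
    · refine le_trans (add_le_add_left hx.2 m) ?_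
      rw [← h.add_mul_q]; exact h.mono.monotone (by omega)
    · exact le_trans (h.mono.monotone (by omega)) hk₀
    · exact hk₀'.le
  rw [hx₀, Real.log_one, sub_zero] at d1
  -- the point `g^b x` is close to `x`
  obtain ⟨mb, hmb⟩ := exists_nrm p q b
  have hmb' : |(b : ℤ) * p + mb * q| < c := by omega
  rw [abs_lt] at hmb'
  have d2 : |Real.log (deriv g^[j] x) - Real.log (deriv g^[j] (g^[b] x))| ≤ K * (2 : ℕ) := by
    rw [← hper j (g^[b] x) mb]
    have hx := h.iterate_mem b (k := k) (l := k + 1) ⟨hk, hk'.le⟩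
    have hx1 : y (k + b * p + mb * q) ≤ g^[b] x + mb := by
      rw [h.add_mul_q]; exact add_le_add_left hx.1 _
    have hx2 : g^[b] x + mb ≤ y (k + 1 + b * p + mb * q) := by
      rw [h.add_mul_q]; exact add_le_add_left hx.2 _
    rcases le_total 0 ((b : ℤ) * p + mb * q) with hpos | hneg
    · refine h.dist_le hK (hs.mono hj.le) hc (k := k) (l := k + 1 + b * p + mb * q)
        (by push_cast; omega) ⟨hk, hk'.le.trans (h.mono.monotone (by omega))⟩
        ⟨(h.mono.monotone (by omega)).trans hx1, hx2⟩
    · refine h.dist_le hK (hs.mono hj.le) hc (k := k + b * p + mb * q) (l := k + 1)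
        (by push_cast; omega) ⟨(h.mono.monotone (by omega)).trans hk, hk'.le⟩
        ⟨hx1, hx2.trans (h.mono.monotone (by omega))⟩
  have e1 := h.lift.deriv_iterate_add b j x
  have e2 := h.lift.deriv_iterate_add j b x
  rw [add_comm, e1] at e2
  have e3 := congrArg Real.log e2
  rw [Real.log_mul ((h.lift.iterate _).deriv_pos _).ne' ((h.lift.iterate _).deriv_pos _).ne',
    Real.log_mul ((h.lift.iterate _).deriv_pos _).ne' ((h.lift.iterate _).deriv_pos _).ne'] at e3
  push_cast at d1 d2
  rw [abs_le] at d1 d2 ⊢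
  constructor <;> linarith [d1.1, d1.2, d2.1, d2.2]

end PerOrbit

/-- The nonlinearity of the iterate `g^n`. -/
noncomputable def nonlin (g : ℝ → ℝ) (n : ℕ) (x : ℝ) : ℝ :=
  ∑ i ∈ Finset.range n, deriv (fun z => Real.log (deriv g z)) (g^[i] x) * deriv g^[i] x

lemma IsLift.hasDerivAt_log {g : ℝ → ℝ} (hg : IsLift g) (n : ℕ) (x : ℝ) :
    HasDerivAt (fun z => Real.log (deriv g^[n] z)) (nonlin g n x) x := by
  have e : (fun z => Real.log (deriv g^[n] z))
      = fun z => ∑ i ∈ Finset.range n, Real.log (deriv g (g^[i] z)) :=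
    funext fun z => hg.log_deriv_iterate n z
  rw [e]
  exact HasDerivAt.fun_sum fun i _ =>
    ((smooth_differentiable hg.smooth_log_deriv _).hasDerivAt).comp x
      (smooth_differentiable (hg.iterate i).smooth x).hasDerivAt

lemma IsLift.hasDerivAt_deriv_iterate {g : ℝ → ℝ} (hg : IsLift g) (n : ℕ) (x : ℝ) :
    HasDerivAt (deriv g^[n]) (deriv g^[n] x * nonlin g n x) x := by
  have h1 := (hg.hasDerivAt_log n x).exp
  have e : (fun z => Real.exp (Real.log (deriv g^[n] z))) = deriv g^[n] :=
    funext fun z => Real.exp_log ((hg.iterate n).deriv_pos z)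
  rwa [e, Real.exp_log ((hg.iterate n).deriv_pos x)] at h1

/-- Neighbouring blocks of `L` gaps have comparable lengths. -/
def Cmp (y : ℤ → ℝ) (L : ℕ) (V : ℝ) : Prop :=
  ∀ k : ℤ, y (k + L + L) - y (k + L) ≤ Real.exp V * (y (k + L) - y k) ∧
    y (k + L) - y k ≤ Real.exp V * (y (k + L + L) - y (k + L))

/-- A nonnegative function with bounded second derivative has a small derivative where it is
small. -/
lemma abs_deriv_le_of_nonneg {ψ : ℝ → ℝ} (hψ : Differentiable ℝ ψ)
    (hψ' : Differentiable ℝ (deriv ψ)) {x δ M : ℝ} (hδ : 0 < δ)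
    (h0 : ∀ z ∈ Set.Icc (x - δ) (x + δ), 0 ≤ ψ z)
    (hM : ∀ z ∈ Set.Icc (x - δ) (x + δ), |deriv (deriv ψ) z| ≤ M) :
    |deriv ψ x| ≤ ψ x / δ + M * δ := by
  have hM0 : 0 ≤ M := (abs_nonneg _).trans (hM x ⟨by linarith, by linarith⟩)
  have key : ∀ z ∈ Set.Icc (x - δ) (x + δ), |deriv ψ z - deriv ψ x| ≤ M * δ := by
    intro z hz
    refine (abs_sub_le_of_deriv_le hψ' (C := M) fun w hw => hM w ?_).trans ?_
    · exact Set.uIcc_subset_Icc hz ⟨by linarith, by linarith⟩ hw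
    · refine mul_le_mul_of_nonneg_left ?_ hM0
      rw [abs_le]; constructor <;> linarith [hz.1, hz.2]
  obtain ⟨z₁, hz₁, e₁⟩ := exists_deriv_eq_slope ψ (show x - δ < x by linarith)
    hψ.continuous.continuousOn hψ.differentiableOn
  obtain ⟨z₂, hz₂, e₂⟩ := exists_deriv_eq_slope ψ (show x < x + δ by linarith)
    hψ.continuous.continuousOn hψ.differentiableOn
  have k₁ := abs_le.1 (key z₁ ⟨hz₁.1.le, by linarith [hz₁.2]⟩)
  have k₂ := abs_le.1 (key z₂ ⟨by linarith [hz₂.1], hz₂.2.le⟩)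
  have p₁ := h0 (x - δ) ⟨le_rfl, by linarith⟩
  have p₂ := h0 (x + δ) ⟨by linarith, le_rfl⟩
  rw [show x - (x - δ) = δ by ring, sub_div] at e₁
  rw [show x + δ - x = δ by ring, sub_div] at e₂
  have q₁ : 0 ≤ ψ (x - δ) / δ := by positivity
  have q₂ : 0 ≤ ψ (x + δ) / δ := by positivity
  rw [abs_le]
  constructor <;> linarith [k₁.1, k₁.2, k₂.1, k₂.2]

namespace PerOrbit

variable {g : ℝ → ℝ} {p : ℤ} {q : ℕ} {y : ℤ → ℝ} {K : ℝ}

lemma record_image (h : PerOrbit g p q y) (hK : DistBound g K) {b : ℕ} (hb : IsRecord p q b)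
    (k : ℤ) (L : ℕ) :
    y (k + b * p + L) - y (k + b * p) ≤ Real.exp (5 * K) * (y (k + L) - y k) ∧
    y (k + L) - y k ≤ Real.exp (5 * K) * (y (k + b * p + L) - y (k + b * p)) := by
  rcases Nat.eq_zero_or_pos L with rfl | hL
  · simp
  have hl := h.lift.iterate b
  have hlt : y k < y (k + L) := h.mono (by omega)
  obtain ⟨z, hz, e⟩ := exists_deriv_eq_slope g^[b] hlt
      hl.smooth.continuous.continuousOn (smooth_differentiable hl.smooth).differentiableOn
  rw [h.iterate_map, h.iterate_map, show k + L + b * p = k + b * p + L by ring,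
    eq_div_iff (by linarith)] at e
  have hd := abs_le.1 (h.denjoy hK hb z)
  have hpos := hl.deriv_pos z
  have h1 : deriv g^[b] z ≤ Real.exp (5 * K) := (Real.log_le_iff_le_exp hpos).1 hd.2
  have h2 : Real.exp (-(5 * K)) ≤ deriv g^[b] z := (Real.le_log_iff_exp_le hpos).1 hd.1
  rw [← e]
  refine ⟨mul_le_mul_of_nonneg_right h1 (by linarith), ?_⟩
  rw [← mul_assoc]
  refine le_mul_of_one_le_left (by linarith) ?_
  calc (1 : ℝ) = Real.exp (5 * K) * Real.exp (-(5 * K)) := by rw [← Real.exp_add]; simp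
    _ ≤ _ := by gcongr

lemma cmp_record (h : PerOrbit g p q y) (hK : DistBound g K) {b : ℕ} (hb : IsRecord p q b) :
    Cmp y (nrm p q b) (5 * K) := by
  intro k
  obtain ⟨m, hm⟩ := exists_nrm p q b
  set e := nrm p q b
  rcases abs_choice ((b : ℤ) * p + m * q) with he | he <;> rw [he] at hm
  · have := h.record_image hK hb k e
    rwa [h.gap_congr (a := k + b * p) (b := k + e) ⟨-m, by linarith⟩] at this
  · have := h.record_image hK hb (k + e) e
    rw [h.gap_congr (a := k + e + b * p) (b := k) ⟨-m, by linarith⟩] at this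
    exact ⟨this.2, this.1⟩

lemma cmp_q (h : PerOrbit g p q y) (hK : DistBound g K) : Cmp y q (5 * K) := by
  intro k
  rw [h.add_q, h.add_q]
  have : 1 ≤ Real.exp (5 * K) := Real.one_le_exp (by linarith [hK.nonneg])
  constructor <;> linarith

lemma sep_sum_two (h : PerOrbit g p q y) {n c b : ℕ} (hs : Sep p q n c) (hc : c ≤ q)
    (hb : b ≤ 2 * n) (t : ℕ) (k : ℤ) :
    ∑ i ∈ Finset.range b, (y (k + i * p + t * c) - y (k + i * p)) ≤ 2 * t := by
  have hnn : ∀ i : ℕ, 0 ≤ y (k + i * p + t * c) - y (k + i * p) := fun i =>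
    sub_nonneg.2 (h.mono.monotone (by have : (0 : ℤ) ≤ t * c := by positivity
                                      omega))
  calc _ ≤ ∑ i ∈ Finset.range (n + n), (y (k + i * p + t * c) - y (k + i * p)) :=
        Finset.sum_le_sum_of_subset_of_nonneg (Finset.range_mono (by omega)) fun i _ _ => hnn i
    _ = _ := Finset.sum_range_add _ n n
    _ ≤ _ := by
      have h1 := h.sep_sum_mul hs hc t k
      have h2 := h.sep_sum_mul hs hc t (k + n * p)
      have e : ∀ i : ℕ, k + n * p + i * p = k + ((n + i : ℕ) : ℤ) * p := fun i => by
        push_cast; ring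
      simp_rw [e] at h2
      linarith

/-- Derivative bounds for `g^b` on an interval with controlled total length of images. -/
lemma nonlin_le (h : PerOrbit g p q y) (hK : DistBound g K) {b : ℕ} {k l : ℤ} (hkl : k < l) {S : ℝ}
    (hS : ∑ i ∈ Finset.range b, (y (l + i * p) - y (k + i * p)) ≤ S) {x : ℝ}
    (hx : x ∈ Set.Icc (y k) (y l)) :
    |nonlin g b x| ≤ K * (Real.exp (K * S) * S / (y l - y k)) := by
  have hlt := h.mono hkl
  have hnn : ∀ i : ℕ, 0 ≤ y (l + i * p) - y (k + i * p) := fun i =>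
    sub_nonneg.2 (h.mono.monotone (by omega))
  have hD : ∀ i ∈ Finset.range b,
      deriv g^[i] x ≤ Real.exp (K * S) * (y (l + i * p) - y (k + i * p)) / (y l - y k) := by
    intro i hi
    rw [Finset.mem_range] at hi
    have hl := h.lift.iterate i
    obtain ⟨z, hz, e⟩ := exists_deriv_eq_slope g^[i] hlt
      hl.smooth.continuous.continuousOn (smooth_differentiable hl.smooth).differentiableOn
    have hdist := distortion h.lift hK i x z
    have hsum : ∑ j ∈ Finset.range i, |g^[j] x - g^[j] z| ≤ S := by
      refine le_trans ?_ hS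
      refine le_trans (Finset.sum_le_sum fun j _ => ?_)
        (Finset.sum_le_sum_of_subset_of_nonneg (Finset.range_mono hi.le) fun j _ _ => hnn j)
      have h1 := h.iterate_mem j hx
      have h2 := h.iterate_mem j (k := k) (l := l) ⟨hz.1.le, hz.2.le⟩
      rw [abs_le]; constructor <;> linarith [h1.1, h1.2, h2.1, h2.2]
    have h3 := (abs_le.1 (hdist.trans (mul_le_mul_of_nonneg_left hsum hK.nonneg))).2
    have h4 : deriv g^[i] x ≤ Real.exp (K * S) * deriv g^[i] z := by
      rw [← Real.log_le_log_iff (hl.deriv_pos x) (mul_pos (Real.exp_pos _) (hl.deriv_pos z)),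
        Real.log_mul (Real.exp_pos _).ne' (hl.deriv_pos z).ne', Real.log_exp]
      linarith
    rwa [e, h.iterate_map, h.iterate_map, ← mul_div_assoc] at h4
  calc |nonlin g b x| ≤ ∑ i ∈ Finset.range b,
        K * (Real.exp (K * S) * (y (l + i * p) - y (k + i * p)) / (y l - y k)) := by
        refine (Finset.abs_sum_le_sum_abs _ _).trans (Finset.sum_le_sum fun i hi => ?_)
        rw [abs_mul, abs_of_pos ((h.lift.iterate i).deriv_pos x)]
        exact mul_le_mul (hK _) (hD i hi) ((h.lift.iterate i).deriv_pos x).le hK.nonneg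
    _ = K * (Real.exp (K * S) * (∑ i ∈ Finset.range b, (y (l + i * p) - y (k + i * p)))
          / (y l - y k)) := by
        rw [← Finset.mul_sum, ← Finset.sum_div, ← Finset.mul_sum]
    _ ≤ _ := by
        have := hK.nonneg
        have : 0 < y l - y k := by linarith
        gcongr

end PerOrbit

/-- A positive function with bounded second derivative has a Lipschitz square root. -/
lemma sqrt_lipschitz {ψ : ℝ → ℝ} (hψ : Differentiable ℝ ψ) (hψ' : Differentiable ℝ (deriv ψ))
    {A B Λ E M : ℝ} (hΛ : 0 < Λ) (hE : 1 ≤ E)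
    (hpos : ∀ z, 0 < ψ z)
    (hM : ∀ z ∈ Set.Icc (A - Λ / E ^ 2) (B + Λ / E ^ 2), |deriv (deriv ψ) z| ≤ M / Λ)
    (hW : ∀ z ∈ Set.Icc A B, ψ z ≤ (2 * E) ^ 2 * Λ) {a b : ℝ} (ha : a ∈ Set.Icc A B)
    (hb : b ∈ Set.Icc A B) :
    |√(ψ a) - √(ψ b)| ≤ (E ^ 3 + M) / √Λ * |a - b| := by
  have hE0 : 0 < E := by linarith
  have hM0 : 0 ≤ M := by
    have h1 := hM a ⟨by have : 0 < Λ / E ^ 2 := by positivity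
                        linarith [ha.1], by have : 0 < Λ / E ^ 2 := by positivity
                                            linarith [ha.2]⟩
    have h2 := (abs_nonneg _).trans h1
    by_contra hneg
    exact absurd h2 (not_le.2 (div_neg_of_neg_of_pos (not_le.1 hneg) hΛ))
  have hder : ∀ z, HasDerivAt (fun x => √(ψ x)) (deriv ψ z / (2 * √(ψ z))) z := fun z =>
    (hψ z).hasDerivAt.sqrt (hpos z).ne'
  refine abs_sub_le_of_deriv_le (u := fun x => √(ψ x)) (fun z => (hder z).differentiableAt)
    (fun z hz => ?_)
  have hz' : z ∈ Set.Icc A B := Set.uIcc_subset_Icc ha hb hz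
  rw [(hder z).deriv]
  set s := √(ψ z) with hs
  set l := √Λ with hl
  have hs0 : 0 < s := Real.sqrt_pos.2 (hpos z)
  have hl0 : 0 < l := Real.sqrt_pos.2 hΛ
  have hss : s ^ 2 = ψ z := Real.sq_sqrt (hpos z).le
  have hll : l ^ 2 = Λ := Real.sq_sqrt hΛ.le
  have hsl : s ≤ 2 * E * l := by
    refine le_of_sq_le_sq (by rw [mul_pow, hss, hll]; exact hW z hz') (by positivity)
  set δ := l * s / (2 * E ^ 3) with hδ
  have hδ0 : 0 < δ := by positivity
  have hδle : δ ≤ Λ / E ^ 2 := by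
    rw [hδ, ← hll, div_le_div_iff₀ (by positivity) (by positivity)]
    calc l * s * E ^ 2 ≤ l * (2 * E * l) * E ^ 2 := by gcongr
      _ = _ := by ring
  have key := abs_deriv_le_of_nonneg hψ hψ' hδ0 (M := M / Λ) (x := z)
    (fun w _ => (hpos w).le)
    (fun w hw => hM w ⟨by linarith [hw.1, hz'.1], by linarith [hw.2, hz'.2]⟩)
  rw [abs_div, abs_of_pos (show 0 < 2 * s by positivity), div_le_iff₀ (by positivity)]
  refine key.trans ?_
  rw [← hss, ← hll, hδ]
  have e1 : s ^ 2 / (l * s / (2 * E ^ 3)) = 2 * E ^ 3 * (s / l) := by field_simp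
  have e2 : M / l ^ 2 * (l * s / (2 * E ^ 3)) = M * (s / l) * (1 / (2 * E ^ 3)) := by field_simp
  have e3 : (E ^ 3 + M) / l * (2 * s) = 2 * E ^ 3 * (s / l) + M * (s / l) * 2 := by
    field_simp
  rw [e1, e2, e3]
  have : 1 / (2 * E ^ 3) ≤ 2 := by
    rw [div_le_iff₀ (by positivity)]
    have : 1 ≤ E ^ 3 := one_le_pow₀ hE
    linarith
  gcongr

/-- Constant in the slow variation estimate for record displacements. -/
noncomputable def slowConst (K : ℝ) : ℝ :=
  Real.exp (5 * K) * (Real.exp (5 * K) ^ 3 + Real.exp (5 * K) * (K * (Real.exp (K * 8) * 8)))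

lemma slowConst_ge {K : ℝ} (hK : 0 ≤ K) : 1 ≤ slowConst K := by
  have h1 : 1 ≤ Real.exp (5 * K) := Real.one_le_exp (by linarith)
  have h2 : 1 ≤ Real.exp (5 * K) ^ 3 := one_le_pow₀ h1
  have h3 : 0 ≤ Real.exp (5 * K) * (K * (Real.exp (K * 8) * 8)) := by positivity
  unfold slowConst
  nlinarith

lemma abs_inv_sqrt_sub_le {Q Q' C E : ℝ} (hQ : 0 < Q) (hQ' : 0 < Q') (hE : 1 ≤ E)
    (h1 : Q ≤ E * Q') (h2 : Q' ≤ E * Q) {D : ℝ} (hC : 0 ≤ C)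
    (h : |√Q - √Q'| ≤ C * D) (hD : D = Q ∨ D = Q') :
    |1 / √Q' - 1 / √Q| ≤ E * C := by
  have a0 : 0 < √Q := Real.sqrt_pos.2 hQ
  have b0 : 0 < √Q' := Real.sqrt_pos.2 hQ'
  have a2 : √Q ^ 2 = Q := Real.sq_sqrt hQ.le
  have b2 : √Q' ^ 2 = Q' := Real.sq_sqrt hQ'.le
  set a := √Q
  set b := √Q'
  have hEE : E ≤ E ^ 2 := by nlinarith
  have hab : a ≤ E * b := by
    refine le_of_sq_le_sq ?_ (by positivity)
    rw [mul_pow, a2, b2]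
    exact h1.trans (by gcongr)
  have hba : b ≤ E * a := by
    refine le_of_sq_le_sq ?_ (by positivity)
    rw [mul_pow, a2, b2]
    exact h2.trans (by gcongr)
  have hD' : D ≤ E * (a * b) := by
    rcases hD with rfl | rfl
    · rw [← a2]; nlinarith
    · rw [← b2]; nlinarith
  have e : 1 / b - 1 / a = (a - b) / (a * b) := by field_simp
  rw [e, abs_div, abs_of_pos (mul_pos a0 b0), div_le_iff₀ (mul_pos a0 b0)]
  calc |a - b| ≤ C * D := h
    _ ≤ C * (E * (a * b)) := by gcongr
    _ = _ := by ring

namespace PerOrbit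

variable {g : ℝ → ℝ} {p : ℤ} {q : ℕ} {y : ℤ → ℝ} {K : ℝ}

lemma slow_variation (h : PerOrbit g p q y) (hK : DistBound g K) {b n c : ℕ} (hb : IsRecord p q b)
    (hs : Sep p q n c) (hc : c ≤ q) (hbn : b ≤ 2 * n) (hec : nrm p q b ≤ c)
    (hcmp : Cmp y c (5 * K)) {k j : ℤ} (hkj : k ≤ j)
    (hj : j + nrm p q b + nrm p q b ≤ k + c + c) :
    |1 / √(y (j + nrm p q b + nrm p q b) - y (j + nrm p q b)) - 1 / √(y (j + nrm p q b) - y j)|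
      ≤ slowConst K / √(y (k + c) - y k) := by
  have hK0 := hK.nonneg
  obtain ⟨m, hm⟩ := exists_nrm p q b
  have hepos := h.nrm_pos hb.pos hb.lt
  have hcmpe := h.cmp_record hK hb j
  set e := nrm p q b with he
  set E := Real.exp (5 * K) with hEdef
  have hE : 1 ≤ E := Real.one_le_exp (by linarith)
  have hE0 : 0 < E := by linarith
  set Λ := y (k + c) - y k with hΛdef
  have hΛ : 0 < Λ := sub_pos.2 (h.mono (by omega))
  set M := E * (K * (Real.exp (K * 8) * 8)) with hMdef
  have hM0 : 0 ≤ M := by positivity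
  -- the four blocks
  have B0 := hcmp (k - c)
  rw [sub_add_cancel] at B0
  have B1 := hcmp k
  have B2 := hcmp (k + c)
  rw [← hEdef] at B0 B1 B2
  set X := y k - y (k - c)
  set Y1 := y (k + c + c) - y (k + c)
  set Y2 := y (k + c + c + c) - y (k + c + c)
  have hX1 : Λ / E ^ 2 ≤ X := by
    rw [div_le_iff₀ (by positivity)]
    have : 0 ≤ X := sub_nonneg.2 (h.mono.monotone (by omega))
    nlinarith [B0.1]
  have hY2 : Λ / E ^ 2 ≤ Y2 := by
    rw [div_le_iff₀ (by positivity)]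
    calc Λ ≤ E * Y1 := B1.2
      _ ≤ E * (E * Y2) := by gcongr; exact B2.2
      _ = _ := by ring
  have hEE : E ≤ E ^ 2 := by nlinarith
  have hE2 : 1 ≤ E ^ 2 := by nlinarith
  have hXu : X ≤ E ^ 2 * Λ := B0.2.trans (by gcongr)
  have hY1u : Y1 ≤ E ^ 2 * Λ := B1.1.trans (by gcongr)
  have hY2u : Y2 ≤ E ^ 2 * Λ := B2.1.trans (by
    calc E * Y1 ≤ E * (E * Λ) := by gcongr; exact B1.1
      _ = _ := by ring)
  have hΛu : Λ ≤ E ^ 2 * Λ := by nlinarith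
  have hI : y (k + c + c + c) - y (k - c) = X + Λ + Y1 + Y2 := by ring
  -- second derivative
  have hl := h.lift.iterate b
  have hdd : ∀ z ∈ Set.Icc (y (k - c)) (y (k + c + c + c)),
      |deriv g^[b] z * nonlin g b z| ≤ M / Λ := by
    intro z hz
    have h1 : deriv g^[b] z ≤ E :=
      (Real.log_le_iff_le_exp (hl.deriv_pos z)).1 (abs_le.1 (h.denjoy hK hb z)).2
    have hS := h.sep_sum_two hs hc hbn 4 (k - c)
    have h2 := h.nonlin_le hK (k := k - c) (l := k + c + c + c) (by omega) (S := 8) (b := b)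
      (x := z)
      (by
        refine le_trans (le_of_eq (Finset.sum_congr rfl fun i _ => ?_)) (hS.trans (by norm_num))
        congr 2
        push_cast; ring) hz
    rw [abs_mul, abs_of_pos (hl.deriv_pos z)]
    have h3 : Real.exp (K * 8) * 8 / (y (k + c + c + c) - y (k - c)) ≤
        Real.exp (K * 8) * 8 / Λ := by
      gcongr
      rw [hI]
      have : 0 < Λ / E ^ 2 := by positivity
      have : 0 ≤ Y1 := sub_nonneg.2 (h.mono.monotone (by omega))
      linarith
    calc deriv g^[b] z * |nonlin g b z| ≤ E * (K * (Real.exp (K * 8) * 8 / Λ)) := by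
          refine mul_le_mul h1 (h2.trans (by gcongr)) (abs_nonneg _) hE0.le
      _ = _ := by rw [hMdef]; ring
  have hdiff := smooth_differentiable hl.smooth
  have hdiff' := smooth_differentiable (smooth_deriv hl.smooth)
  -- the displacement at orbit points and in between
  have hyb : ∀ i, g^[b] (y i) + m = y (i + (b * p + m * q)) := fun i => by
    rw [h.iterate_map, ← h.add_mul_q]; congr 1; ring
  have hmono : Monotone g^[b] := hl.strictMono.monotone
  have hsub : ∀ ψ : ℝ → ℝ, ∀ s : ℝ, (s = 1 ∨ s = -1) → (ψ = fun x => s * (g^[b] x + m - x)) →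
      (∀ z, 0 < ψ z) → |(b : ℤ) * p + m * q| = e →
      ∀ a ∈ Set.Icc (y k) (y (k + c + c)), ∀ a' ∈ Set.Icc (y k) (y (k + c + c)),
      |√(ψ a) - √(ψ a')| ≤ (E ^ 3 + M) / √Λ * |a - a'| := by
    intro ψ s hs1 hψ hpos hee a ha a' ha'
    have hs' : |s| = 1 := by rcases hs1 with rfl | rfl <;> simp
    have d1 : ∀ z, HasDerivAt ψ (s * (deriv g^[b] z - 1)) z := fun z => by
      rw [hψ]
      exact (((hdiff z).hasDerivAt.add_const _).sub (hasDerivAt_id z)).const_mul s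
    have d1' : deriv ψ = fun z => s * (deriv g^[b] z - 1) := funext fun z => (d1 z).deriv
    have d2 : ∀ z, HasDerivAt (deriv ψ) (s * (deriv g^[b] z * nonlin g b z)) z := fun z => by
      rw [d1']
      exact ((h.lift.hasDerivAt_deriv_iterate b z).sub_const 1).const_mul s
    refine sqrt_lipschitz (fun z => (d1 z).differentiableAt) (fun z => (d2 z).differentiableAt)
      hΛ hE hpos (fun z hz => ?_) (fun z hz => ?_) ha ha'
    · rw [(d2 z).deriv, abs_mul, hs', one_mul]
      exact hdd z ⟨by linarith [hz.1], by linarith [hz.2]⟩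
    · have h1 : g^[b] z + m ≤ y (k + c + c + c) := by
        have h2 := hmono hz.2
        have h3 := hyb (k + c + c)
        have h4 : y (k + c + c + (b * p + m * q)) ≤ y (k + c + c + c) :=
          h.mono.monotone (by have := le_abs_self ((b : ℤ) * p + m * q); omega)
        linarith
      have h1' : y (k - c) ≤ g^[b] z + m := by
        have h2 := hmono hz.1
        have h3 := hyb k
        have h4 : y (k - c) ≤ y (k + (b * p + m * q)) :=
          h.mono.monotone (by have := neg_abs_le ((b : ℤ) * p + m * q); omega)
        linarith
      have hz1 : y (k - c) ≤ z := (h.mono.monotone (by omega)).trans hz.1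
      have hz2 : z ≤ y (k + c + c + c) := hz.2.trans (h.mono.monotone (by omega))
      have h5 : ψ z ≤ |g^[b] z + m - z| := by
        rw [hψ]; refine (le_abs_self _).trans ?_
        rw [abs_mul, hs', one_mul]
      have h6 : |g^[b] z + m - z| ≤ y (k + c + c + c) - y (k - c) := by
        rw [abs_le]; constructor <;> linarith
      calc ψ z ≤ X + Λ + Y1 + Y2 := by linarith
        _ ≤ (2 * E) ^ 2 * Λ := by linarith
  have hC : slowConst K / √Λ = E * ((E ^ 3 + M) / √Λ) := by
    rw [slowConst, hMdef]; ring
  rw [hC]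
  have hQ : 0 < y (j + e) - y j := sub_pos.2 (h.mono (by omega))
  have hQ' : 0 < y (j + e + e) - y (j + e) := sub_pos.2 (h.mono (by omega))
  have hin : ∀ i : ℤ, k ≤ i → i ≤ k + c + c → y i ∈ Set.Icc (y k) (y (k + c + c)) :=
    fun i h1 h2 => ⟨h.mono.monotone h1, h.mono.monotone h2⟩
  have hC0 : 0 ≤ (E ^ 3 + M) / √Λ := by positivity
  rcases abs_choice ((b : ℤ) * p + m * q) with hsg | hsg
  · have hbe : (b : ℤ) * p + m * q = e := by omega
    have := hsub _ 1 (Or.inl rfl) rfl (fun z => by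
      obtain ⟨i, hi, hi'⟩ := h.exists_index z
      have h1 := hmono hi
      have h2 := hyb i
      have h3 : y (i + 1) ≤ y (i + (b * p + m * q)) := h.mono.monotone (by omega)
      linarith) hm (y j) (hin _ hkj (by omega)) (y (j + e)) (hin _ (by omega) (by omega))
    simp only [one_mul, hyb, hbe] at this
    rw [abs_sub_comm (y j), abs_of_pos hQ] at this
    exact abs_inv_sqrt_sub_le hQ hQ' hE hcmpe.2 hcmpe.1 hC0 this (Or.inl rfl)
  · have hbe : (b : ℤ) * p + m * q = -e := by omega
    have := hsub _ (-1) (Or.inr rfl) rfl (fun z => by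
      obtain ⟨i, hi, hi'⟩ := h.exists_index z
      have h1 := hl.strictMono hi'
      have h2 := hyb (i + 1)
      have h3 : y (i + 1 + (b * p + m * q)) ≤ y i := h.mono.monotone (by omega)
      linarith) hm (y (j + e)) (hin _ (by omega) (by omega)) (y (j + e + e))
        (hin _ (by omega) (by omega))
    simp only [hyb, hbe, neg_mul, one_mul, neg_sub, add_neg_cancel_right] at this
    rw [abs_sub_comm (y (j + e)), abs_of_pos hQ'] at this
    exact abs_inv_sqrt_sub_le hQ hQ' hE hcmpe.2 hcmpe.1 hC0 this (Or.inr rfl)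

end PerOrbit

lemma PerOrbit.exists_record_one {g : ℝ → ℝ} {p : ℤ} {q : ℕ} {y : ℤ → ℝ} (h : PerOrbit g p q y)
    (hq : 2 ≤ q) : ∃ s, IsRecord p q s ∧ nrm p q s = 1 := by
  obtain ⟨c, a, hs, hc, ha, -, hor⟩ := exists_sep p h.q_pos (n := q) (by omega) le_rfl
  have hc1 : c ≤ 1 := by
    obtain ⟨u, v, huv⟩ := h.coprime
    have hq0 : (q : ℤ) ≠ 0 := by omega
    have h1 := Int.emod_add_mul_ediv u q
    have h2 := Int.emod_nonneg u hq0
    have h3 := Int.emod_lt_of_pos u (show (0 : ℤ) < q by omega)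
    have h4 : u % q ≠ 0 := fun h0 => by
      have : (q : ℤ) ∣ 1 := ⟨u / q * p + v, by rw [← huv]; linear_combination (-p) * h1 + p * h0⟩
      have := Int.le_of_dvd one_pos this
      omega
    have h5 : (((u % q).toNat : ℕ) : ℤ) = u % q := Int.toNat_of_nonneg h2
    have := hs (u % q).toNat (by omega) (by omega) (u / q * p + v)
    rw [h5, show u % q * p + (u / q * p + v) * q = 1 by linear_combination huv + p * h1] at this
    simpa using this
  rcases hor with rfl | ⟨hr, hn⟩
  · omega
  · exact ⟨a, hr, by have := h.nrm_pos hr.pos hr.lt; omega⟩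

namespace PerOrbit

variable {g : ℝ → ℝ} {p : ℤ} {q : ℕ} {y : ℤ → ℝ} {K : ℝ}

lemma slow_chain (h : PerOrbit g p q y) (hK : DistBound g K) {b n c : ℕ} (hb : IsRecord p q b)
    (hs : Sep p q n c) (hc : c ≤ q) (hbn : b ≤ 2 * n) (hec : nrm p q b ≤ c)
    (hcmp : Cmp y c (5 * K)) (k : ℤ) {i j : ℕ} (hij : i ≤ j)
    (hj : (j + 1) * nrm p q b ≤ 2 * c) :
    |1 / √(y (k + j * nrm p q b + nrm p q b) - y (k + j * nrm p q b))
      - 1 / √(y (k + i * nrm p q b + nrm p q b) - y (k + i * nrm p q b))|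
      ≤ (j - i) * (slowConst K / √(y (k + c) - y k)) := by
  induction j, hij using Nat.le_induction with
  | base => simp
  | succ j hij ih =>
    have ih' := ih (le_trans (Nat.mul_le_mul_right _ (by omega)) hj)
    have hj' : ((j : ℤ) + 1 + 1) * nrm p q b ≤ 2 * c := by exact_mod_cast hj
    have := h.slow_variation hK hb hs hc hbn hec hcmp (k := k) (j := k + j * nrm p q b)
      (by have : (0 : ℤ) ≤ j * nrm p q b := by positivity
          linarith) (by linarith)
    rw [show k + ((j + 1 : ℕ) : ℤ) * nrm p q b = k + j * nrm p q b + nrm p q b by push_cast; ring]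
    refine (abs_sub_le _ _ _).trans ((add_le_add this ih').trans (le_of_eq ?_))
    push_cast; ring

lemma sum_block (y : ℤ → ℝ) (k : ℤ) (e m : ℕ) :
    ∑ i ∈ Finset.range m, (y (k + i * e + e) - y (k + i * e)) = y (k + m * e) - y k := by
  have := Finset.sum_range_sub (fun i : ℕ => y (k + i * e)) m
  simp only [Nat.cast_zero, zero_mul, add_zero] at this
  rw [← this]
  refine Finset.sum_congr rfl fun i _ => ?_
  congr 2
  push_cast; ring

lemma record_block_ge (h : PerOrbit g p q y) (hK : DistBound g K) {b n c : ℕ} (hb : IsRecord p q b)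
    (hs : Sep p q n c) (hc : c ≤ q) (hbn : b ≤ 2 * n) (hec : nrm p q b ≤ c)
    (hcmp : Cmp y c (5 * K)) (k : ℤ) :
    (nrm p q b / c : ℝ) ^ 2 / (2 + 2 * slowConst K) ^ 2 * (y (k + c) - y k)
      ≤ y (k + nrm p q b) - y k := by
  have hepos := h.nrm_pos hb.pos hb.lt
  have hchain := fun {i j : ℕ} => h.slow_chain hK hb hs hc hbn hec hcmp k (i := i) (j := j)
  set e := nrm p q b with he
  set C := slowConst K with hCdef
  have hC : 1 ≤ C := slowConst_ge hK.nonneg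
  set Λ := y (k + c) - y k with hΛdef
  have hΛ : 0 < Λ := sub_pos.2 (h.mono (by omega))
  set m := c / e + 1 with hm
  have hm1 : c ≤ m * e := by
    have := Nat.div_add_mod c e
    have := Nat.mod_lt c hepos
    rw [hm]; linarith
  have hme : (c / e) * e ≤ c := Nat.div_mul_le_self c e
  have hm2 : m * e ≤ 2 * c := by rw [hm]; linarith
  have hmpos : (0 : ℝ) < m := by positivity
  obtain ⟨i, hi, hQi⟩ : ∃ i ∈ Finset.range m, Λ / m ≤ y (k + i * e + e) - y (k + i * e) := by
    refine Finset.exists_le_of_sum_le ⟨0, by simp [hm]⟩ ?_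
    rw [sum_block, Finset.sum_const, Finset.card_range, nsmul_eq_mul, mul_div_cancel₀ _ hmpos.ne']
    exact sub_le_sub_right (h.mono.monotone (by have : (c : ℤ) ≤ m * e := by exact_mod_cast hm1
                                                omega)) _
  rw [Finset.mem_range] at hi
  have hch := hchain (i := 0) (j := i) (Nat.zero_le _)
    (le_trans (Nat.mul_le_mul_right _ (by omega)) hm2)
  simp only [Nat.cast_zero, zero_mul, add_zero, sub_zero] at hch
  set Qi := y (k + i * e + e) - y (k + i * e)
  have hQ : 0 < y (k + e) - y k := sub_pos.2 (h.mono (by omega))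
  set Q := y (k + e) - y k
  have hl0 : 0 < √Λ := Real.sqrt_pos.2 hΛ
  have hQi0 : 0 < Qi := lt_of_lt_of_le (by positivity) hQi
  have hm1' : (1 : ℝ) ≤ m := by exact_mod_cast (show 1 ≤ m by omega)
  have hwi : 1 / √Qi ≤ m / √Λ := by
    rw [div_le_div_iff₀ (Real.sqrt_pos.2 hQi0) hl0, one_mul]
    refine Real.sqrt_le_iff.2 ⟨by positivity, ?_⟩
    rw [mul_pow, Real.sq_sqrt hQi0.le]
    rw [div_le_iff₀ hmpos] at hQi
    nlinarith
  have hi' : (i : ℝ) ≤ m := by exact_mod_cast hi.le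
  have hw : 1 / √Q ≤ m * (1 + C) / √Λ := by
    have := (abs_le.1 hch).1
    have h3 : (i : ℝ) * (C / √Λ) ≤ m * (C / √Λ) := by gcongr
    calc 1 / √Q ≤ m / √Λ + m * (C / √Λ) := by linarith
      _ = _ := by ring
  have hQ2 : Λ ≤ (m * (1 + C)) ^ 2 * Q := by
    rw [div_le_div_iff₀ (Real.sqrt_pos.2 hQ) hl0, one_mul] at hw
    have := pow_le_pow_left₀ hl0.le hw 2
    rwa [mul_pow, Real.sq_sqrt hΛ.le, Real.sq_sqrt hQ.le] at this
  have hmR : (m : ℝ) * e ≤ 2 * c := by exact_mod_cast hm2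
  have hc0 : (0 : ℝ) < c := by
    have : 0 < c := by omega
    exact_mod_cast this
  have he0 : (0 : ℝ) < e := by exact_mod_cast hepos
  have key : ((e : ℝ) / c) ^ 2 * (m * (1 + C)) ^ 2 ≤ (2 + 2 * C) ^ 2 := by
    rw [← mul_pow]
    refine pow_le_pow_left₀ (by positivity) ?_ 2
    rw [show (e : ℝ) / c * (m * (1 + C)) = (m * e) * (1 + C) / c by ring, div_le_iff₀ hc0]
    nlinarith
  rw [div_mul_eq_mul_div, div_le_iff₀ (by positivity)]
  calc ((e : ℝ) / c) ^ 2 * Λ ≤ ((e : ℝ) / c) ^ 2 * ((m * (1 + C)) ^ 2 * Q) := by gcongr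
    _ = ((e : ℝ) / c) ^ 2 * (m * (1 + C)) ^ 2 * Q := by ring
    _ ≤ (2 + 2 * C) ^ 2 * Q := by gcongr
    _ = _ := by ring

lemma record_block_lower (h : PerOrbit g p q y) (hK : DistBound g K) {κ : ℕ}
    (hκ : (2 + 2 * slowConst K) ^ 2 ≤ 2 ^ κ) {b : ℕ} (hb : IsRecord p q b) (k : ℤ) :
    (nrm p q b / q : ℝ) ^ 2 / ((2 + 2 * slowConst K) ^ 2 * b ^ κ) ≤ y (k + nrm p q b) - y k := by
  induction b using Nat.strong_induction_on generalizing k with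
  | _ b ih =>
  have hC : 1 ≤ slowConst K := slowConst_ge hK.nonneg
  have hb0 := hb.pos
  have hbq := hb.lt
  have hq0 : (0 : ℝ) < q := by exact_mod_cast h.q_pos
  have hbR : (1 : ℝ) ≤ b := by exact_mod_cast hb0
  obtain ⟨c, a, hs, hc, ha, -, hor⟩ := exists_sep p h.q_pos (n := (b + 1) / 2) (by omega) (by omega)
  rcases hor with rfl | ⟨hr, rfl⟩
  · have := h.record_block_ge hK hb hs hc (by omega) (nrm_lt p h.q_pos b).le (h.cmp_q hK) k
    rw [h.add_q, add_sub_cancel_left, mul_one] at this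
    refine le_trans ?_ this
    rw [← div_div]
    exact div_le_self (by positivity) (one_le_pow₀ hbR)
  · have hlt := hb.nrm_lt a hr.pos (by omega)
    have h1 := h.record_block_ge hK hb hs hc (by omega) hlt.le (h.cmp_record hK hr) k
    have h2 := ih a (by omega) hr k
    refine le_trans ?_ (le_trans (mul_le_mul_of_nonneg_left h2 (by positivity)) h1)
    have hc0 : (0 : ℝ) < nrm p q a := by exact_mod_cast h.nrm_pos hr.pos hr.lt
    have ha0 : (0 : ℝ) < a := by exact_mod_cast hr.pos
    have hab : (2 : ℝ) * a ≤ b := by exact_mod_cast (show 2 * a ≤ b by omega)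
    have key : (2 + 2 * slowConst K) ^ 2 * (a : ℝ) ^ κ ≤ b ^ κ := by
      calc _ ≤ 2 ^ κ * (a : ℝ) ^ κ := by gcongr
        _ = (2 * a) ^ κ := (mul_pow _ _ _).symm
        _ ≤ _ := by gcongr
    have e1 : (nrm p q b / nrm p q a : ℝ) ^ 2 / (2 + 2 * slowConst K) ^ 2
        * ((nrm p q a / q : ℝ) ^ 2 / ((2 + 2 * slowConst K) ^ 2 * a ^ κ))
        = (nrm p q b / q : ℝ) ^ 2 / ((2 + 2 * slowConst K) ^ 2 *
          ((2 + 2 * slowConst K) ^ 2 * a ^ κ)) := by field_simp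
    rw [e1]
    gcongr

end PerOrbit

/-- Polynomial lower bound for the gaps of a periodic orbit. -/
lemma exists_gap_lower {K : ℝ} (hK0 : 0 ≤ K) : ∃ κ : ℕ, ∀ (g : ℝ → ℝ) (p : ℤ) (q : ℕ) (y : ℤ → ℝ),
    PerOrbit g p q y → DistBound g K → 2 ≤ q → ∀ k, 1 / (q : ℝ) ^ κ ≤ y (k + 1) - y k := by
  obtain ⟨κ, hκ⟩ := pow_unbounded_of_one_lt ((2 + 2 * slowConst K) ^ 2) one_lt_two
  refine ⟨2 + κ + κ, fun g p q y h hK hq k => ?_⟩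
  obtain ⟨s, hs, hs1⟩ := h.exists_record_one hq
  have := h.record_block_lower hK hκ.le hs k
  rw [hs1] at this
  refine le_trans ?_ this
  have hC : 1 ≤ slowConst K := slowConst_ge hK0
  have hq2 : (2 : ℝ) ≤ q := by exact_mod_cast hq
  have hs0 : (0 : ℝ) < s := by exact_mod_cast hs.pos
  have hsq : (s : ℝ) ≤ q := by exact_mod_cast hs.lt.le
  have : (1 : ℝ) / q ^ (2 + κ + κ) = ((1 : ℕ) / q : ℝ) ^ 2 / (q ^ κ * q ^ κ) := by
    simp only [Nat.cast_one, div_pow, one_pow, pow_add]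
    field_simp
  rw [this]
  gcongr
  exact hκ.le.trans (by gcongr)

lemma PerOrbit.card_records_mul_le {g : ℝ → ℝ} {p : ℤ} {q : ℕ} {y : ℤ → ℝ} {K : ℝ}
    (h : PerOrbit g p q y) (hK : DistBound g K) (s : Finset ℕ) (hs : ∀ b ∈ s, IsRecord p q b)
    (k : ℤ) : s.card * (y (k + 1) - y k) ≤ Real.exp (5 * K) := by
  have h1 := h.gap_sum_le_one s (fun b => k + b * p) (fun a ha b hb hab => by
    have h1 : (q : ℤ) ∣ (a - b : ℤ) * p := by convert hab using 1; ring
    have h2 : (q : ℤ) ∣ a - b := h.coprime.symm.dvd_of_dvd_mul_right h1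
    have := (hs a ha).lt
    have := (hs b hb).lt
    have h3 := Int.eq_zero_of_abs_lt_dvd h2 (by rw [abs_lt]; constructor <;> omega)
    omega)
  have h2 : ∀ b ∈ s, y (k + 1) - y k ≤ Real.exp (5 * K) * (y (k + b * p + 1) - y (k + b * p)) :=
    fun b hb => by simpa using (h.record_image hK (hs b hb) k 1).2
  calc s.card * (y (k + 1) - y k) = ∑ b ∈ s, (y (k + 1) - y k) := by
        rw [Finset.sum_const, nsmul_eq_mul]
    _ ≤ ∑ b ∈ s, Real.exp (5 * K) * (y (k + b * p + 1) - y (k + b * p)) := Finset.sum_le_sum h2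
    _ = Real.exp (5 * K) * ∑ b ∈ s, (y (k + b * p + 1) - y (k + b * p)) := by
        rw [Finset.mul_sum]
    _ ≤ Real.exp (5 * K) * 1 := by gcongr
    _ = _ := mul_one _

/-- Distance to the nearest integer. -/
noncomputable def toInt (x : ℝ) : ℝ := |x - round x|

lemma toInt_le (x : ℝ) (m : ℤ) : toInt x ≤ |x - m| := round_le x m

lemma toInt_pos {α : ℝ} (hα : Irrational α) {i : ℕ} (hi : 0 < i) : 0 < toInt (i * α) := by
  refine abs_pos.2 fun h => ?_
  have : Irrational (i * α) := hα.natCast_mul hi.ne'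
  exact this.ne_int _ (sub_eq_zero.1 h)

/-- Times of closest return for the rotation by `α`. -/
def IsRecordReal (α : ℝ) (b : ℕ) : Prop :=
  0 < b ∧ ∀ i, 0 < i → i < b → toInt (b * α) < toInt (i * α)

lemma infinite_isRecordReal {α : ℝ} (hα : Irrational α) : {b | IsRecordReal α b}.Infinite := by
  refine Set.infinite_of_forall_exists_gt fun N => ?_
  obtain ⟨i₀, hi₀, hmin⟩ := Finset.exists_min_image (Finset.Icc 1 (N + 1))
    (fun i : ℕ => toInt (i * α)) ⟨1, by simp⟩
  rw [Finset.mem_Icc] at hi₀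
  have hpos := toInt_pos hα (i := i₀) (by omega)
  have hex : ∃ j : ℕ, 0 < j ∧ toInt (j * α) < toInt (i₀ * α) := by
    obtain ⟨n, hn⟩ := exists_nat_one_div_lt hpos
    obtain ⟨k, hk, -, hk'⟩ := Real.exists_nat_abs_mul_sub_round_le α (Nat.succ_pos n)
    refine ⟨k, hk, hk'.trans_lt (lt_of_le_of_lt ?_ hn)⟩
    push_cast
    gcongr
    linarith
  classical
  have hb := Nat.find_spec hex
  refine ⟨Nat.find hex, ⟨hb.1, fun i hi hib => ?_⟩, ?_⟩
  · have := Nat.find_min hex hib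
    push Not at this
    exact hb.2.trans_le (this hi)
  · by_contra! hle
    exact absurd hb.2 (not_lt.2 (hmin _ (Finset.mem_Icc.2 ⟨hb.1, by omega⟩)))

lemma abs_nrm_sub_toInt_le (α : ℝ) (p : ℤ) {q : ℕ} (hq : 0 < q) (i : ℕ) :
    |(nrm p q i : ℝ) / q - toInt (i * α)| ≤ i * |α - p / q| := by
  have hq0 : (0 : ℝ) < q := by exact_mod_cast hq
  have hd : |i * (α - p / q)| = i * |α - p / q| := by rw [abs_mul, Nat.abs_cast]
  rw [abs_sub_le_iff]
  constructor
  · have h1 := nrm_le p q i (-round (i * α))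
    have h2 : (nrm p q i : ℝ) ≤ |(i : ℝ) * p + (-round (i * α) : ℤ) * q| := by exact_mod_cast h1
    have h3 : (nrm p q i : ℝ) / q ≤ |i * α - round (i * α) - i * (α - p / q)| := by
      rw [div_le_iff₀ hq0]
      refine h2.trans (le_of_eq ?_)
      rw [← abs_of_pos hq0, ← abs_mul, abs_of_pos hq0]
      congr 1; push_cast; field_simp; ring
    have h4 := abs_sub (i * α - round (i * α)) (i * (α - p / q))
    rw [hd] at h4
    have : toInt (i * α) = |i * α - round (i * α)| := rfl
    linarith
  · obtain ⟨m, hm⟩ := exists_nrm p q i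
    have h2 : (nrm p q i : ℝ) = |(i : ℝ) * p + m * q| := by
      rw [← Int.cast_natCast, ← hm]; push_cast; rfl
    have h3 : (nrm p q i : ℝ) / q = |i * α - (-m : ℤ) - i * (α - p / q)| := by
      rw [div_eq_iff hq0.ne', h2, ← abs_of_pos hq0, ← abs_mul, abs_of_pos hq0]
      congr 1; push_cast; field_simp; ring
    have h4 := toInt_le (i * α) (-m)
    have h5 := abs_sub_abs_le_abs_sub (i * α - (-m : ℤ)) (i * (α - p / q))
    rw [hd] at h5
    linarith

lemma IsRecordReal.eventually {α : ℝ} {b : ℕ} (hb : IsRecordReal α b) :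
    ∀ᶠ η in 𝓝[>] (0 : ℝ), ∀ (p : ℤ) (q : ℕ), |α - p / q| < η → b < q → IsRecord p q b := by
  have h1 : ∀ᶠ η in 𝓝[>] (0 : ℝ), ∀ i ∈ Finset.Ioo 0 b,
      (2 * b) * η < toInt (i * α) - toInt (b * α) := by
    rw [Filter.eventually_all_finset]
    intro i hi
    rw [Finset.mem_Ioo] at hi
    have ht : Tendsto (fun η : ℝ => (2 * b) * η) (𝓝[>] 0) (𝓝 0) := by
      have : Continuous fun η : ℝ => (2 * b) * η := by fun_prop
      simpa using (this.tendsto 0).mono_left nhdsWithin_le_nhds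
    exact ht.eventually_lt_const (sub_pos.2 (hb.2 i hi.1 hi.2))
  filter_upwards [h1, self_mem_nhdsWithin] with η hη hη0 p q hpq hbq
  refine ⟨hb.1, hbq, fun i hi hib => ?_⟩
  have hq : 0 < q := by omega
  have hq0 : (0 : ℝ) < q := by exact_mod_cast hq
  have k1 := abs_le.1 (abs_nrm_sub_toInt_le α p hq i)
  have k2 := abs_le.1 (abs_nrm_sub_toInt_le α p hq b)
  have k3 := hη i (Finset.mem_Ioo.2 ⟨hi, hib⟩)
  have hib' : (i : ℝ) ≤ b := by exact_mod_cast hib.le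
  have k4 : (i : ℝ) * |α - p / q| ≤ b * η := by
    have := Set.mem_Ioi.1 hη0
    gcongr
  have k5 : (b : ℝ) * |α - p / q| ≤ b * η := by gcongr
  have : (nrm p q b : ℝ) / q < nrm p q i / q := by linarith [k1.1, k2.2]
  rw [div_lt_div_iff_of_pos_right hq0] at this
  exact_mod_cast this

/-- The gaps of periodic orbits are small when the rotation number is close to `α`. -/
lemma exists_gap_upper {α : ℝ} (hα : Irrational α) (K : ℝ) {ε : ℝ} (hε : 0 < ε) :
    ∃ η > 0, ∃ N : ℕ, ∀ (g : ℝ → ℝ) (p : ℤ) (q : ℕ) (y : ℤ → ℝ), PerOrbit g p q y →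
      DistBound g K → |α - p / q| < η → N ≤ q → ∀ k, y (k + 1) - y k ≤ ε := by
  obtain ⟨R, hR⟩ := exists_nat_gt (Real.exp (5 * K) / ε)
  obtain ⟨s, hs, hcard⟩ := (infinite_isRecordReal hα).exists_subset_card_eq R
  have h1 : ∀ᶠ η in 𝓝[>] (0 : ℝ), ∀ b ∈ s, ∀ (p : ℤ) (q : ℕ), |α - p / q| < η → b < q →
      IsRecord p q b := by
    rw [Filter.eventually_all_finset]
    exact fun b hb => IsRecordReal.eventually (hs hb)
  obtain ⟨η, hη, hη0⟩ := (h1.and self_mem_nhdsWithin).exists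
  refine ⟨η, hη0, s.sup id + 1, fun g p q y h hK hpq hq k => ?_⟩
  have h2 := h.card_records_mul_le hK s (fun b hb => hη b hb p q hpq (by
    have : b ≤ s.sup id := Finset.le_sup (f := id) hb
    omega)) k
  rw [hcard] at h2
  rw [div_lt_iff₀ hε] at hR
  by_contra! hlt
  have hR0 : (0 : ℝ) < R := by
    by_contra! h0
    have := Real.exp_pos (5 * K)
    nlinarith
  nlinarith

namespace PerOrbit

variable {g : ℝ → ℝ} {p : ℤ} {q : ℕ} {y : ℤ → ℝ} {K : ℝ}

lemma gap_near (h : PerOrbit g p q y) (hK : DistBound g K) (hq : 2 ≤ q) (k : ℤ) (n : ℕ) :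
    (y (k + n + 1) - y (k + n) ≤ Real.exp (5 * K) ^ n * (y (k + 1) - y k)) ∧
    (y (k - n + 1) - y (k - n) ≤ Real.exp (5 * K) ^ n * (y (k + 1) - y k)) := by
  obtain ⟨s, hs, hs1⟩ := h.exists_record_one hq
  have hcmp := h.cmp_record hK hs
  rw [hs1] at hcmp
  simp only [Cmp, Nat.cast_one] at hcmp
  induction n with
  | zero => simp
  | succ n ih =>
    have h1 := (hcmp (k + n)).1
    have h2 := (hcmp (k - n - 1)).2
    rw [show k - n - 1 + 1 = k - (n : ℤ) by ring] at h2
    push_cast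
    rw [show k + ((n : ℤ) + 1) = k + n + 1 by ring,
      show k - ((n : ℤ) + 1) = k - n - 1 by ring, show k - (n : ℤ) - 1 + 1 = k - n by ring]
    have hE := (Real.exp_pos (5 * K)).le
    constructor
    · calc _ ≤ _ := h1
        _ ≤ Real.exp (5 * K) * (Real.exp (5 * K) ^ n * (y (k + 1) - y k)) := by gcongr; exact ih.1
        _ = _ := by ring
    · calc _ ≤ _ := h2
        _ ≤ Real.exp (5 * K) * (Real.exp (5 * K) ^ n * (y (k + 1) - y k)) := by gcongr; exact ih.2
        _ = _ := by ring

lemma span_near (h : PerOrbit g p q y) (hK : DistBound g K) (hq : 2 ≤ q) (k : ℤ) (n : ℕ) :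
    y (k + n) - y (k - n) ≤ 2 * n * Real.exp (5 * K) ^ n * (y (k + 1) - y k) := by
  have hE : 1 ≤ Real.exp (5 * K) := Real.one_le_exp (by linarith [hK.nonneg])
  have hg : 0 < y (k + 1) - y k := sub_pos.2 (h.mono (by omega))
  induction n with
  | zero => simp
  | succ n ih =>
    have h1 := (h.gap_near hK hq k n).1
    have h2 := (h.gap_near hK hq k (n + 1)).2
    push_cast at h2 ⊢
    rw [show k - ((n : ℤ) + 1) + 1 = k - n by ring] at h2
    rw [← add_assoc]
    have hp : Real.exp (5 * K) ^ n ≤ Real.exp (5 * K) ^ (n + 1) := by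
      gcongr
      omega
    have h3 : Real.exp (5 * K) ^ n * (y (k + 1) - y k)
      ≤ Real.exp (5 * K) ^ (n + 1) * (y (k + 1) - y k) := by gcongr
    have h4 : 2 * n * (Real.exp (5 * K) ^ n * (y (k + 1) - y k))
      ≤ 2 * n * (Real.exp (5 * K) ^ (n + 1) * (y (k + 1) - y k)) := by gcongr
    linarith

lemma exists_max_gap (h : PerOrbit g p q y) :
    ∃ k₀, ∀ k, y (k + 1) - y k ≤ y (k₀ + 1) - y k₀ := by
  obtain ⟨k₀, -, hmax⟩ := Finset.exists_max_image (Finset.range q)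
    (fun k : ℕ => y (k + 1) - y k) ⟨0, Finset.mem_range.2 h.q_pos⟩
  refine ⟨k₀, fun k => ?_⟩
  have hq : (q : ℤ) ≠ 0 := by have := h.q_pos; omega
  have h1 := Int.emod_add_mul_ediv k q
  have h2 := Int.emod_nonneg k hq
  have h3 := Int.emod_lt_of_pos k (show (0 : ℤ) < q by have := h.q_pos; omega)
  have h5 : (((k % q).toNat : ℕ) : ℤ) = k % q := Int.toNat_of_nonneg h2
  rw [h.gap_congr (a := k) (b := (k % q).toNat) ⟨k / q, by rw [h5]; linarith⟩ 1]
  exact hmax _ (Finset.mem_range.2 (by omega))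

lemma sum_span (h : PerOrbit g p q y) (a : ℤ) (n : ℕ) :
    ∑ i ∈ Finset.range q, (y (a + n + i * p) - y (a + i * p)) ≤ n := by
  have := h.sep_sum_mul h.sep_one h.q_pos n a
  simpa [add_right_comm] using this

lemma span_le {M : ℝ} (hM : ∀ k, y (k + 1) - y k ≤ M) (a : ℤ) (n : ℕ) :
    y (a + n) - y a ≤ n * M := by
  rw [← sum_range_gap]
  calc _ ≤ ∑ i ∈ Finset.range n, M := Finset.sum_le_sum fun i _ => hM (a + i)
    _ = n * M := by simp

/-- The total squared length of the images of an interval is controlled by the largest gap. -/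
lemma sum_span_sq (h : PerOrbit g p q y) {M : ℝ} (hM : ∀ k, y (k + 1) - y k ≤ M) (a : ℤ) (n : ℕ) :
    ∑ i ∈ Finset.range q, (y (a + n + i * p) - y (a + i * p)) ^ 2 ≤ n ^ 2 * M := by
  have hM0 : 0 ≤ M := (sub_nonneg.2 (h.mono.monotone (by omega : (0 : ℤ) ≤ 0 + 1))).trans (hM 0)
  calc _ ≤ ∑ i ∈ Finset.range q, n * M * (y (a + n + i * p) - y (a + i * p)) := by
        refine Finset.sum_le_sum fun i _ => ?_
        have h1 := span_le hM (a + i * p) n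
        rw [add_right_comm] at h1
        have h2 : 0 ≤ y (a + n + i * p) - y (a + i * p) :=
          sub_nonneg.2 (h.mono.monotone (by omega))
        nlinarith
    _ = n * M * ∑ i ∈ Finset.range q, (y (a + n + i * p) - y (a + i * p)) := by
        rw [Finset.mul_sum]
    _ ≤ n * M * n := by gcongr; exact h.sum_span a n
    _ = _ := by ring

end PerOrbit

/-- An interval `[y a, y (a + n)]` which is long compared with the `2 r` gaps around its
interior point `y k`. -/
structure Window (y : ℤ → ℝ) (r B : ℕ) (C M : ℝ) (a : ℤ) (n : ℕ) (k : ℤ) (d : ℝ) : Prop where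
  left : y a ≤ y (k - r) - d
  right : y (k + r) + d ≤ y (a + n)
  le_d : 1 / (C * B ^ 20) ≤ d
  span_le : y (k + r) - y (k - r) ≤ C * d / B
  n_le : n ≤ C * B ^ 4
  sq_le : n ^ 2 * M ≤ C / B

/-- Constant for windows. -/
noncomputable def windowConst (K : ℝ) (r : ℕ) : ℝ :=
  8 * 16 ^ 9 * (⌈slowConst K⌉₊ : ℝ) ^ 22 * Real.exp (5 * K) ^ 2
    + 8 * (2 * r * Real.exp (5 * K) ^ r) * Real.exp (5 * K) ^ 2

section

variable {g : ℝ → ℝ} {p : ℤ} {q : ℕ} {y : ℤ → ℝ} {K : ℝ}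

lemma PerOrbit.window_short (h : PerOrbit g p q y) (hK : DistBound g K) (hq : 2 ≤ q) {c A r B : ℕ}
    {C M : ℝ} (hcmp : Cmp y c (5 * K)) (hAc : A ≤ c) (hcA : c ≤ A ^ 2) (hrB : r ≤ B) (hBA : B ≤ A)
    (hB : 0 < B) {k₀ : ℤ} (hk₀ : y (k₀ + 1) - y k₀ = M)
    (hC1 : 1 / M * Real.exp (5 * K) ^ 2 ≤ C * B ^ 20)
    (hC2 : 2 * r * Real.exp (5 * K) ^ r * Real.exp (5 * K) ^ 2 ≤ C)
    (hC3 : 5 * (A : ℝ) ^ 2 ≤ C * B ^ 4) (hC4 : (5 * (A : ℝ) ^ 2) ^ 2 * M ≤ C / B) :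
    ∃ a n k d, Window y r B C M a n k d := by
  have hK0 := hK.nonneg
  set E := Real.exp (5 * K) with hEdef
  have hE : 1 ≤ E := Real.one_le_exp (by linarith)
  have hE0 : 0 < E := by linarith
  set Λ := y (k₀ + c) - y k₀ with hΛdef
  have hM : 0 < M := hk₀ ▸ sub_pos.2 (h.mono (by omega))
  have hΛM : M ≤ Λ := by
    rw [← hk₀]; exact sub_le_sub_right (h.mono.monotone (by omega)) _
  have hΛ : 0 < Λ := hM.trans_le hΛM
  have hcR : (0 : ℝ) < c := by
    have : 0 < c := by omega
    exact_mod_cast this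
  obtain ⟨i, hi, hgap⟩ : ∃ i ∈ Finset.range c, y (k₀ + i + 1) - y (k₀ + i) ≤ Λ / c := by
    refine Finset.exists_le_of_sum_le ⟨0, Finset.mem_range.2 (by omega)⟩ ?_
    rw [PerOrbit.sum_range_gap, Finset.sum_const, Finset.card_range, nsmul_eq_mul,
      mul_div_cancel₀ _ hcR.ne']
  rw [Finset.mem_range] at hi
  have hspan := h.span_near hK hq (k₀ + i) r
  have c1 := (hcmp (k₀ - c)).1
  have c2 := (hcmp (k₀ - c - c)).1
  have c3 := (hcmp k₀).2
  have c4 := (hcmp (k₀ + c)).2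
  rw [sub_add_cancel] at c1 c2
  rw [sub_add_cancel] at c2
  rw [← hEdef] at c1 c2 c3 c4
  have hn : ((5 * c : ℕ) : ℝ) ≤ 5 * (A : ℝ) ^ 2 := by exact_mod_cast (by omega)
  refine ⟨k₀ - c - c, 5 * c, k₀ + i, Λ / E ^ 2, ?_, ?_, ?_, ?_, hn.trans hC3, ?_⟩
  · have h1 : y (k₀ - c) ≤ y (k₀ + i - r) := h.mono.monotone (by omega)
    have h2 : Λ / E ^ 2 ≤ y (k₀ - c) - y (k₀ - c - c) := by
      rw [div_le_iff₀ (by positivity)]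
      calc Λ ≤ E * (y k₀ - y (k₀ - c)) := c1
        _ ≤ E * (E * (y (k₀ - c) - y (k₀ - c - c))) := by gcongr
        _ = _ := by ring
    linarith
  · have h1 : y (k₀ + i + r) ≤ y (k₀ + c + c) := h.mono.monotone (by omega)
    have h2 : Λ / E ^ 2 ≤ y (k₀ + c + c + c) - y (k₀ + c + c) := by
      rw [div_le_iff₀ (by positivity)]
      calc Λ ≤ E * (y (k₀ + c + c) - y (k₀ + c)) := c3
        _ ≤ E * (E * (y (k₀ + c + c + c) - y (k₀ + c + c))) := by gcongr
        _ = _ := by ring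
    have h3 : k₀ - c - c + ((5 * c : ℕ) : ℤ) = k₀ + c + c + c := by push_cast; ring
    rw [h3]
    linarith
  · rw [one_div]
    refine inv_le_of_inv_le₀ (by positivity) ?_
    rw [inv_div]
    refine le_trans ?_ hC1
    rw [div_eq_mul_one_div, mul_comm]
    gcongr
  · have hBc : (B : ℝ) ≤ c := by exact_mod_cast hBA.trans hAc
    have hBR : (0 : ℝ) < B := by exact_mod_cast hB
    have hC0 : 0 ≤ C := le_trans (by positivity) hC2
    calc _ ≤ 2 * r * E ^ r * (Λ / c) := hspan.trans (by gcongr)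
      _ = (2 * r * E ^ r * E ^ 2) * (Λ / E ^ 2) / c := by field_simp
      _ ≤ C * (Λ / E ^ 2) / B := by gcongr
  · refine le_trans ?_ hC4
    gcongr

set_option maxHeartbeats 1000000 in
lemma PerOrbit.window_long (h : PerOrbit g p q y) (hK : DistBound g K) (hq : 2 ≤ q)
    {b c r B L P : ℕ} {C M : ℝ} (hb : IsRecord p q b) (hs : Sep p q b c) (hc : c ≤ q)
    (hcmp : Cmp y c (5 * K)) (hL : slowConst K ≤ L) (hP : P = (L * B) ^ 2)
    (heA : nrm p q b ≤ 4 * P) (hAc : (4 * P) ^ 2 ≤ c) (hB : 0 < B)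
    (hrB : 8 * (2 * r * Real.exp (5 * K) ^ r) ≤ B) {k₀ : ℤ} (hk₀ : y (k₀ + 1) - y k₀ = M)
    (hC1 : 8 * (4 * P * L : ℝ) ^ 2 * (1 / M) ≤ C * B ^ 20)
    (hC2 : 8 * (2 * r * Real.exp (5 * K) ^ r) ≤ C)
    (hC3 : 5 * (4 * P : ℝ) ^ 2 ≤ C * B ^ 4) (hC4 : (5 * (4 * P : ℝ) ^ 2) ^ 2 * M ≤ C / B) :
    ∃ a n k d, Window y r B C M a n k d := by
  have hK0 := hK.nonneg
  have hepos := h.nrm_pos hb.pos hb.lt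
  have hS := slowConst_ge hK0
  have hL1 : (1 : ℝ) ≤ L := hS.trans hL
  have hLn : 1 ≤ L := by exact_mod_cast hL1
  have hBP : B ≤ P := by
    rw [hP]; calc B ≤ L * B := Nat.le_mul_of_pos_left _ hLn
      _ ≤ (L * B) ^ 2 := Nat.le_self_pow (by norm_num) _
  have hPpos : 0 < P := by omega
  set e := nrm p q b with he
  have hPec : 4 * P * e ≤ c :=
    (Nat.mul_le_mul_left (4 * P) heA).trans (by rw [← sq]; exact hAc)
  have hec : e ≤ c := (Nat.le_mul_of_pos_left e (by omega)).trans hPec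
  have hchain := fun {i j : ℕ} => h.slow_chain hK hb hs hc (by omega) hec hcmp k₀ (i := i) (j := j)
  rw [← he] at hchain
  set Q : ℕ → ℝ := fun i => y (k₀ + i * e + e) - y (k₀ + i * e) with hQdef
  have hQ : ∀ i, 0 < Q i := fun i => sub_pos.2 (h.mono (by omega))
  set Λ := y (k₀ + c) - y k₀ with hΛdef
  have hM : 0 < M := hk₀ ▸ sub_pos.2 (h.mono (by omega))
  have hΛM : M ≤ Λ := by
    rw [← hk₀]; exact sub_le_sub_right (h.mono.monotone (by omega)) _
  have hΛ : 0 < Λ := hM.trans_le hΛM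
  have hPR : (1 : ℝ) ≤ P := by exact_mod_cast hPpos
  have hbound : ∀ {i j : ℕ}, i ≤ j → j < 4 * P →
      |1 / √(Q j) - 1 / √(Q i)| ≤ (j - i) * (L / √Λ) := fun {i j} hij hj => by
    refine (hchain hij (le_trans (Nat.mul_le_mul_right e hj) (by omega))).trans ?_
    have : (i : ℝ) ≤ j := by exact_mod_cast hij
    have : (0 : ℝ) ≤ j - i := by linarith
    gcongr
  obtain ⟨i', hi', hQi'⟩ : ∃ i ∈ Finset.range (2 * P), Q (P + i) ≤ Λ / (2 * P) := by
    refine Finset.exists_le_of_sum_le ⟨0, Finset.mem_range.2 (by omega)⟩ ?_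
    have h1 := sum_block y (k₀ + P * e) e (2 * P)
    have h2 : ∑ i ∈ Finset.range (2 * P), Q (P + i)
        = y (k₀ + P * e + (2 * P : ℕ) * e) - y (k₀ + P * e) := by
      rw [← h1]
      refine Finset.sum_congr rfl fun i _ => ?_
      rw [hQdef]
      dsimp only
      rw [show k₀ + ((P + i : ℕ) : ℤ) * e = k₀ + P * e + i * e by push_cast; ring]
    rw [h2, Finset.sum_const, Finset.card_range, nsmul_eq_mul]
    push_cast
    rw [mul_div_cancel₀ _ (by positivity)]
    have hPe : (4 : ℤ) * P * e ≤ c := by exact_mod_cast hPec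
    have hPe0 : (0 : ℤ) ≤ P * e := by positivity
    have h3 : y (k₀ + P * e + 2 * P * e) ≤ y (k₀ + c) := h.mono.monotone (by linarith)
    have h4 : y k₀ ≤ y (k₀ + P * e) := h.mono.monotone (by linarith)
    linarith
  rw [Finset.mem_range] at hi'
  set i₁ := P + i' with hi₁
  have hl0 : 0 < √Λ := Real.sqrt_pos.2 hΛ
  have hw1 : L * B / √Λ ≤ 1 / √(Q i₁) := by
    rw [div_le_div_iff₀ hl0 (Real.sqrt_pos.2 (hQ i₁)), one_mul]
    refine le_of_sq_le_sq ?_ hl0.le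
    rw [mul_pow, Real.sq_sqrt (hQ i₁).le, Real.sq_sqrt hΛ.le]
    have : ((L : ℝ) * B) ^ 2 = P := by rw [hP]; push_cast; ring
    rw [this]
    rw [le_div_iff₀ (by positivity)] at hQi'
    have := hQ i₁
    nlinarith
  have hfour : ∀ j : ℕ, i₁ ≤ j + B → j ≤ i₁ + B → Q i₁ / 4 ≤ Q j := by
    intro j h1 h2
    have h3 : 1 / √(Q j) ≤ 2 * (1 / √(Q i₁)) := by
      have key : |1 / √(Q j) - 1 / √(Q i₁)| ≤ L * B / √Λ := by
        have hle : ∀ t : ℝ, t ≤ B → t * (L / √Λ) ≤ L * B / √Λ := fun t ht => by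
          rw [show (L : ℝ) * B / √Λ = B * (L / √Λ) by ring]
          gcongr
        rcases le_total i₁ j with hij | hij
        · refine (hbound hij (by omega)).trans (hle _ ?_)
          have : (j : ℝ) ≤ i₁ + B := by exact_mod_cast h2
          linarith
        · rw [abs_sub_comm]
          refine (hbound hij (by omega)).trans (hle _ ?_)
          have : (i₁ : ℝ) ≤ j + B := by exact_mod_cast h1
          linarith
      linarith [(abs_le.1 key).2]
    rw [mul_one_div, div_le_div_iff₀ (Real.sqrt_pos.2 (hQ j)) (Real.sqrt_pos.2 (hQ i₁)), one_mul]
      at h3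
    have := pow_le_pow_left₀ (Real.sqrt_nonneg _) h3 2
    rw [mul_pow, Real.sq_sqrt (hQ i₁).le, Real.sq_sqrt (hQ j).le] at this
    linarith
  have hQ1 : M / (4 * P * L) ^ 2 ≤ Q i₁ := by
    have h1 := (abs_le.1 (hbound (Nat.zero_le i₁) (by omega))).2
    have hm0 : 0 < √M := Real.sqrt_pos.2 hM
    have h2 : 1 / √(Q 0) ≤ 1 / √M := by
      refine one_div_le_one_div_of_le hm0 (Real.sqrt_le_sqrt ?_)
      rw [← hk₀, hQdef]
      simp only [Nat.cast_zero, zero_mul, add_zero]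
      exact sub_le_sub_right (h.mono.monotone (by omega)) _
    have h3 : (L : ℝ) / √Λ ≤ L / √M := by gcongr
    have hi1 : (i₁ : ℝ) ≤ 3 * P := by exact_mod_cast (by omega)
    have h4 : ((i₁ : ℝ) - (0 : ℕ)) * (L / √Λ) ≤ 3 * P * (L / √M) := by
      rw [Nat.cast_zero, sub_zero]
      gcongr
    have h5 : 1 / √(Q i₁) ≤ (4 * P * L) / √M := by
      have h6 : 1 / √M ≤ (P * L) / √M := by
        gcongr; nlinarith
      calc 1 / √(Q i₁) ≤ (P * L) / √M + 3 * P * (L / √M) := by linarith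
        _ = _ := by ring
    rw [div_le_div_iff₀ (Real.sqrt_pos.2 (hQ i₁)) hm0, one_mul] at h5
    have := pow_le_pow_left₀ hm0.le h5 2
    rw [mul_pow, Real.sq_sqrt (hQ i₁).le, Real.sq_sqrt hM.le] at this
    rw [div_le_iff₀ (by positivity)]
    linarith
  have hspan := h.span_near hK hq (k₀ + i₁ * e) r
  set D := 2 * r * Real.exp (5 * K) ^ r with hD
  have hD0 : 0 ≤ D := by positivity
  have hspan' : y (k₀ + i₁ * e + r) - y (k₀ + i₁ * e - r) ≤ D * Q i₁ := by
    refine hspan.trans ?_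
    gcongr
    exact sub_le_sub_right (h.mono.monotone (by omega)) _
  have hBR : (0 : ℝ) < B := by exact_mod_cast hB
  have hDB : D * Q i₁ ≤ B * Q i₁ / 8 := by
    have := hQ i₁
    nlinarith
  have hsum : ∀ j : ℕ, i₁ ≤ j + B → j ≤ i₁ →
      B * (Q i₁ / 4) ≤ y (k₀ + j * e + B * e) - y (k₀ + j * e) := by
    intro j h1 h2
    rw [← sum_block]
    calc B * (Q i₁ / 4) = ∑ i ∈ Finset.range B, Q i₁ / 4 := by
          rw [Finset.sum_const, Finset.card_range, nsmul_eq_mul]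
      _ ≤ _ := Finset.sum_le_sum fun i hi => by
          rw [Finset.mem_range] at hi
          have := hfour (j + i) (by omega) (by omega)
          rw [hQdef] at this ⊢
          dsimp only at this ⊢
          rwa [show k₀ + ((j + i : ℕ) : ℤ) * e = k₀ + j * e + i * e by push_cast; ring] at this
  have hBi : B ≤ i₁ := by omega
  have hcast : k₀ + ((i₁ - B : ℕ) : ℤ) * e = k₀ + i₁ * e - B * e := by
    rw [Nat.cast_sub hBi]; ring
  have s1 := hsum (i₁ - B) (by omega) (by omega)
  have s2 := hsum i₁ (by omega) le_rfl
  rw [hcast, sub_add_cancel] at s1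
  have hn : ((2 * B * e : ℕ) : ℝ) ≤ 5 * (4 * P : ℝ) ^ 2 := by
    have : 2 * B * e ≤ 5 * (4 * P) ^ 2 := by
      calc 2 * B * e ≤ 2 * P * (4 * P) := by gcongr
        _ ≤ _ := by ring_nf; nlinarith
    exact_mod_cast this
  have m1 : y (k₀ + i₁ * e) ≤ y (k₀ + i₁ * e + r) := h.mono.monotone (by omega)
  have m2 : y (k₀ + i₁ * e - r) ≤ y (k₀ + i₁ * e) := h.mono.monotone (by omega)
  refine ⟨k₀ + i₁ * e - B * e, 2 * B * e, k₀ + i₁ * e, B * Q i₁ / 8, ?_, ?_, ?_, ?_,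
    hn.trans hC3, ?_⟩
  · linarith
  · rw [show k₀ + i₁ * e - B * e + ((2 * B * e : ℕ) : ℤ) = k₀ + i₁ * e + B * e by push_cast; ring]
    linarith
  · have h1 : M / (4 * P * L) ^ 2 / 8 ≤ B * Q i₁ / 8 := by
      have : (1 : ℝ) ≤ B := by exact_mod_cast hB
      have h2 := hQ i₁
      have h3 : Q i₁ ≤ B * Q i₁ := le_mul_of_one_le_left h2.le this
      linarith
    refine le_trans ?_ h1
    rw [one_div]
    refine inv_le_of_inv_le₀ (by positivity) (le_trans (le_of_eq ?_) hC1)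
    rw [inv_div, div_div_eq_mul_div]
    ring
  · calc _ ≤ D * Q i₁ := hspan'
      _ = 8 * D * (B * Q i₁ / 8) / B := by field_simp
      _ ≤ C * (B * Q i₁ / 8) / B := by
        have := hQ i₁
        gcongr
  · refine le_trans ?_ hC4
    gcongr

end

lemma exists_window (K : ℝ) (r N : ℕ) : ∃ ε > 0, ∀ (g : ℝ → ℝ) (p : ℤ) (q : ℕ) (y : ℤ → ℝ),
    PerOrbit g p q y → DistBound g K → 2 ≤ q → (∀ k, y (k + 1) - y k ≤ ε) →
    ∃ B M, N ≤ B ∧ (∀ k, y (k + 1) - y k ≤ M) ∧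
      ∃ a n k d, Window y r B (windowConst K r) M a n k d := by
  set L := ⌈slowConst K⌉₊ with hLdef
  have hL : slowConst K ≤ L := Nat.le_ceil _
  set E := Real.exp (5 * K) with hEdef
  set D := 2 * r * E ^ r with hD
  set N' := N + r + 1 + ⌈8 * D⌉₊ with hN'
  refine ⟨1 / ((4 * ((L + 1 : ℕ) * N') ^ 2 : ℕ) : ℝ) ^ 8, by positivity,
    fun g p q y h hK hq hgap => ?_⟩
  obtain ⟨k₀, hmax⟩ := h.exists_max_gap
  set M := y (k₀ + 1) - y k₀ with hMdef
  have hM : 0 < M := sub_pos.2 (h.mono (by omega))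
  have hK0 := hK.nonneg
  have hE : 1 ≤ E := Real.one_le_exp (by linarith)
  have hL1 : (1 : ℝ) ≤ L := (slowConst_ge hK0).trans hL
  have hLn : 1 ≤ L := by exact_mod_cast hL1
  classical
  have hex : ∃ B : ℕ, 1 < ((4 * (L * B) ^ 2 : ℕ) : ℝ) ^ 8 * M := by
    obtain ⟨B, hB⟩ := exists_nat_gt (1 / M)
    refine ⟨B, ?_⟩
    rw [div_lt_iff₀ hM] at hB
    refine hB.trans_le ?_
    have : B ≤ (4 * (L * B) ^ 2) ^ 8 := by
      calc B ≤ L * B := Nat.le_mul_of_pos_left _ hLn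
        _ ≤ (L * B) ^ 2 := Nat.le_self_pow (by norm_num) _
        _ ≤ 4 * (L * B) ^ 2 := by omega
        _ ≤ _ := Nat.le_self_pow (by norm_num) _
    gcongr
    exact_mod_cast this
  obtain ⟨B, hB⟩ : ∃ B, Nat.find hex = B + 1 := Nat.exists_eq_succ_of_ne_zero fun h0 => by
    have := Nat.find_spec hex
    rw [h0] at this
    norm_num at this
  have hlow : ((4 * (L * B) ^ 2 : ℕ) : ℝ) ^ 8 * M ≤ 1 := not_lt.1 (Nat.find_min hex (by omega))
  have hup := Nat.find_spec hex
  rw [hB] at hup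
  have hNB : N' ≤ B := by
    have : ∀ j ≤ N', ¬ 1 < ((4 * (L * j) ^ 2 : ℕ) : ℝ) ^ 8 * M := fun j hj => by
      rw [not_lt]
      have h1 := hgap k₀
      rw [le_div_iff₀ (by positivity), mul_comm] at h1
      refine le_trans (mul_le_mul_of_nonneg_right ?_ hM.le) h1
      gcongr
      omega
    by_contra! hlt
    exact this (B + 1) (by omega) (hB ▸ Nat.find_spec hex)
  have hB0 : 0 < B := by omega
  have hBR : (1 : ℝ) ≤ B := by exact_mod_cast hB0
  set P := (L * B) ^ 2 with hP
  have hPL : (P : ℝ) = L ^ 2 * B ^ 2 := by rw [hP]; push_cast; ring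
  have hMinv : 1 / M ≤ (16 * P : ℝ) ^ 8 := by
    rw [div_le_iff₀ hM]
    refine hup.le.trans ?_
    gcongr
    have : 4 * (L * (B + 1)) ^ 2 ≤ 16 * P := by
      calc 4 * (L * (B + 1)) ^ 2 ≤ 4 * (L * (B + B)) ^ 2 := by gcongr; omega
        _ = _ := by rw [hP]; ring
    exact_mod_cast this
  have hBP : B ≤ 4 * P := by
    calc B ≤ L * B := Nat.le_mul_of_pos_left _ hLn
      _ ≤ P := Nat.le_self_pow (by norm_num) _
      _ ≤ _ := by omega
  have hMA : ((4 * P : ℕ) : ℝ) ^ 8 ≤ 1 / M := by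
    rw [le_div_iff₀ hM]; exact hlow
  have hAq : 4 * P ≤ q := by
    have h1 : 1 / M ≤ q := by
      rw [div_le_iff₀ hM]
      have := PerOrbit.span_le hmax 0 q
      rwa [h.add_q, add_sub_cancel_left] at this
    have h2 : (4 * P) ^ 8 ≤ q := by exact_mod_cast hMA.trans h1
    exact (Nat.le_self_pow (by norm_num) _).trans h2
  obtain ⟨s, hsr, hs1⟩ := h.exists_record_one hq
  have hexb : ∃ j, 0 < j ∧ nrm p q j ≤ 4 * P := ⟨s, hsr.pos, by omega⟩
  have hb1 := Nat.find_spec hexb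
  have hbmin : ∀ i, 0 < i → i < Nat.find hexb → 4 * P < nrm p q i := fun i hi hib => by
    have := Nat.find_min hexb hib
    push Not at this
    exact this hi
  have hbs : Nat.find hexb ≤ s := Nat.find_min' hexb ⟨hsr.pos, by omega⟩
  generalize Nat.find hexb = b at hb1 hbmin hbs
  have hb : IsRecord p q b := ⟨hb1.1, hbs.trans_lt hsr.lt, fun i hi hib =>
    lt_of_le_of_lt hb1.2 (hbmin i hi hib)⟩
  obtain ⟨c, a, hsep, hc, ha, -, hor⟩ := exists_sep p h.q_pos hb.pos hb.lt.le
  have hAc : 4 * P ≤ c ∧ Cmp y c (5 * K) := by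
    rcases hor with rfl | ⟨hr, rfl⟩
    · exact ⟨hAq, h.cmp_q hK⟩
    · exact ⟨(hbmin a hr.pos ha).le, h.cmp_record hK hr⟩
  have hD0 : 0 ≤ D := by positivity
  have hE2 : 1 ≤ E ^ 2 := one_le_pow₀ hE
  have hLp : ∀ i, (1 : ℝ) ≤ (L : ℝ) ^ i := fun i => one_le_pow₀ hL1
  have hX : ∀ i ≤ 22, (L : ℝ) ^ i ≤ (L : ℝ) ^ 22 * E ^ 2 := fun i hi =>
    (pow_le_pow_right₀ hL1 hi).trans (le_mul_of_one_le_right (by positivity) hE2)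
  have hC : windowConst K r = 8 * 16 ^ 9 * ((L : ℝ) ^ 22 * E ^ 2) + 8 * D * E ^ 2 := by
    rw [windowConst]; ring
  have hX0 : 0 ≤ 8 * D * E ^ 2 := by positivity
  have hC3 : 5 * ((4 * P : ℕ) : ℝ) ^ 2 ≤ windowConst K r * B ^ 4 := by
    push_cast
    rw [hPL, show 5 * (4 * ((L : ℝ) ^ 2 * B ^ 2)) ^ 2 = 80 * L ^ 4 * B ^ 4 by ring, hC]
    gcongr
    have := hX 4 (by norm_num)
    have := hLp 4
    linarith
  have hC25 : 25 ≤ windowConst K r := by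
    have := hX 0 (by norm_num)
    rw [hC]
    rw [pow_zero] at this
    linarith
  have hC4 : (5 * ((4 * P : ℕ) : ℝ) ^ 2) ^ 2 * M ≤ windowConst K r / B := by
    rw [le_div_iff₀ (by positivity)]
    have hA1 : (1 : ℝ) ≤ (4 * P : ℕ) := by exact_mod_cast (by omega)
    have hBA : (B : ℝ) ≤ (4 * P : ℕ) := by exact_mod_cast hBP
    generalize ((4 * P : ℕ) : ℝ) = A at hlow hA1 hBA
    calc (5 * A ^ 2) ^ 2 * M * B ≤ (5 * A ^ 2) ^ 2 * M * A := by gcongr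
      _ = 25 * (A ^ 5 * M) := by ring
      _ ≤ 25 * (A ^ 8 * M) := by gcongr; norm_num
      _ ≤ 25 * 1 := by gcongr
      _ ≤ _ := by linarith
  refine ⟨B, M, by omega, hmax, ?_⟩
  rcases le_total c ((4 * P) ^ 2) with hcase | hcase
  · refine h.window_short hK hq hAc.2 hAc.1 hcase (r := r) (B := B) (by omega) hBP hB0 rfl ?_ ?_ hC3
      hC4
    · rw [← hEdef]
      calc 1 / M * E ^ 2 ≤ (16 * P : ℝ) ^ 8 * E ^ 2 := by gcongr
        _ = 16 ^ 8 * (L : ℝ) ^ 16 * B ^ 16 * E ^ 2 := by rw [hPL]; ring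
        _ ≤ 16 ^ 8 * (L : ℝ) ^ 22 * B ^ 20 * E ^ 2 := by gcongr; norm_num; norm_num
        _ = 16 ^ 8 * ((L : ℝ) ^ 22 * E ^ 2) * B ^ 20 := by ring
        _ ≤ _ := by
          rw [hC]
          gcongr
          have := hX 0 (by norm_num)
          rw [pow_zero] at this
          linarith
    · rw [← hEdef, ← hD, hC]
      have := hX 0 (by norm_num)
      rw [pow_zero] at this
      nlinarith
  · refine h.window_long hK hq hb hsep hc hAc.2 hL rfl hb1.2 hcase hB0 (r := r) ?_ rfl ?_ ?_ ?_ ?_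
    · rw [← hEdef, ← hD]
      have h1 := Nat.le_ceil (8 * D)
      have h2 : ((⌈8 * D⌉₊ : ℕ) : ℝ) ≤ B := by exact_mod_cast (by omega)
      linarith
    · calc 8 * (4 * P * L : ℝ) ^ 2 * (1 / M) ≤ 8 * (4 * P * L : ℝ) ^ 2 * (16 * P : ℝ) ^ 8 := by
            gcongr
        _ = 8 * 16 ^ 9 * (L : ℝ) ^ 22 * B ^ 20 := by rw [hPL]; ring
        _ ≤ _ := by
          rw [hC]
          gcongr
          have := hX 22 (by norm_num)
          linarith
    · rw [← hEdef, ← hD, hC]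
      have := hX 0 (by norm_num)
      rw [pow_zero] at this
      nlinarith
    · exact_mod_cast hC3
    · exact_mod_cast hC4

/-- The nonlinearity: the derivative of the logarithm of the derivative. -/
noncomputable def nu (g : ℝ → ℝ) : ℝ → ℝ := deriv fun z => Real.log (deriv g z)

/-- The Schwarzian derivative. -/
noncomputable def sch (g : ℝ → ℝ) (x : ℝ) : ℝ := deriv (nu g) x - nu g x * nu g x / 2

/-- The Schwarzian derivative of the `n`-th iterate. -/
noncomputable def schSum (g : ℝ → ℝ) (n : ℕ) (x : ℝ) : ℝ :=
  ∑ i ∈ Finset.range n, sch g (g^[i] x) * (deriv g^[i] x * deriv g^[i] x)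

section

variable {g : ℝ → ℝ}

lemma IsLift.smooth_nu (hg : IsLift g) : ContDiff ℝ ∞ (nu g) := smooth_deriv hg.smooth_log_deriv

lemma IsLift.smooth_sch (hg : IsLift g) : ContDiff ℝ ∞ (sch g) :=
  (smooth_deriv hg.smooth_nu).sub ((hg.smooth_nu.mul hg.smooth_nu).div_const 2)

lemma IsLift.smooth_deriv_iterate (hg : IsLift g) (n : ℕ) : ContDiff ℝ ∞ (deriv g^[n]) :=
  smooth_deriv (hg.iterate n).smooth

lemma IsLift.smooth_nonlin (hg : IsLift g) (n : ℕ) : ContDiff ℝ ∞ (nonlin g n) :=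
  ContDiff.sum fun i _ => (hg.smooth_nu.comp (hg.iterate i).smooth).mul (hg.smooth_deriv_iterate i)

lemma IsLift.hasDerivAt_nonlin (hg : IsLift g) (n : ℕ) (x : ℝ) :
    HasDerivAt (nonlin g n) (nonlin g n x ^ 2 / 2 + schSum g n x) x := by
  induction n with
  | zero =>
    have : nonlin g 0 = fun _ => 0 := funext fun _ => by simp [nonlin]
    rw [this]
    simpa [schSum] using hasDerivAt_const x (0 : ℝ)
  | succ n ih =>
    have e : nonlin g (n + 1) = fun z => nonlin g n z + nu g (g^[n] z) * deriv g^[n] z :=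
      funext fun z => Finset.sum_range_succ _ n
    have h1 := ((smooth_differentiable hg.smooth_nu (g^[n] x)).hasDerivAt).comp x
      (smooth_differentiable (hg.iterate n).smooth x).hasDerivAt
    have h2 := ih.fun_add (h1.fun_mul (hg.hasDerivAt_deriv_iterate n x))
    rw [e]
    refine HasDerivAt.congr_deriv h2 ?_
    rw [show schSum g (n + 1) x = schSum g n x + sch g (g^[n] x) * (deriv g^[n] x * deriv g^[n] x)
      from Finset.sum_range_succ _ n, sch]
    simp only [Function.comp_apply]
    ring

end

lemma riccati_right {u u' : ℝ → ℝ} (hu : ∀ x, HasDerivAt u (u' x) x) {x₀ d : ℝ} (hd : 0 < d)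
    (h : ∀ x, x₀ ≤ x → x < x₀ + d → u x ^ 2 / 2 - 1 / (2 * (x₀ + d - x) ^ 2) ≤ u' x) :
    u x₀ ≤ 3 / d := by
  by_contra! hlt
  rw [div_lt_iff₀ hd] at hlt
  set φ : ℝ → ℝ := fun x => u x * (x₀ + d - x) with hφ
  have hφd : ∀ x, HasDerivAt φ (u' x * (x₀ + d - x) + u x * (-1)) x := fun x =>
    (hu x).mul ((hasDerivAt_id x).const_sub _)
  have hcont : Continuous φ := continuous_iff_continuousAt.2 fun x => (hφd x).continuousAt
  have hge : ∀ b, b < x₀ + d → ∀ x ∈ Set.Icc x₀ b, -φ x ≤ -3 := by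
    intro b hb
    refine image_le_of_deriv_right_lt_deriv_boundary (f := fun x => -φ x)
      (f' := fun x => -(u' x * (x₀ + d - x) + u x * (-1))) (B := fun _ => -3) (B' := fun _ => 0)
      hcont.neg.continuousOn (fun x _ => (hφd x).neg.hasDerivWithinAt) ?_
      (fun x => hasDerivAt_const x _) ?_
    · simp only [hφ]
      linarith
    · intro x hx hx3
      have hτ : 0 < x₀ + d - x := by linarith [hx.2]
      have h1 := h x hx.1 (by linarith)
      simp only [hφ] at hx3
      set τ := x₀ + d - x
      have h2 : u x = 3 / τ := by rw [eq_div_iff hτ.ne']; linarith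
      rw [h2] at h1 ⊢
      have h3 : (3 / τ) ^ 2 / 2 - 1 / (2 * τ ^ 2) = 4 / τ / τ := by field_simp; ring
      rw [h3, div_le_iff₀ hτ] at h1
      have h4 : 3 / τ < 4 / τ := by gcongr; norm_num
      linarith
  have hlim : Tendsto φ (𝓝[<] (x₀ + d)) (𝓝 (φ (x₀ + d))) :=
    (hcont.tendsto _).mono_left nhdsWithin_le_nhds
  have h0 : φ (x₀ + d) = 0 := by simp [hφ]
  have h3 : (3 : ℝ) ≤ φ (x₀ + d) := by
    refine ge_of_tendsto hlim ?_
    have : ∀ᶠ x in 𝓝[<] (x₀ + d), x ∈ Set.Ioo x₀ (x₀ + d) :=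
      Ioo_mem_nhdsLT (by linarith)
    filter_upwards [this] with x hx
    linarith [hge x hx.2 x ⟨hx.1.le, le_rfl⟩]
  linarith

lemma riccati {u u' : ℝ → ℝ} (hu : ∀ x, HasDerivAt u (u' x) x) {x₀ d : ℝ} (hd : 0 < d)
    (h : ∀ x, |x - x₀| < d → u x ^ 2 / 2 - 1 / (2 * (d - |x - x₀|) ^ 2) ≤ u' x) :
    |u x₀| ≤ 3 / d := by
  rw [abs_le']
  constructor
  · refine riccati_right hu hd fun x h1 h2 => ?_
    have h3 : |x - x₀| = x - x₀ := abs_of_nonneg (by linarith)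
    have := h x (by linarith)
    rwa [h3, show d - (x - x₀) = x₀ + d - x by ring] at this
  · have hv : ∀ x, HasDerivAt (fun z => -u (-z)) (u' (-x)) x := fun x => by
      have := ((hu (-x)).comp x (hasDerivAt_neg x)).fun_neg
      simpa using this
    have := riccati_right hv (x₀ := -x₀) hd fun x h1 h2 => ?_
    · simpa using this
    have h3 : |-x - x₀| = x + x₀ := by
      rw [abs_sub_comm, abs_of_nonneg] <;> linarith
    have := h (-x) (by linarith)
    rw [h3, show d - (x + x₀) = -x₀ + d - x by ring] at this
    simpa using this

/-- Solutions of a linear differential equation inherit derivative bounds. -/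
lemma derivBound_of_linear (n : ℕ) {C : ℝ} (hC : 0 ≤ C) : ∃ C' ≥ 1, ∀ (f u : ℝ → ℝ) (x s : ℝ),
    ContDiff ℝ ∞ f → ContDiff ℝ ∞ u → (∀ z, deriv f z = f z * u z) → 0 ≤ s →
    DerivBound u x n s (C * s) → DerivBound f x (n + 1) s (C' * |f x|) := by
  have step : ∀ (n : ℕ) (D : ℝ), 1 ≤ D → ∀ (f u : ℝ → ℝ) (x s : ℝ),
      ContDiff ℝ ∞ f → ContDiff ℝ ∞ u → (∀ z, deriv f z = f z * u z) → 0 ≤ s →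
      DerivBound u x n s (C * s) → DerivBound f x n s (D * |f x|) →
      DerivBound f x (n + 1) s ((1 + 2 ^ n * (D * C)) * |f x|) := by
    intro n D hD f u x s hf hu hode hs hub hfb
    refine DerivBound.of_succ (le_mul_of_one_le_left (abs_nonneg _) ?_) ?_
    · have : 0 ≤ 2 ^ n * (D * C) := by positivity
      linarith
    · rw [show deriv f = fun z => f z * u z from funext hode]
      refine (DerivBound.mul hf hu hs hfb hub).mono hs ?_ le_rfl
      have : 0 ≤ |f x| * s := by positivity
      calc _ = 2 ^ n * (D * C) * (|f x| * s) := by ring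
        _ ≤ (1 + 2 ^ n * (D * C)) * (|f x| * s) := by gcongr; linarith
        _ = _ := by ring
  induction n with
  | zero =>
    refine ⟨1 + 2 ^ 0 * (1 * C), by simpa using hC, fun f u x s hf hu hode hs hub =>
      step 0 1 le_rfl f u x s hf hu hode hs hub fun i hi => ?_⟩
    obtain rfl : i = 0 := by omega
    simp
  | succ n ih =>
    obtain ⟨D, hD, ih⟩ := ih
    refine ⟨1 + 2 ^ (n + 1) * (D * C), ?_, fun f u x s hf hu hode hs hub =>
      step (n + 1) D hD f u x s hf hu hode hs hub
        (ih f u x s hf hu hode hs (hub.mono hs le_rfl (by omega)))⟩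
    have : 0 ≤ 2 ^ (n + 1) * (D * C) := by positivity
    linarith

/-- Hypotheses for the distortion estimates: an interval whose images under the first `q`
iterates have small total squared length. -/
structure SmallSquares (g : ℝ → ℝ) (q : ℕ) (lo hi S : ℝ) : Prop where
  lift : IsLift g
  le_one : ∀ i ≤ q, g^[i] hi - g^[i] lo ≤ 1
  sch_le : ∀ x, |sch g x| ≤ S
  sum_le : S * ∑ i ∈ Finset.range q, (g^[i] hi - g^[i] lo) ^ 2 ≤ 1 / (2 * Real.exp 6)

namespace SmallSquares

variable {g : ℝ → ℝ} {q : ℕ} {lo hi S : ℝ}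

lemma S_nonneg (h : SmallSquares g q lo hi S) : 0 ≤ S := (abs_nonneg _).trans (h.sch_le 0)

lemma deriv_le_of_nonlin (h : SmallSquares g q lo hi S) {j : ℕ}
    (hu : ∀ x d, 0 < d → lo ≤ x - d → x + d ≤ hi → |nonlin g j x| ≤ 3 / d) {x d : ℝ} (hd : 0 < d)
    (h1 : lo ≤ x - d) (h2 : x + d ≤ hi) :
    deriv g^[j] x ≤ Real.exp 3 * (g^[j] hi - g^[j] lo) / d := by
  have hl := h.lift.iterate j
  have hlt : x - d / 2 < x + d / 2 := by linarith
  obtain ⟨z, hz, e⟩ := exists_deriv_eq_slope g^[j] hlt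
    hl.smooth.continuous.continuousOn (smooth_differentiable hl.smooth).differentiableOn
  rw [show x + d / 2 - (x - d / 2) = d by ring, eq_div_iff hd.ne'] at e
  have hlog : |Real.log (deriv g^[j] x) - Real.log (deriv g^[j] z)| ≤ 6 / d * |x - z| := by
    refine abs_sub_le_of_deriv_le (u := fun x => Real.log (deriv g^[j] x)) (fun w =>
      (h.lift.hasDerivAt_log j w).differentiableAt) fun w hw => ?_
    rw [(h.lift.hasDerivAt_log j w).deriv]
    have hw' : w ∈ Set.Icc (x - d / 2) (x + d / 2) :=
      Set.uIcc_subset_Icc ⟨by linarith, by linarith⟩ ⟨hz.1.le, hz.2.le⟩ hw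
    refine (hu w (d / 2) (by linarith) (by linarith [hw'.1]) (by linarith [hw'.2])).trans
      (le_of_eq ?_)
    field_simp
    norm_num
  have hxz : |x - z| ≤ d / 2 := by rw [abs_le]; constructor <;> linarith [hz.1, hz.2]
  have h3 : 6 / d * |x - z| ≤ 3 := by
    calc 6 / d * |x - z| ≤ 6 / d * (d / 2) := by gcongr
      _ = 3 := by field_simp; norm_num
  have h4 : deriv g^[j] x ≤ Real.exp 3 * deriv g^[j] z := by
    rw [← Real.log_le_log_iff (hl.deriv_pos x) (mul_pos (Real.exp_pos _) (hl.deriv_pos z)),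
      Real.log_mul (Real.exp_pos _).ne' (hl.deriv_pos z).ne', Real.log_exp]
    linarith [(abs_le.1 hlog).2]
  rw [le_div_iff₀ hd]
  have m1 : g^[j] (x + d / 2) ≤ g^[j] hi := hl.strictMono.monotone (by linarith)
  have m2 : g^[j] lo ≤ g^[j] (x - d / 2) := hl.strictMono.monotone (by linarith)
  calc deriv g^[j] x * d ≤ Real.exp 3 * deriv g^[j] z * d := by gcongr
    _ = Real.exp 3 * (deriv g^[j] z * d) := by ring
    _ ≤ _ := by rw [e]; gcongr

lemma nonlin_le (h : SmallSquares g q lo hi S) {j : ℕ} (hj : j ≤ q) :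
    ∀ x d, 0 < d → lo ≤ x - d → x + d ≤ hi → |nonlin g j x| ≤ 3 / d := by
  induction j using Nat.strong_induction_on with
  | _ j ih =>
  intro x d hd h1 h2
  refine riccati (h.lift.hasDerivAt_nonlin j) hd fun z hz => ?_
  set d' := d - |z - x| with hd'
  have hd'0 : 0 < d' := by linarith
  have a1 := abs_le.1 (le_refl |z - x|)
  have hbd : |schSum g j z| ≤ 1 / (2 * d' ^ 2) := by
    calc |schSum g j z| ≤ ∑ i ∈ Finset.range j,
          S * (Real.exp 6 / d' ^ 2 * (g^[i] hi - g^[i] lo) ^ 2) := by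
          refine (Finset.abs_sum_le_sum_abs _ _).trans (Finset.sum_le_sum fun i hi' => ?_)
          rw [Finset.mem_range] at hi'
          have hD := h.deriv_le_of_nonlin (ih i hi' (by omega)) hd'0 (x := z)
            (by linarith) (by linarith)
          have hpos := (h.lift.iterate i).deriv_pos z
          rw [abs_mul, abs_of_pos (mul_pos hpos hpos)]
          refine mul_le_mul (h.sch_le _) ?_ (mul_pos hpos hpos).le h.S_nonneg
          calc deriv g^[i] z * deriv g^[i] z
              ≤ (Real.exp 3 * (g^[i] hi - g^[i] lo) / d')
                * (Real.exp 3 * (g^[i] hi - g^[i] lo) / d') :=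
                mul_le_mul hD hD hpos.le (hpos.le.trans hD)
            _ = (Real.exp 3 * Real.exp 3) / d' ^ 2 * (g^[i] hi - g^[i] lo) ^ 2 := by ring_nf
            _ = _ := by rw [← Real.exp_add]; norm_num
      _ = Real.exp 6 / d' ^ 2 * (S * ∑ i ∈ Finset.range j, (g^[i] hi - g^[i] lo) ^ 2) := by
          rw [Finset.mul_sum, Finset.mul_sum]
          exact Finset.sum_congr rfl fun i _ => by ring
      _ ≤ Real.exp 6 / d' ^ 2 * (S * ∑ i ∈ Finset.range q, (g^[i] hi - g^[i] lo) ^ 2) := by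
          have := h.S_nonneg
          gcongr
      _ ≤ Real.exp 6 / d' ^ 2 * (1 / (2 * Real.exp 6)) := by gcongr; exact h.sum_le
      _ = _ := by have := Real.exp_pos 6; field_simp
  linarith [(abs_le.1 hbd).1]

lemma deriv_iterate_le (h : SmallSquares g q lo hi S) {j : ℕ} (hj : j ≤ q) {x d : ℝ} (hd : 0 < d)
    (h1 : lo ≤ x - d) (h2 : x + d ≤ hi) :
    deriv g^[j] x ≤ Real.exp 3 * (g^[j] hi - g^[j] lo) / d :=
  h.deriv_le_of_nonlin (h.nonlin_le hj) hd h1 h2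

end SmallSquares

namespace SmallSquares

variable {g : ℝ → ℝ} {q : ℕ} {lo hi S : ℝ}

lemma span_nonneg (h : SmallSquares g q lo hi S) (hl : lo ≤ hi) (i : ℕ) :
    0 ≤ g^[i] hi - g^[i] lo := sub_nonneg.2 ((h.lift.iterate i).strictMono.monotone hl)

lemma derivBound_deriv_iterate_of_nonlin {C C' : ℝ} {l : ℕ}
    (hC' : ∀ (f u : ℝ → ℝ) (x s : ℝ), ContDiff ℝ ∞ f → ContDiff ℝ ∞ u →
      (∀ z, deriv f z = f z * u z) → 0 ≤ s → DerivBound u x l s (C * s) →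
      DerivBound f x (l + 1) s (C' * |f x|))
    (hg : IsLift g) {j : ℕ} {x s : ℝ} (hs : 0 ≤ s) (hu : DerivBound (nonlin g j) x l s (C * s)) :
    DerivBound (deriv g^[j]) x (l + 1) s (C' * deriv g^[j] x) := by
  have := hC' _ _ x s (hg.smooth_deriv_iterate j) (hg.smooth_nonlin j)
    (fun z => (hg.hasDerivAt_deriv_iterate j z).deriv) hs hu
  rwa [abs_of_pos ((hg.iterate j).deriv_pos x)] at this

lemma derivBound_nonlin (l : ℕ) {A : ℝ} (hA : 0 ≤ A) : ∃ C ≥ 0, ∀ (g : ℝ → ℝ) (q : ℕ)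
    (lo hi S : ℝ), SmallSquares g q lo hi S → (∀ i ≤ l, ∀ x, |iteratedDeriv i (sch g) x| ≤ A) →
    ∑ i ∈ Finset.range q, (g^[i] hi - g^[i] lo) ^ 2 ≤ 1 →
    ∀ j ≤ q, ∀ x d, 0 < d → lo ≤ x - d → x + d ≤ hi →
      DerivBound (nonlin g j) x l (1 / d) (C * (1 / d)) := by
  induction l with
  | zero =>
    refine ⟨3, by norm_num, fun g q lo hi S h _ _ j hj x d hd h1 h2 i hi' => ?_⟩
    obtain rfl : i = 0 := by omega
    simpa [div_eq_mul_inv] using h.nonlin_le hj x d hd h1 h2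
  | succ l ih =>
    obtain ⟨C, hC, ih⟩ := ih
    obtain ⟨C', hC'1, hC'⟩ := derivBound_of_linear l hC
    set E : ℝ := C' * Real.exp 3 with hE
    have hE1 : 1 ≤ E := one_le_mul_of_one_le_of_one_le hC'1 (Real.one_le_exp (by norm_num))
    set W : ℝ := 2 ^ l * (l.factorial * A * E ^ l * (2 ^ l * E ^ 2)) with hW
    have hW0 : 0 ≤ W := by positivity
    set D : ℝ := 2 ^ l * (2 ^ l * (C * C) * (1 / 2)) with hD
    have hD0 : 0 ≤ D := by positivity
    refine ⟨3 + (D + W), by positivity, fun g q lo hi S h hsch hsum j hj x d hd h1 h2 => ?_⟩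
    have hlohi : lo ≤ hi := by linarith
    have hs : (0 : ℝ) ≤ 1 / d := by positivity
    have hu := fun i (hiq : i ≤ q) =>
      ih g q lo hi S h (fun i hil => hsch i (by omega)) hsum i hiq x d hd h1 h2
    have hDg := fun i (hi : i ≤ q) => derivBound_deriv_iterate_of_nonlin hC' h.lift hs (hu i hi)
    have hdg : ∀ i ≤ q, C' * deriv g^[i] x ≤ E * (g^[i] hi - g^[i] lo) * (1 / d) := fun i hi' => by
      have := h.deriv_iterate_le hi' hd h1 h2
      calc C' * deriv g^[i] x ≤ C' * (Real.exp 3 * (g^[i] hi - g^[i] lo) / d) := by gcongr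
        _ = _ := by ring
    have hterm : ∀ i < j, DerivBound (fun z => sch g (g^[i] z) * (deriv g^[i] z * deriv g^[i] z))
        x l (1 / d) (W * (g^[i] hi - g^[i] lo) ^ 2 * (1 / d) ^ 2) := fun i hij => by
      have hiq : i ≤ q := by omega
      have hI := h.span_nonneg hlohi i
      have hcomp := DerivBound.comp (n := l) (x := x) h.lift.smooth_sch (h.lift.iterate i).smooth hs
        (C := A) hE1 (fun m hm => hsch m (by omega) _) fun m hm1 hm => by
          obtain ⟨m, rfl⟩ : ∃ m', m = m' + 1 := ⟨m - 1, by omega⟩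
          rw [iteratedDeriv_succ']
          refine (hDg i hiq m (by omega)).trans ?_
          calc C' * deriv g^[i] x * (1 / d) ^ m
              ≤ E * (g^[i] hi - g^[i] lo) * (1 / d) * (1 / d) ^ m :=
                mul_le_mul_of_nonneg_right (hdg i hiq) (by positivity)
            _ ≤ E * 1 * (1 / d) * (1 / d) ^ m := by gcongr; exact h.le_one i hiq
            _ = _ := by ring
      have hsq := ((hDg i hiq).mono hs le_rfl (Nat.le_succ l)).mul
        (h.lift.smooth_deriv_iterate i) (h.lift.smooth_deriv_iterate i) hs
        ((hDg i hiq).mono hs le_rfl (Nat.le_succ l))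
      refine (hcomp.mul (h.lift.smooth_sch.comp (h.lift.iterate i).smooth)
        ((h.lift.smooth_deriv_iterate i).mul (h.lift.smooth_deriv_iterate i)) hs hsq).mono hs ?_
        le_rfl
      have hpos : 0 ≤ C' * deriv g^[i] x :=
        mul_nonneg (by linarith) ((h.lift.iterate i).deriv_pos x).le
      have := hdg i hiq
      calc _ ≤ 2 ^ l * (l.factorial * A * E ^ l * (2 ^ l *
            ((E * (g^[i] hi - g^[i] lo) * (1 / d)) * (E * (g^[i] hi - g^[i] lo) * (1 / d))))) := by
            gcongr
        _ = _ := by rw [hW]; ring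
    have hsm : ∀ i, ContDiff ℝ ∞ fun z => sch g (g^[i] z) * (deriv g^[i] z * deriv g^[i] z) :=
      fun i => (h.lift.smooth_sch.comp (h.lift.iterate i).smooth).mul
        ((h.lift.smooth_deriv_iterate i).mul (h.lift.smooth_deriv_iterate i))
    have hS : DerivBound (schSum g j) x l (1 / d) (W * (1 / d) ^ 2) := by
      refine (DerivBound.sum (Finset.range j) (fun i _ => hsm i) fun i hi =>
        hterm i (Finset.mem_range.1 hi)).mono hs ?_ le_rfl
      rw [← Finset.sum_mul, ← Finset.mul_sum]
      have : ∑ i ∈ Finset.range j, (g^[i] hi - g^[i] lo) ^ 2 ≤ 1 :=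
        (Finset.sum_le_sum_of_subset_of_nonneg (Finset.range_mono hj)
          fun i _ _ => sq_nonneg _).trans hsum
      calc _ ≤ W * 1 * (1 / d) ^ 2 := by gcongr
        _ = _ := by ring
    have hsu := h.lift.smooth_nonlin j
    have hcst : ContDiff ℝ ∞ fun _ : ℝ => (1 / 2 : ℝ) := contDiff_const
    have hQ := ((hu j hj).mul hsu hsu hs (hu j hj)).mul (hsu.mul hsu) hcst hs
      (DerivBound.const (x := x) (n := l) (1 / 2 : ℝ) hs)
    have hder : deriv (nonlin g j) =
        fun z => nonlin g j z * nonlin g j z * (1 / 2) + schSum g j z :=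
      funext fun z => by rw [(h.lift.hasDerivAt_nonlin j z).deriv]; ring
    refine DerivBound.of_succ ?_ ?_
    · refine (h.nonlin_le hj x d hd h1 h2).trans ?_
      rw [div_eq_mul_one_div 3 d]
      exact mul_le_mul_of_nonneg_right (by linarith) hs
    · rw [hder]
      refine (hQ.add ((hsu.mul hsu).mul hcst) (ContDiff.sum fun i _ => hsm i) hS).mono hs ?_ le_rfl
      have h12 : |(1 / 2 : ℝ)| = 1 / 2 := abs_of_pos (by norm_num)
      rw [h12]
      calc _ = (D + W) * (1 / d) ^ 2 := by rw [hD]; ring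
        _ ≤ (3 + (D + W)) * (1 / d) ^ 2 :=
            mul_le_mul_of_nonneg_right (by linarith) (by positivity)
        _ = _ := by ring

/-- Derivative bounds for iterates well inside an interval with small total squared length. -/
lemma derivBound_deriv_iterate (l : ℕ) {A : ℝ} (hA : 0 ≤ A) : ∃ C ≥ 1, ∀ (g : ℝ → ℝ) (q : ℕ)
    (lo hi S : ℝ), SmallSquares g q lo hi S → (∀ i ≤ l, ∀ x, |iteratedDeriv i (sch g) x| ≤ A) →
    ∑ i ∈ Finset.range q, (g^[i] hi - g^[i] lo) ^ 2 ≤ 1 →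
    ∀ j ≤ q, ∀ x d, 0 < d → lo ≤ x - d → x + d ≤ hi →
      DerivBound (deriv g^[j]) x l (1 / d) (C * ((g^[j] hi - g^[j] lo) / d)) := by
  obtain ⟨C, hC, h0⟩ := derivBound_nonlin l hA
  obtain ⟨C', hC'1, hC'⟩ := derivBound_of_linear l hC
  refine ⟨C' * Real.exp 3, one_le_mul_of_one_le_of_one_le hC'1 (Real.one_le_exp (by norm_num)),
    fun g q lo hi S h hsch hsum j hj x d hd h1 h2 => ?_⟩
  have hs : (0 : ℝ) ≤ 1 / d := by positivity
  refine (derivBound_deriv_iterate_of_nonlin hC' h.lift hs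
    (h0 g q lo hi S h hsch hsum j hj x d hd h1 h2)).mono hs ?_ (Nat.le_succ l)
  have := h.deriv_iterate_le hj hd h1 h2
  calc C' * deriv g^[j] x ≤ C' * (Real.exp 3 * (g^[j] hi - g^[j] lo) / d) := by gcongr
    _ = _ := by ring

end SmallSquares

/-- Iterated Rolle: a function with `n + 1` zeros has zeros of all derivatives up to order `n`. -/
lemma exists_zero_iteratedDeriv (n : ℕ) : ∀ (ψ : ℝ → ℝ) (z : ℕ → ℝ), ContDiff ℝ ∞ ψ →
    (∀ i < n, z i < z (i + 1)) → (∀ i ≤ n, ψ (z i) = 0) →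
    ∀ j ≤ n, ∃ w ∈ Set.Icc (z 0) (z n), iteratedDeriv j ψ w = 0 := by
  induction n with
  | zero =>
    intro ψ z _ _ h0 j hj
    obtain rfl : j = 0 := by omega
    exact ⟨z 0, Set.left_mem_Icc.2 le_rfl, by simpa using h0 0 le_rfl⟩
  | succ n ih =>
    intro ψ z hψ hz h0 j hj
    have hle : ∀ m ≤ n + 1, z 0 ≤ z m := fun m => by
      induction m with
      | zero => simp
      | succ m ihm => exact fun hm => (ihm (by omega)).trans (hz m (by omega)).le
    rcases j with _ | j
    · exact ⟨z 0, Set.left_mem_Icc.2 (hle _ le_rfl), by simpa using h0 0 (by omega)⟩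
    have hrolle : ∀ i, ∃ w, i ≤ n → w ∈ Set.Ioo (z i) (z (i + 1)) ∧ deriv ψ w = 0 := fun i => by
      by_cases hi : i ≤ n
      · obtain ⟨w, hw, hw'⟩ := exists_deriv_eq_zero (hz i (by omega)) hψ.continuous.continuousOn
          (by rw [h0 i (by omega), h0 (i + 1) (by omega)])
        exact ⟨w, fun _ => ⟨hw, hw'⟩⟩
      · exact ⟨0, fun h => absurd h hi⟩
    choose w hw using hrolle
    obtain ⟨v, hv, hv'⟩ := ih (deriv ψ) w (smooth_deriv hψ)
      (fun i hi => (hw i hi.le).1.2.trans (hw (i + 1) hi).1.1) (fun i hi => (hw i hi).2) j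
      (by omega)
    refine ⟨v, ⟨(hw 0 (by omega)).1.1.le.trans hv.1, hv.2.trans (hw n le_rfl).1.2.le⟩, ?_⟩
    rwa [iteratedDeriv_succ']

lemma abs_iteratedDeriv_le_of_zeros {ψ : ℝ → ℝ} (hψ : ContDiff ℝ ∞ ψ) {lo hi M : ℝ} {n : ℕ}
    (h0 : ∀ j ≤ n, ∃ w ∈ Set.Icc lo hi, iteratedDeriv j ψ w = 0)
    (hM : ∀ x ∈ Set.Icc lo hi, |iteratedDeriv (n + 1) ψ x| ≤ M) (m : ℕ) :
    ∀ j, j + m = n + 1 → ∀ x ∈ Set.Icc lo hi, |iteratedDeriv j ψ x| ≤ M * (hi - lo) ^ m := by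
  induction m with
  | zero =>
    intro j hj x hx
    obtain rfl : j = n + 1 := by omega
    simpa using hM x hx
  | succ m ih =>
    intro j hj x hx
    obtain ⟨w, hw, hw'⟩ := h0 j (by omega)
    have key := abs_sub_le_of_deriv_le (smooth_differentiable (smooth_iteratedDeriv hψ j))
      (a := x) (b := w) (C := M * (hi - lo) ^ m) fun z hz => by
        rw [← iteratedDeriv_succ]
        exact ih (j + 1) (by omega) z (Set.uIcc_subset_Icc hx hw hz)
    rw [hw', sub_zero] at key
    have hxw : |x - w| ≤ hi - lo := by
      rw [abs_le]; constructor <;> linarith [hx.1, hx.2, hw.1, hw.2]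
    have h1 : 0 ≤ M * (hi - lo) ^ m := (abs_nonneg _).trans (ih (j + 1) (by omega) x hx)
    calc _ ≤ M * (hi - lo) ^ m * |x - w| := key
      _ ≤ M * (hi - lo) ^ m * (hi - lo) := by gcongr
      _ = _ := by ring

/-- A continuous periodic function is bounded. -/
lemma exists_bound_of_periodic {f : ℝ → ℝ} (hf : Continuous f) (hp : ∀ x, f (x + 1) = f x) :
    ∃ C, ∀ x, |f x| ≤ C := by
  obtain ⟨C, hC⟩ := (isCompact_Icc (a := (0 : ℝ)) (b := 1)).exists_bound_of_continuousOn
    hf.continuousOn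
  refine ⟨C, fun x => ?_⟩
  have hper : Function.Periodic f 1 := hp
  have h1 : f x = f (Int.fract x) := by
    have := hper.sub_int_mul_eq ⌊x⌋ (x := x)
    rw [mul_one] at this
    rw [Int.fract, this]
  rw [h1]
  exact hC _ ⟨Int.fract_nonneg x, (Int.fract_lt_one x).le⟩

lemma iteratedDeriv_periodic {f : ℝ → ℝ} (hp : ∀ x, f (x + 1) = f x) (n : ℕ) (x : ℝ) :
    iteratedDeriv n f (x + 1) = iteratedDeriv n f x := by
  have := congrFun (iteratedDeriv_comp_add_const n f 1) x
  rw [← this]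
  congr 1
  exact funext hp

/-- Uniform bounds for finitely many derivatives of a smooth periodic function. -/
lemma exists_iteratedDeriv_bound {f : ℝ → ℝ} (hf : ContDiff ℝ ∞ f) (hp : ∀ x, f (x + 1) = f x)
    (n : ℕ) : ∃ C, ∀ i ≤ n, ∀ x, |iteratedDeriv i f x| ≤ C := by
  have : ∀ i, ∃ C, ∀ x, |iteratedDeriv i f x| ≤ C := fun i =>
    exists_bound_of_periodic (smooth_iteratedDeriv hf i).continuous (iteratedDeriv_periodic hp i)
  choose C hC using this
  refine ⟨∑ i ∈ Finset.range (n + 1), C i, fun i hi x => (hC i x).trans ?_⟩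
  exact Finset.single_le_sum (f := C) (fun j _ => (abs_nonneg _).trans (hC j 0))
    (Finset.mem_range.2 (by omega))

lemma iteratedDeriv_eq_zero_of_const {f : ℝ → ℝ} {U : Set ℝ} (hU : IsOpen U) {c : ℝ}
    (hc : ∀ x ∈ U, f x = c) {i : ℕ} (hi : 1 ≤ i) {x : ℝ} (hx : x ∈ U) :
    iteratedDeriv i f x = 0 := by
  have : f =ᶠ[𝓝 x] fun _ => c := by
    filter_upwards [hU.mem_nhds hx] with z hz using hc z hz
  rw [this.iteratedDeriv_eq i, iteratedDeriv_const, if_neg (by omega)]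

lemma exists_smoothTransition_bound (n : ℕ) :
    ∃ C, ∀ i ≤ n, ∀ x, |iteratedDeriv i Real.smoothTransition x| ≤ C := by
  have hS : ContDiff ℝ ∞ Real.smoothTransition := Real.smoothTransition.contDiff
  have : ∀ i, ∃ C, ∀ x, |iteratedDeriv i Real.smoothTransition x| ≤ C := fun i => by
    obtain ⟨C, hC⟩ := (isCompact_Icc (a := (0 : ℝ)) (b := 1)).exists_bound_of_continuousOn
      (smooth_iteratedDeriv hS i).continuous.continuousOn
    refine ⟨max C 1, fun x => ?_⟩
    rcases Nat.eq_zero_or_pos i with rfl | hi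
    · rw [iteratedDeriv_zero, abs_of_nonneg (Real.smoothTransition.nonneg x)]
      exact (Real.smoothTransition.le_one x).trans (le_max_right _ _)
    by_cases hx : x ∈ Set.Icc (0 : ℝ) 1
    · exact (hC x hx).trans (le_max_left _ _)
    have h0 : iteratedDeriv i Real.smoothTransition x = 0 := by
      rw [Set.mem_Icc, not_and_or, not_le, not_le] at hx
      rcases hx with hx | hx
      · exact iteratedDeriv_eq_zero_of_const isOpen_Iio
          (fun z hz => Real.smoothTransition.zero_of_nonpos (le_of_lt hz)) hi hx
      · exact iteratedDeriv_eq_zero_of_const isOpen_Ioi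
          (fun z hz => Real.smoothTransition.one_of_one_le (le_of_lt hz)) hi hx
    rw [h0, abs_zero]
    exact zero_le_one.trans (le_max_right _ _)
  choose C hC using this
  refine ⟨∑ i ∈ Finset.range (n + 1), C i, fun i hi x => (hC i x).trans ?_⟩
  exact Finset.single_le_sum (f := C) (fun j _ => (abs_nonneg _).trans (hC j 0))
    (Finset.mem_range.2 (by omega))

/-- Periodic bump functions with polynomial derivative bounds. -/
lemma exists_bump (n : ℕ) : ∃ (c : ℕ) (C : ℝ), 2 ≤ C ∧ ∀ a ℓ δ : ℝ, 0 < ℓ → 0 < δ →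
    ℓ + 2 * δ ≤ 1 / 2 →
    ∃ w : ℝ → ℝ, ContDiff ℝ ∞ w ∧ (∀ x, w (x + 1) = w x) ∧ (∀ x, 0 ≤ w x) ∧ (∀ x, w x ≤ 1) ∧
      (∀ x ∈ Set.Icc a (a + ℓ), w x = 1) ∧ (∀ x ∈ Set.Icc (a + ℓ + δ) (a + 1 - δ), w x = 0) ∧
      ∀ x, DerivBound w x n 1 ((C / δ ^ 2) ^ c) := by
  set k : ℝ → ℝ := fun x => Real.cos (2 * Real.pi * x) with hk
  have hks : ContDiff ℝ ∞ k := Real.contDiff_cos.comp (contDiff_const.mul contDiff_id)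
  obtain ⟨C₁, hC₁⟩ := exists_iteratedDeriv_bound hks (fun x => by
    simp only [hk]; rw [mul_add, mul_one, Real.cos_add_two_pi]) n
  obtain ⟨C₂, hC₂⟩ := exists_smoothTransition_bound n
  have hC₁0 : 0 ≤ C₁ := (abs_nonneg _).trans (hC₁ 0 (Nat.zero_le _) 0)
  have hC₂0 : 0 ≤ C₂ := (abs_nonneg _).trans (hC₂ 0 (Nat.zero_le _) 0)
  refine ⟨n * n + 1 + n, 2 + C₁ + C₂, by linarith, fun a ℓ δ hℓ hδ hs => ?_⟩
  have hpi := Real.pi_pos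
  set θ₀ : ℝ := Real.pi * ℓ with hθ₀
  set θ₁ : ℝ := Real.pi * (ℓ + 2 * δ) with hθ₁
  have hθ₁π : θ₁ ≤ Real.pi / 2 := by rw [hθ₁]; nlinarith
  have hΔ : 8 * δ ^ 2 ≤ Real.cos θ₀ - Real.cos θ₁ := by
    rw [Real.cos_sub_cos, show (θ₀ + θ₁) / 2 = Real.pi * (ℓ + δ) by rw [hθ₀, hθ₁]; ring,
      show (θ₀ - θ₁) / 2 = -(Real.pi * δ) by rw [hθ₀, hθ₁]; ring, Real.sin_neg]
    have h1 := Real.mul_le_sin (x := Real.pi * (ℓ + δ)) (by positivity) (by nlinarith)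
    have h2 := Real.mul_le_sin (x := Real.pi * δ) (by positivity) (by nlinarith)
    rw [show 2 / Real.pi * (Real.pi * (ℓ + δ)) = 2 * (ℓ + δ) by field_simp] at h1
    rw [show 2 / Real.pi * (Real.pi * δ) = 2 * δ by field_simp] at h2
    nlinarith [mul_le_mul h1 h2 (by positivity) (le_trans (by positivity) h1), mul_pos hℓ hδ]
  set Δ := Real.cos θ₀ - Real.cos θ₁ with hΔdef
  have hΔ0 : 0 < Δ := lt_of_lt_of_le (by positivity) hΔ
  set v : ℝ → ℝ := fun x => (k (x - (a + ℓ / 2)) - Real.cos θ₁) / Δ with hv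
  have hvs : ContDiff ℝ ∞ v :=
    ((hks.comp (contDiff_id.sub contDiff_const)).sub contDiff_const).div_const _
  have hδ1 : δ ≤ 1 / 2 := by linarith
  have hB2 : 2 ≤ (2 + C₁ + C₂) / δ ^ 2 := by
    rw [le_div_iff₀ (by positivity)]; nlinarith
  refine ⟨fun x => Real.smoothTransition (v x), Real.smoothTransition.contDiff.comp hvs, ?_,
    fun x => Real.smoothTransition.nonneg _, fun x => Real.smoothTransition.le_one _, ?_, ?_, ?_⟩
  · intro x
    simp only [hv, hk]
    rw [show 2 * Real.pi * (x + 1 - (a + ℓ / 2)) = 2 * Real.pi * (x - (a + ℓ / 2)) + 2 * Real.pi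
      by ring, Real.cos_add_two_pi]
  · intro x hx
    refine Real.smoothTransition.one_of_one_le ?_
    rw [hv, le_div_iff₀ hΔ0, one_mul, hΔdef]
    have : Real.cos θ₀ ≤ k (x - (a + ℓ / 2)) := by
      simp only [hk]
      rw [← Real.cos_abs (2 * Real.pi * _), abs_mul, abs_of_pos (by positivity : 0 < 2 * Real.pi)]
      have : |x - (a + ℓ / 2)| ≤ ℓ / 2 := by rw [abs_le]; constructor <;> linarith [hx.1, hx.2]
      refine Real.cos_le_cos_of_nonneg_of_le_pi (by positivity) (by rw [hθ₀]; nlinarith) ?_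
      rw [hθ₀]
      nlinarith
    linarith
  · intro x hx
    refine Real.smoothTransition.zero_of_nonpos ?_
    refine div_nonpos_of_nonpos_of_nonneg ?_ hΔ0.le
    have : k (x - (a + ℓ / 2)) ≤ Real.cos θ₁ := by
      simp only [hk]
      rcases le_total (x - (a + ℓ / 2)) (1 / 2) with h | h
      · exact Real.cos_le_cos_of_nonneg_of_le_pi (by positivity) (by nlinarith)
          (by rw [hθ₁]; nlinarith [hx.1])
      · rw [← Real.cos_two_pi_sub]
        exact Real.cos_le_cos_of_nonneg_of_le_pi (by positivity) (by nlinarith)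
          (by rw [hθ₁]; nlinarith [hx.2])
    linarith
  · intro x
    refine comp_bound Real.smoothTransition.contDiff hvs hB2 (fun i hi => (hC₂ i hi _).trans ?_)
      fun i hi1 hi => ?_
    · rw [le_div_iff₀ (by positivity)]
      have : C₂ * δ ^ 2 ≤ C₂ * 1 := by gcongr; nlinarith
      linarith
    · have e : iteratedDeriv i v x = iteratedDeriv i k (x - (a + ℓ / 2)) / Δ := by
        have e1 : v = fun x => (1 / Δ) * (fun x => k (x - (a + ℓ / 2)) - Real.cos θ₁) x :=
          funext fun z => by simp only [hv]; ring
        rw [e1, iteratedDeriv_const_mul_field]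
        have e2 := iteratedDeriv_comp_sub_const i k (a + ℓ / 2)
        have e3 : iteratedDeriv i (fun x => k (x - (a + ℓ / 2)) - Real.cos θ₁) x =
            iteratedDeriv i (fun x => k (x - (a + ℓ / 2))) x := by
          obtain ⟨i, rfl⟩ : ∃ j, i = j + 1 := ⟨i - 1, by omega⟩
          rw [iteratedDeriv_succ', iteratedDeriv_succ']
          congr 1
          funext z
          rw [deriv_sub_const]
        rw [e3, e2]
        ring
      rw [e, abs_div, abs_of_pos hΔ0, div_le_div_iff₀ hΔ0 (by positivity)]
      have h1 := hC₁ i hi (x - (a + ℓ / 2))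
      have : |iteratedDeriv i k (x - (a + ℓ / 2))| * δ ^ 2 ≤ C₁ * δ ^ 2 := by gcongr
      nlinarith [mul_nonneg hC₁0 (sq_nonneg δ), mul_nonneg hC₂0 hΔ0.le]

namespace PerOrbit

variable {g : ℝ → ℝ} {p : ℤ} {q : ℕ} {y : ℤ → ℝ} {K : ℝ}

lemma gap_pos (h : PerOrbit g p q y) (k : ℤ) : 0 < y (k + 1) - y k :=
  sub_pos.2 (h.mono (by omega))

lemma gap_le_one (h : PerOrbit g p q y) (k : ℤ) : y (k + 1) - y k ≤ 1 := by
  have h1 := h.add_q k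
  have h2 : y (k + 1) ≤ y (k + q) := h.mono.monotone (by have := h.q_pos; omega)
  linarith

lemma deriv_iterate_gap (h : PerOrbit g p q y) (hK : DistBound g K) {i : ℕ} (hi : i ≤ q) {j : ℤ}
    {x : ℝ} (hx : x ∈ Set.Icc (y j) (y (j + 1))) :
    deriv g^[i] x ≤ Real.exp K * ((y (j + i * p + 1) - y (j + i * p)) / (y (j + 1) - y j)) ∧
      (y (j + i * p + 1) - y (j + i * p)) / (y (j + 1) - y j) ≤ Real.exp K * deriv g^[i] x := by
  have hl := h.lift.iterate i
  obtain ⟨z, hz, e⟩ := exists_deriv_eq_slope g^[i] (sub_pos.1 (h.gap_pos j))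
    hl.smooth.continuous.continuousOn (smooth_differentiable hl.smooth).differentiableOn
  rw [h.iterate_map, h.iterate_map, show j + 1 + i * p = j + i * p + 1 by ring] at e
  rw [← e]
  have := h.dist_le hK (h.sep_one.mono hi) h.q_pos (t := 1) (l := j + 1) (by simp) hx
    ⟨hz.1.le, hz.2.le⟩
  rw [Nat.cast_one, mul_one, abs_le] at this
  have key : ∀ a b : ℝ, 0 < a → 0 < b → Real.log a - Real.log b ≤ K → a ≤ Real.exp K * b :=
    fun a b ha hb hab => by
      rw [← Real.log_le_log_iff ha (mul_pos (Real.exp_pos _) hb),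
        Real.log_mul (Real.exp_pos _).ne' hb.ne', Real.log_exp]
      linarith
  exact ⟨key _ _ (hl.deriv_pos _) (hl.deriv_pos _) this.2,
    key _ _ (hl.deriv_pos _) (hl.deriv_pos _) (by linarith)⟩

/-- Every point visits a given gap, with controlled derivative. -/
lemma exists_visit (h : PerOrbit g p q y) (hK : DistBound g K) (k : ℤ) (x : ℝ) :
    ∃ i < q, ∃ m : ℤ, g^[i + 1] x - m ∈ Set.Icc (y k) (y (k + 1)) ∧
      y (k + 1) - y k ≤ Real.exp K * deriv g^[i + 1] x := by
  obtain ⟨j, hj, hj'⟩ := h.exists_index x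
  have hq0 : (0 : ℤ) < q := by exact_mod_cast h.q_pos
  obtain ⟨a, b, hab⟩ := h.coprime
  set i := ((a * (k - j) - 1) % q).toNat with hi
  have hi' : (i : ℤ) = (a * (k - j) - 1) % q := Int.toNat_of_nonneg (Int.emod_nonneg _ hq0.ne')
  have hiq : i < q := by have := Int.emod_lt_of_pos (a * (k - j) - 1) hq0; omega
  set m' := (a * (k - j) - 1) / q with hm'
  have hdiv : (i : ℤ) + q * m' = a * (k - j) - 1 := by rw [hi', hm', Int.emod_add_mul_ediv]
  have hk : j + (i + 1 : ℕ) * p = k + (-(b * (k - j)) - m' * p) * q := by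
    push_cast
    linear_combination p * hdiv + (k - j) * hab
  refine ⟨i, hiq, -(b * (k - j)) - m' * p, ?_, ?_⟩
  · have := h.iterate_mem (i + 1) (k := j) (l := j + 1) ⟨hj, hj'.le⟩
    rw [show j + 1 + (i + 1 : ℕ) * p = j + (i + 1 : ℕ) * p + 1 by ring, hk,
      show ∀ e, k + e + 1 = k + 1 + e by intro e; ring, h.add_mul_q, h.add_mul_q] at this
    exact ⟨by linarith [this.1], by linarith [this.2]⟩
  · have := (h.deriv_iterate_gap hK (i := i + 1) (by omega) ⟨hj, hj'.le⟩).2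
    refine le_trans ?_ this
    rw [le_div_iff₀ (h.gap_pos j)]
    have e : y (j + (i + 1 : ℕ) * p + 1) - y (j + (i + 1 : ℕ) * p) = y (k + 1) - y k :=
      h.gap_congr ⟨-(b * (k - j)) - m' * p, by rw [hk]; ring⟩ 1
    rw [e]
    exact mul_le_of_le_one_right (h.gap_pos k).le (h.gap_le_one j)

end PerOrbit

/-- The primitive of a function vanishing at the origin. -/
noncomputable def prim (w : ℝ → ℝ) (x : ℝ) : ℝ := ∫ t in (0 : ℝ)..x, w t

/-- The sum of the primitive of `w` along an orbit segment. -/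
noncomputable def orbSum (g w : ℝ → ℝ) (q : ℕ) (x : ℝ) : ℝ :=
  ∑ i ∈ Finset.range q, prim w (g^[i + 1] x)

section

variable {w g : ℝ → ℝ}

lemma hasDerivAt_prim (hw : ContDiff ℝ ∞ w) (x : ℝ) : HasDerivAt (prim w) (w x) x :=
  intervalIntegral.integral_hasDerivAt_right (hw.continuous.intervalIntegrable _ _)
    (hw.continuous.stronglyMeasurableAtFilter _ _) hw.continuous.continuousAt

lemma deriv_prim (hw : ContDiff ℝ ∞ w) : deriv (prim w) = w :=
  funext fun x => (hasDerivAt_prim hw x).deriv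

lemma smooth_prim (hw : ContDiff ℝ ∞ w) : ContDiff ℝ ∞ (prim w) := by
  rw [contDiff_infty_iff_deriv, deriv_prim hw]
  exact ⟨fun x => (hasDerivAt_prim hw x).differentiableAt, hw⟩

lemma prim_sub (hw : ContDiff ℝ ∞ w) (a b : ℝ) : prim w b - prim w a = ∫ t in a..b, w t :=
  intervalIntegral.integral_interval_sub_left (hw.continuous.intervalIntegrable _ _)
    (hw.continuous.intervalIntegrable _ _)

lemma prim_add_one (hw : ContDiff ℝ ∞ w) (hp : ∀ x, w (x + 1) = w x) (x : ℝ) :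
    prim w (x + 1) = prim w x + prim w 1 := by
  have h1 := prim_sub hw x (x + 1)
  have h2 : Function.Periodic w 1 := hp
  have h3 := h2.intervalIntegral_add_eq x 0
  rw [zero_add] at h3
  rw [h3] at h1
  rw [← sub_eq_iff_eq_add', h1, prim]

lemma prim_add_int (hw : ContDiff ℝ ∞ w) (hp : ∀ x, w (x + 1) = w x) (x : ℝ) (m : ℤ) :
    prim w (x + m) = prim w x + m * prim w 1 := by
  induction m using Int.induction_on with
  | zero => simp
  | succ m ih =>
    push_cast at ih ⊢
    rw [← add_assoc, prim_add_one hw hp, ih]; ring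
  | pred m ih =>
    have := prim_add_one hw hp (x + ((-m - 1 : ℤ) : ℝ))
    push_cast at ih this ⊢
    rw [show x + (-(m : ℝ) - 1) + 1 = x + -m by ring, ih] at this
    linarith

lemma prim_eq_of_zero (hw : ContDiff ℝ ∞ w) {lo hi a b : ℝ} (h0 : ∀ x ∈ Set.Icc lo hi, w x = 0)
    (ha : a ∈ Set.Icc lo hi) (hb : b ∈ Set.Icc lo hi) : prim w a = prim w b := by
  have := abs_sub_le_of_deriv_le (smooth_differentiable (smooth_prim hw)) (a := a) (b := b)
    (C := 0) fun z hz => by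
      rw [deriv_prim hw, h0 z (Set.uIcc_subset_Icc ha hb hz), abs_zero]
  rw [zero_mul] at this
  linarith [abs_nonpos_iff.1 this]

lemma smooth_orbSum (hg : IsLift g) (hw : ContDiff ℝ ∞ w) (q : ℕ) :
    ContDiff ℝ ∞ (orbSum g w q) :=
  ContDiff.sum fun i _ => (smooth_prim hw).comp (hg.iterate (i + 1)).smooth

lemma deriv_orbSum (hg : IsLift g) (hw : ContDiff ℝ ∞ w) (q : ℕ) : deriv (orbSum g w q) =
    fun x => ∑ i ∈ Finset.range q, w (g^[i + 1] x) * deriv g^[i + 1] x := funext fun x =>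
  (HasDerivAt.fun_sum fun i _ => (hasDerivAt_prim hw _).comp x
    (smooth_differentiable (hg.iterate (i + 1)).smooth x).hasDerivAt).deriv

lemma orbSum_add_one (hg : IsLift g) (hw : ContDiff ℝ ∞ w) (hp : ∀ x, w (x + 1) = w x) (q : ℕ)
    (x : ℝ) : orbSum g w q (x + 1) = orbSum g w q x + q * prim w 1 := by
  simp only [orbSum, (hg.iterate _).add_one, prim_add_one hw hp, Finset.sum_add_distrib]
  simp

lemma orbSum_map (q : ℕ) (x : ℝ) :
    orbSum g w q (g x) = orbSum g w q x + (prim w (g^[q] (g x)) - prim w (g x)) := by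
  have h1 := Finset.sum_range_succ' (fun i => prim w (g^[i + 1] x)) q
  have h2 := Finset.sum_range_succ (fun i => prim w (g^[i + 1] x)) q
  simp only [orbSum, ← Function.iterate_succ_apply] at h1 h2 ⊢
  simp only [zero_add, Function.iterate_one, Nat.succ_eq_add_one] at h1 h2 ⊢
  linarith

/-- Derivative bounds for orbit sums from bounds along the orbit. -/
lemma derivBound_deriv_orbSum (hg : IsLift g) (hw : ContDiff ℝ ∞ w) {q n : ℕ} {x s D E : ℝ}
    {I : ℕ → ℝ} (hs : 0 ≤ s) (hE : 1 ≤ E) (hD : ∀ z, ∀ i ≤ n, |iteratedDeriv i w z| ≤ D)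
    (hI : ∀ i < q, DerivBound (deriv g^[i + 1]) x n s (I i)) (hIs : ∀ i < q, I i ≤ E * s) :
    DerivBound (deriv (orbSum g w q)) x n s
      (2 ^ n * (n.factorial * D * E ^ n) * ∑ i ∈ Finset.range q, I i) := by
  rw [deriv_orbSum hg hw, Finset.mul_sum]
  refine DerivBound.sum _ (fun i _ => (hw.comp (hg.iterate (i + 1)).smooth).mul
    (hg.smooth_deriv_iterate (i + 1))) fun i hi => ?_
  rw [Finset.mem_range] at hi
  have h1 := DerivBound.comp (n := n) (x := x) hw (hg.iterate (i + 1)).smooth hs hE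
    (fun m hm => hD _ m hm) fun m hm1 hm => by
      obtain ⟨m, rfl⟩ : ∃ m', m = m' + 1 := ⟨m - 1, by omega⟩
      rw [iteratedDeriv_succ']
      refine (hI i hi m (by omega)).trans ?_
      rw [pow_succ', ← mul_assoc]
      gcongr
      exact hIs i hi
  refine (h1.mul (hw.comp (hg.iterate (i + 1)).smooth) (hg.smooth_deriv_iterate (i + 1)) hs
    (hI i hi)).mono hs (le_of_eq ?_) le_rfl
  ring

end

lemma IsLift.tendsto_atTop {g : ℝ → ℝ} (hg : IsLift g) : Tendsto g atTop atTop := by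
  refine tendsto_atTop_mono (f := fun x => x + (g 0 - 1)) (fun x => ?_)
    (tendsto_atTop_add_const_right _ _ tendsto_id)
  have h1 : g ⌊x⌋ ≤ g x := hg.strictMono.monotone (Int.floor_le x)
  have h2 := hg.add_int 0 ⌊x⌋
  rw [zero_add] at h2
  linarith [Int.lt_floor_add_one x]

lemma IsLift.tendsto_atBot {g : ℝ → ℝ} (hg : IsLift g) : Tendsto g atBot atBot := by
  refine tendsto_atBot_mono (f := fun x => x + (g 0 + 1)) (fun x => ?_)
    (tendsto_atBot_add_const_right _ _ tendsto_id)
  have h1 : g x ≤ g ⌈x⌉ := hg.strictMono.monotone (Int.le_ceil x)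
  have h2 := hg.add_int 0 ⌈x⌉
  rw [zero_add] at h2
  linarith [Int.ceil_lt_add_one x]

lemma IsLift.exists_inverse {g : ℝ → ℝ} (hg : IsLift g) :
    ∃ G, IsLift G ∧ (∀ x, G (g x) = x) ∧ ∀ x, g (G x) = x := by
  have hs : Function.Surjective g :=
    hg.smooth.continuous.surjective hg.tendsto_atTop hg.tendsto_atBot
  set e : ℝ ≃ₜ ℝ := (hg.strictMono.orderIsoOfSurjective g hs).toHomeomorph with he
  have hge : ∀ x, e x = g x := fun _ => rfl
  have hl : ∀ x, e.symm (g x) = x := fun x => e.symm_apply_apply x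
  have hr : ∀ x, g (e.symm x) = x := fun x => e.apply_symm_apply x
  have hsm : ContDiff ℝ ∞ e.symm := Homeomorph.contDiff_symm_deriv (f := e) (f' := deriv g)
    (fun x => (hg.deriv_pos x).ne')
    (fun x => (smooth_differentiable hg.smooth x).hasDerivAt) hg.smooth
  refine ⟨e.symm, ⟨hsm, fun x => ?_, fun x => ?_⟩, hl, hr⟩
  · have h1 := (smooth_differentiable hg.smooth (e.symm x)).hasDerivAt.comp x
      (smooth_differentiable hsm x).hasDerivAt
    have h2 : g ∘ e.symm = _root_.id := funext hr
    rw [h2] at h1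
    have h3 := h1.unique (hasDerivAt_id x)
    exact pos_of_mul_pos_right (by rw [h3]; exact one_pos) (hg.deriv_pos _).le
  · apply hg.strictMono.injective
    rw [hr, hg.add_one, hr]

/-- Crude bounds for the derivatives of iterates. -/
lemma derivBound_iterate_crude (n : ℕ) : ∃ c : ℕ, ∀ (g : ℝ → ℝ) (q : ℕ) (B : ℝ), IsLift g →
    2 ≤ B → (∀ i ≤ n, ∀ x, |iteratedDeriv i (nu g) x| ≤ B) → (q : ℝ) ≤ B →
    (∀ i ≤ q, ∀ x, deriv g^[i] x ≤ B) →
    ∀ i ≤ q, ∀ x, DerivBound (deriv g^[i]) x n 1 (B ^ c) := by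
  induction n with
  | zero =>
    refine ⟨1, fun g q B hg hB _ _ hD i hi x m hm => ?_⟩
    obtain rfl : m = 0 := by omega
    simpa [abs_of_pos ((hg.iterate i).deriv_pos x)] using hD i hi x
  | succ n ih =>
    obtain ⟨c, ih⟩ := ih
    set N := (c + 1) * (n * n + 1 + n) with hN
    refine ⟨n + (c + (1 + (n + (N + c)))) + 1, fun g q B hg hB hν hq hD i hi x => ?_⟩
    have hc := ih g q B hg hB (fun i hi => hν i (by omega)) hq hD
    have hB1 : (1 : ℝ) ≤ B := by linarith
    have hBpow : ∀ {a b : ℕ}, a ≤ b → B ^ a ≤ B ^ b := fun h => pow_le_pow_right₀ hB1 h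
    have hterm : ∀ j ≤ q, DerivBound (fun z => nu g (g^[j] z) * deriv g^[j] z) x n 1
        (B ^ (n + (N + c))) := fun j hj => by
      have h1 := comp_bound (n := n) (x := x) (B := B ^ (c + 1)) hg.smooth_nu (hg.iterate j).smooth
        (hB.trans (by simpa using hBpow (a := 1) (b := c + 1) (by omega)))
        (fun m hm => (hν m (by omega) _).trans
          (by simpa using hBpow (a := 1) (b := c + 1) (by omega)))
        fun m hm1 hm => by
          obtain ⟨m, rfl⟩ : ∃ m', m = m' + 1 := ⟨m - 1, by omega⟩
          rw [iteratedDeriv_succ']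
          have := hc j hj x m (by omega)
          rw [one_pow, mul_one] at this
          exact this.trans (hBpow (by omega))
      refine (h1.mul (hg.smooth_nu.comp (hg.iterate j).smooth) (hg.smooth_deriv_iterate j)
        zero_le_one (hc j hj x)).mono zero_le_one ?_ le_rfl
      rw [← pow_mul, ← pow_add, pow_add B n]
      gcongr
    have hnon : DerivBound (nonlin g i) x n 1 (B ^ (1 + (n + (N + c)))) := by
      refine (DerivBound.sum (Finset.range i) (fun j _ =>
        (hg.smooth_nu.comp (hg.iterate j).smooth).mul (hg.smooth_deriv_iterate j)) fun j hj =>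
          hterm j ((Finset.mem_range.1 hj).le.trans hi)).mono zero_le_one ?_ le_rfl
      rw [Finset.sum_const, Finset.card_range, nsmul_eq_mul, pow_add B 1, pow_one]
      have : (i : ℝ) ≤ B := le_trans (by exact_mod_cast hi) hq
      gcongr
    refine DerivBound.of_succ ?_ ?_
    · rw [abs_of_pos ((hg.iterate i).deriv_pos x)]
      refine (hD i hi x).trans ?_
      simpa using hBpow (a := 1) (by omega : 1 ≤ n + (c + (1 + (n + (N + c)))) + 1)
    · rw [show deriv (deriv g^[i]) = fun z => deriv g^[i] z * nonlin g i z from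
        funext fun z => (hg.hasDerivAt_deriv_iterate i z).deriv]
      refine ((hc i hi x).mul (hg.smooth_deriv_iterate i) (hg.smooth_nonlin i) zero_le_one
        hnon).mono zero_le_one ?_ le_rfl
      rw [mul_one, ← pow_add]
      calc (2 : ℝ) ^ n * B ^ (c + (1 + (n + (N + c))))
          ≤ B ^ n * B ^ (c + (1 + (n + (N + c)))) := by gcongr
        _ = B ^ (n + (c + (1 + (n + (N + c))))) := (pow_add _ _ _).symm
        _ ≤ _ := hBpow (by omega)

/-- Data for the conjugacy to a rotation: a weight concentrated near the `k`-th gap. -/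
structure Surgery (g : ℝ → ℝ) (p : ℤ) (q : ℕ) (y : ℤ → ℝ) (k : ℤ) (w : ℝ → ℝ) : Prop where
  orb : PerOrbit g p q y
  smooth : ContDiff ℝ ∞ w
  periodic : ∀ x, w (x + 1) = w x
  nonneg : ∀ x, 0 ≤ w x
  le_one : ∀ x, w x ≤ 1
  eq_one : ∀ x ∈ Set.Icc (y k) (y (k + 1)), w x = 1
  eq_zero : ∀ x ∈ Set.Icc (y (k + 2)) (y (k - 1) + 1), w x = 0

/-- The defect of the orbit sum under the dynamics. -/
noncomputable def defect (g w : ℝ → ℝ) (p : ℤ) (q : ℕ) (z : ℝ) : ℝ :=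
  prim w (g^[q] z - p) - prim w z

namespace Surgery

variable {g w : ℝ → ℝ} {p : ℤ} {q : ℕ} {y : ℤ → ℝ} {k : ℤ} {K : ℝ}

lemma deriv_ge (h : Surgery g p q y k w) (hK : DistBound g K) (x : ℝ) :
    y (k + 1) - y k ≤ Real.exp K * deriv (orbSum g w q) x := by
  obtain ⟨i, hi, m, hm, hle⟩ := h.orb.exists_visit hK k x
  rw [deriv_orbSum h.orb.lift h.smooth]
  refine hle.trans (mul_le_mul_of_nonneg_left ?_ (Real.exp_pos _).le)
  have hper : Function.Periodic w 1 := h.periodic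
  have h1 : w (g^[i + 1] x) = 1 := by
    have := hper.sub_int_mul_eq m (x := g^[i + 1] x)
    rw [mul_one] at this
    rw [← this, h.eq_one _ hm]
  calc deriv g^[i + 1] x = w (g^[i + 1] x) * deriv g^[i + 1] x := by rw [h1, one_mul]
    _ ≤ _ := Finset.single_le_sum (f := fun i => w (g^[i + 1] x) * deriv g^[i + 1] x)
      (fun j _ => mul_nonneg (h.nonneg _) ((h.orb.lift.iterate _).deriv_pos x).le)
      (Finset.mem_range.2 hi)

lemma deriv_pos (h : Surgery g p q y k w) (hK : DistBound g K) (x : ℝ) :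
    0 < deriv (orbSum g w q) x :=
  pos_of_mul_pos_right ((h.orb.gap_pos k).trans_le (h.deriv_ge hK x)) (Real.exp_pos _).le

lemma prim_one_pos (h : Surgery g p q y k w) (hK : DistBound g K) : 0 < prim w 1 := by
  have h1 : StrictMono (orbSum g w q) := strictMono_of_deriv_pos (h.deriv_pos hK)
  have h2 := h1 (show (0 : ℝ) < 0 + 1 by norm_num)
  rw [orbSum_add_one h.orb.lift h.smooth h.periodic] at h2
  have : (0 : ℝ) ≤ q := Nat.cast_nonneg q
  exact pos_of_mul_pos_right (by linarith) this

lemma prim_one_le (h : Surgery g p q y k w) : prim w 1 ≤ 1 := by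
  have := abs_sub_le_of_deriv_le (smooth_differentiable (smooth_prim h.smooth)) (a := 1) (b := 0)
    (C := 1) fun z _ => by
      rw [deriv_prim h.smooth, abs_of_nonneg (h.nonneg z)]
      exact h.le_one z
  rw [show prim w 0 = 0 by simp [prim]] at this
  simpa using (le_abs_self _).trans this

lemma isLift (h : Surgery g p q y k w) (hK : DistBound g K) :
    IsLift fun x => orbSum g w q x / (q * prim w 1) := by
  have hc := h.prim_one_pos hK
  have hq : (0 : ℝ) < q := Nat.cast_pos.2 h.orb.q_pos
  refine ⟨(smooth_orbSum h.orb.lift h.smooth q).div_const _, fun x => ?_, fun x => ?_⟩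
  · rw [deriv_div_const]
    exact div_pos (h.deriv_pos hK x) (mul_pos hq hc)
  · rw [orbSum_add_one h.orb.lift h.smooth h.periodic]
    field_simp

lemma smooth_defect (h : Surgery g p q y k w) : ContDiff ℝ ∞ (defect g w p q) :=
  ((smooth_prim h.smooth).comp ((h.orb.lift.iterate q).smooth.sub contDiff_const)).sub
    (smooth_prim h.smooth)

lemma orbSum_image (h : Surgery g p q y k w) (x : ℝ) :
    orbSum g w q (g x) = orbSum g w q x + p * prim w 1 + defect g w p q (g x) := by
  have := prim_add_int h.smooth h.periodic (g^[q] (g x) - p) p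
  rw [sub_add_cancel] at this
  rw [orbSum_map, this, defect]
  ring

lemma defect_node (h : Surgery g p q y k w) (j : ℤ) : defect g w p q (y j) = 0 := by
  rw [defect, h.orb.iterate_map, mul_comm, h.orb.add_mul_q, add_sub_cancel_right, sub_self]

lemma defect_eq_zero (h : Surgery g p q y k w) {z : ℝ}
    (hz : z ∈ Set.Icc (y (k + 2)) (y (k - 1) + 1)) : defect g w p q z = 0 := by
  rw [defect, sub_eq_zero]
  refine prim_eq_of_zero h.smooth h.eq_zero ?_ hz
  rw [← h.orb.add_q] at hz ⊢
  have := h.orb.iterate_mem q hz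
  rw [mul_comm, h.orb.add_mul_q, h.orb.add_mul_q] at this
  exact ⟨by linarith [this.1], by linarith [this.2]⟩

end Surgery

namespace Surgery

variable {g w : ℝ → ℝ} {p : ℤ} {q : ℕ} {y : ℤ → ℝ} {k : ℤ} {K : ℝ}

lemma strictMono_orbSum (h : Surgery g p q y k w) (hK : DistBound g K) :
    StrictMono (orbSum g w q) := strictMono_of_deriv_pos (h.deriv_pos hK)

lemma map_node (h : Surgery g p q y k w) (hK : DistBound g K) {f : ℝ → ℝ}
    (hf : ∀ x, orbSum g w q (f x) = orbSum g w q x + p * prim w 1) (j : ℤ) :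
    f (y j) = g (y j) := by
  apply (h.strictMono_orbSum hK).injective
  rw [hf, h.orbSum_image, h.orb.map, h.defect_node, add_zero]

end Surgery

/-- The map conjugate to a rational rotation is close to the original map when the return map
is close to the identity on three consecutive gaps. -/
lemma exists_surgery_bound (n : ℕ) : ∃ c : ℕ, ∀ (g w : ℝ → ℝ) (p : ℤ) (q : ℕ) (y : ℤ → ℝ) (k : ℤ)
    (K : ℝ) (f : ℝ → ℝ) (B τ : ℝ), Surgery g p q y k w → DistBound g K → IsLift f →
    (∀ x, orbSum g w q (f x) = orbSum g w q x + p * prim w 1) → 2 ≤ B → 0 ≤ τ → B ^ c * τ ≤ 1 →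
    (∀ i ≤ n, ∀ x, |iteratedDeriv i w x| ≤ B) → (∀ x, 1 / B ≤ deriv (orbSum g w q) x) →
    (∀ i, 1 ≤ i → i ≤ n + 1 → ∀ z ∈ Set.Icc (y (k - 1)) (y (k + 2)),
      |iteratedDeriv i (orbSum g w q) z| ≤ B) →
    (∀ i, 1 ≤ i → i ≤ n → ∀ x, |iteratedDeriv i g x| ≤ B) →
    (∀ z ∈ Set.Icc (y (k - 1)) (y (k + 2)), DerivBound (fun z => g^[q] z - p - z) z n 1 τ) →
    ∀ x, DerivBound (fun z => f z - g z) x n 1 (B ^ c * τ) := by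
  obtain ⟨c₁, hc₁⟩ := comp_sub_comp_bound n
  obtain ⟨c₂, hc₂⟩ := implicit_sub_bound n
  refine ⟨c₂ + (n * n + c₁ + n), fun g w p q y k K f B τ h hK hf hfΩ hB hτ hτ1 hw hΩ1 hΩ hg
    hψ => ?_⟩
  have hB1 : (1 : ℝ) ≤ B := by linarith
  have hle : ∀ {a : ℕ}, a ≤ c₂ + (n * n + c₁ + n) → B ^ a * τ ≤ 1 := fun ha =>
    (mul_le_mul_of_nonneg_right (pow_le_pow_right₀ hB1 ha) hτ).trans hτ1
  have hτ1' : τ ≤ 1 := by simpa using hle (a := 0) (by omega)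
  have hgl := h.orb.lift
  have hFs : ContDiff ℝ ∞ fun z => g^[q] z - p := (hgl.iterate q).smooth.sub contDiff_const
  have hids : ContDiff ℝ ∞ fun z : ℝ => z := contDiff_id
  have hid : ∀ i, 1 ≤ i → ∀ z, |iteratedDeriv i (fun z : ℝ => z) z| ≤ 1 := fun i hi z => by
    obtain ⟨i, rfl⟩ : ∃ j, i = j + 1 := ⟨i - 1, by omega⟩
    rw [iteratedDeriv_succ', show deriv (fun z : ℝ => z) = fun _ => 1 from deriv_id',
      iteratedDeriv_const]
    split_ifs <;> simp
  have hdef : ∀ z ∈ Set.Icc (y (k - 1)) (y (k + 2)),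
      DerivBound (defect g w p q) z n 1 (B ^ c₁ * τ) := fun z hz => by
    refine hc₁ (prim w) _ _ z B τ (smooth_prim h.smooth) hFs hids hB ?_ ?_
      (fun i hi _ => (hid i hi z).trans hB1) (hψ z hz)
    · intro i hi hi' v _
      obtain ⟨i, rfl⟩ : ∃ j, i = j + 1 := ⟨i - 1, by omega⟩
      rw [iteratedDeriv_succ', deriv_prim h.smooth]
      exact hw i (by omega) v
    · intro i hi hi'
      have e : (fun z => g^[q] z - p) = fun z => (g^[q] z - p - z) + z := funext fun z => by ring
      have := hψ z hz i hi'
      rw [one_pow, mul_one] at this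
      rw [e, iteratedDeriv_fun_add (smooth_at (hFs.sub hids) i z) (smooth_at hids i z)]
      have h2 := hid i hi z
      linarith [abs_add_le (iteratedDeriv i (fun z => g^[q] z - p - z) z)
        (iteratedDeriv i (fun z : ℝ => z) z)]
  have main : ∀ x, g x ∈ Set.Ico (y (k - 1)) (y (k - 1) + 1) →
      DerivBound (fun z => f z - g z) x n 1 (B ^ (c₂ + (n * n + c₁ + n)) * τ) := by
    intro x hx
    rcases le_or_gt (g x) (y (k + 2)) with hle2 | hgt
    · have hmem : g x ∈ Set.Icc (y (k - 1)) (y (k + 2)) := ⟨hx.1, hle2⟩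
      have hnode : ∀ j, g (y (j - p)) = y j := fun j => by rw [h.orb.map, sub_add_cancel]
      have hfmem : f x ∈ Set.Icc (y (k - 1)) (y (k + 2)) := by
        constructor
        · rw [← hnode (k - 1), ← h.map_node hK hfΩ]
          refine hf.strictMono.monotone (hgl.strictMono.le_iff_le.1 ?_)
          rw [hnode]; exact hmem.1
        · rw [← hnode (k + 2), ← h.map_node hK hfΩ]
          refine hf.strictMono.monotone (hgl.strictMono.le_iff_le.1 ?_)
          rw [hnode]; exact hmem.2
      have hsub : Set.uIcc (f x) (g x) ⊆ Set.Icc (y (k - 1)) (y (k + 2)) :=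
        Set.uIcc_subset_Icc hfmem hmem
      have hε : DerivBound (fun z => -defect g w p q (g z)) x n 1 (B ^ (n * n + c₁ + n) * τ) := by
        have := (DerivBound.comp (n := n) (x := x) (s := 1) (E := B) (C := B ^ c₁ * τ)
          h.smooth_defect hgl.smooth zero_le_one hB1
          (fun i hi => by simpa using hdef _ hmem i hi)
          (fun i hi hi' => by simpa using hg i hi hi' x)).neg
        refine this.mono zero_le_one ?_ le_rfl
        have := factorial_le_pow hB n
        calc (n.factorial : ℝ) * (B ^ c₁ * τ) * B ^ n ≤ B ^ (n * n) * (B ^ c₁ * τ) * B ^ n := by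
              gcongr
          _ = _ := by rw [pow_add, pow_add]; ring
      have := hc₂ (orbSum g w q) f g _ x B _ (smooth_orbSum hgl h.smooth q) hf.smooth hgl.smooth
        (h.smooth_defect.comp hgl.smooth).neg (h.deriv_pos hK) (fun z => by
          rw [hfΩ, h.orbSum_image]; simp) hB (hle (by omega))
        (fun i hi hi' z hz => hΩ i hi hi' z (hsub hz)) (fun z _ => hΩ1 z)
        (fun i hi hi' => hg i hi hi' x) hε
      rwa [← mul_assoc, ← pow_add] at this
    · have hev : (fun z => f z - g z) =ᶠ[𝓝 x] fun _ => 0 := by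
        have hU : IsOpen (g ⁻¹' Set.Ioo (y (k + 2)) (y (k - 1) + 1)) :=
          isOpen_Ioo.preimage hgl.smooth.continuous
        filter_upwards [hU.mem_nhds ⟨hgt, hx.2⟩] with z hz
        rw [sub_eq_zero]
        apply (h.strictMono_orbSum hK).injective
        rw [hfΩ, h.orbSum_image, h.defect_eq_zero ⟨hz.1.le, hz.2.le⟩, add_zero]
      intro i hi
      rw [hev.iteratedDeriv_eq i, iteratedDeriv_const, ite_self, abs_zero]
      positivity
  intro x i hi
  have hper : Function.Periodic (iteratedDeriv i fun z => f z - g z) 1 :=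
    iteratedDeriv_periodic (fun z => by rw [hf.add_one, hgl.add_one]; ring) i
  have e := hper.sub_int_mul_eq ⌊g x - y (k - 1)⌋ (x := x)
  rw [← e, mul_one]
  refine main _ ?_ i hi
  have h2 := hgl.add_int x (-⌊g x - y (k - 1)⌋)
  push_cast at h2
  rw [← sub_eq_add_neg, ← sub_eq_add_neg] at h2
  rw [h2]
  have h3 := Int.floor_le (g x - y (k - 1))
  have h4 := Int.lt_floor_add_one (g x - y (k - 1))
  exact ⟨by linarith, by linarith⟩

section

variable {g w : ℝ → ℝ} {p : ℤ} {q : ℕ} {y : ℤ → ℝ} {k a : ℤ} {K C M d : ℝ} {r B m : ℕ}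

namespace Window

lemma smallSquares {A : ℝ} (hw : Window y r B C M a m k d) (h : PerOrbit g p q y)
    (hM : ∀ k, y (k + 1) - y k ≤ M) (hA : ∀ x, |sch g x| ≤ A) (hB : 0 < B) (hCB : C ≤ B)
    (hAB : A * C * (2 * Real.exp 6) ≤ B) : SmallSquares g q (y a) (y (a + m)) A ∧
    ∑ i ∈ Finset.range q, (g^[i] (y (a + m)) - g^[i] (y a)) ^ 2 ≤ 1 := by
  have hB' : (0 : ℝ) < B := by exact_mod_cast hB
  have hA0 : 0 ≤ A := (abs_nonneg _).trans (hA 0)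
  have hsum : ∑ i ∈ Finset.range q, (g^[i] (y (a + m)) - g^[i] (y a)) ^ 2 ≤ C / B := by
    simp only [h.iterate_map]
    exact (h.sum_span_sq hM a m).trans hw.sq_le
  have hCB1 : C / B ≤ 1 := (div_le_one hB').2 hCB
  have hM0 : 0 ≤ M := (sub_nonneg.2 (h.mono.monotone (by omega : (0 : ℤ) ≤ 0 + 1))).trans (hM 0)
  refine ⟨⟨h.lift, fun i _ => ?_, hA, ?_⟩, hsum.trans hCB1⟩
  · rw [h.iterate_map, h.iterate_map, add_right_comm]
    refine (PerOrbit.span_le hM _ _).trans (le_trans ?_ (hw.sq_le.trans hCB1))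
    have : (m : ℝ) ≤ m ^ 2 := by exact_mod_cast Nat.le_self_pow (by norm_num) m
    gcongr
  · refine (mul_le_mul_of_nonneg_left hsum hA0).trans ?_
    have := Real.exp_pos 6
    rw [mul_div_assoc', div_le_div_iff₀ hB' (by positivity)]
    linarith

end Window

/-- Closeness to the identity of the return map, forced by many fixed points. -/
lemma return_bound (h : PerOrbit g p q y) {D : ℝ} (hr : 1 ≤ r) {n : ℕ} (hn : n ≤ 2 * r)
    (hh : y (k + r) - y (k - r) ≤ 1)
    (hD : ∀ x ∈ Set.Icc (y (k - r)) (y (k + r)),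
      |iteratedDeriv (2 * r) (deriv g^[q]) x| ≤ D) :
    ∀ x ∈ Set.Icc (y (k - r)) (y (k + r)), DerivBound (fun z => g^[q] z - p - z) x n 1
      (D * (y (k + r) - y (k - r)) ^ (2 * r + 1 - n)) := by
  have hgs := (h.lift.iterate q).smooth
  have hs : ContDiff ℝ ∞ fun z => g^[q] z - p - z := (hgs.sub contDiff_const).sub contDiff_id
  have hz0 : k - (r : ℤ) + ((0 : ℕ) : ℤ) = k - r := by simp
  have hzn : k - (r : ℤ) + ((2 * r : ℕ) : ℤ) = k + r := by push_cast; ring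
  have h0 := exists_zero_iteratedDeriv (2 * r) _ (fun i => y (k - r + i)) hs
    (fun i _ => h.mono (by push_cast; omega)) (fun i _ => by
      rw [h.iterate_map, mul_comm, h.add_mul_q]; ring)
  simp only [hz0, hzn] at h0
  have hd : ∀ x, iteratedDeriv (2 * r + 1) (fun z => g^[q] z - p - z) x =
      iteratedDeriv (2 * r) (deriv g^[q]) x := fun x => by
    have e : deriv (fun z => g^[q] z - p - z) = fun z => deriv g^[q] z - 1 := funext fun z =>
      (((smooth_differentiable hgs z).hasDerivAt.sub_const _).sub (hasDerivAt_id z)).deriv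
    rw [iteratedDeriv_succ', e, iteratedDeriv_fun_sub (smooth_at (smooth_deriv hgs) _ x)
      contDiffAt_const, iteratedDeriv_const, if_neg (by omega), sub_zero]
  have hl : 0 ≤ y (k + r) - y (k - r) := sub_nonneg.2 (h.mono.monotone (by omega))
  intro x hx i hi
  have hD0 : 0 ≤ D := (abs_nonneg _).trans (hD x hx)
  refine (abs_iteratedDeriv_le_of_zeros hs h0 (fun z hz => (hd z).symm ▸ hD z hz)
    (2 * r + 1 - i) i (by omega) x hx).trans ?_
  rw [one_pow, mul_one]
  exact mul_le_mul_of_nonneg_left (pow_le_pow_of_le_one hl hh (by omega)) hD0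

end

section

variable {g w : ℝ → ℝ} {p : ℤ} {q : ℕ} {y : ℤ → ℝ} {k : ℤ} {K : ℝ}

lemma windowConst_pos (hK : 0 ≤ K) (r : ℕ) : 0 < windowConst K r := by
  have h1 := slowConst_ge hK
  have h2 : 0 < ⌈slowConst K⌉₊ := Nat.ceil_pos.2 (by linarith)
  have := Real.exp_pos (5 * K)
  rw [windowConst]
  positivity

lemma PerOrbit.sum_span_succ (h : PerOrbit g p q y) (a : ℤ) (m : ℕ) :
    ∑ i ∈ Finset.range q, (g^[i + 1] (y (a + m)) - g^[i + 1] (y a)) ≤ m := by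
  have e := Finset.sum_range_succ' (fun i => g^[i] (y (a + m)) - g^[i] (y a)) q
  rw [Finset.sum_range_succ] at e
  have hq : g^[q] (y (a + m)) - g^[q] (y a) = y (a + m) - y a := by
    rw [h.iterate_map, h.iterate_map, mul_comm, h.add_mul_q, h.add_mul_q]; ring
  have := h.sum_span a m
  simp only [← h.iterate_map] at this
  simp only [hq, Function.iterate_zero, id] at e
  linarith

/-- Bump surgery data at a given gap. -/
lemma exists_surgery (n : ℕ) : ∃ (c : ℕ) (C : ℝ), 2 ≤ C ∧ ∀ (g : ℝ → ℝ) (p : ℤ) (q : ℕ)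
    (y : ℤ → ℝ) (k : ℤ) (K : ℝ), PerOrbit g p q y → DistBound g K → 3 ≤ q →
    (∀ k, y (k + 1) - y k ≤ 1 / 6) → ∃ w, Surgery g p q y k w ∧
      ∀ x, DerivBound w x n 1 ((C * Real.exp (5 * K) ^ 2 / (y (k + 1) - y k) ^ 2) ^ c) := by
  obtain ⟨c, C, hC, hbump⟩ := exists_bump n
  refine ⟨c, C, hC, fun g p q y k K h hK hq hgap => ?_⟩
  set E := Real.exp (5 * K) with hE
  have hE1 : 1 ≤ E := Real.one_le_exp (by linarith [hK.nonneg])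
  have hE0 : 0 < E := by linarith
  set ℓ := y (k + 1) - y k with hℓ
  have hℓ0 : 0 < ℓ := h.gap_pos k
  set δ := ℓ / E with hδ
  have hδ0 : 0 < δ := by positivity
  have hδℓ : δ ≤ ℓ := div_le_self hℓ0.le hE1
  have hℓ6 : ℓ ≤ 1 / 6 := hgap k
  obtain ⟨w, hws, hwp, hw0, hw1, hweq, hwz, hwb⟩ := hbump (y k) ℓ δ hℓ0 hδ0 (by linarith)
  have hr : y (k + 1) + δ ≤ y (k + 2) := by
    have := (h.gap_near hK (by omega) (k + 1) 1).2
    push_cast at this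
    rw [pow_one, show k + 1 - 1 = k by ring, show k + 1 + 1 = k + 2 by ring] at this
    have : δ ≤ y (k + 2) - y (k + 1) := by rw [hδ, div_le_iff₀ hE0]; linarith
    linarith
  have hl : y (k - 1) + δ ≤ y k := by
    have := (h.gap_near hK (by omega) (k - 1) 1).1
    push_cast at this
    rw [pow_one, show k - 1 + 1 = k by ring] at this
    have : δ ≤ y k - y (k - 1) := by rw [hδ, div_le_iff₀ hE0]; linarith
    linarith
  refine ⟨w, ⟨h, hws, hwp, hw0, hw1, ?_, ?_⟩, ?_⟩
  · intro x hx
    exact hweq x ⟨hx.1, by linarith [hx.2]⟩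
  · intro x hx
    exact hwz x ⟨by linarith [hx.1], by linarith [hx.2]⟩
  · have e : C * E ^ 2 / ℓ ^ 2 = C / δ ^ 2 := by rw [hδ]; field_simp
    rwa [e]

lemma scalar_bound {B h d C : ℝ} (hB : 0 < B) (hh : 0 < h) (hd : 0 < d) (hC : 0 < C)
    (h1 : h ≤ C * d / B) (h2 : 1 / (C * B ^ 20) ≤ d) (N : ℕ) :
    (B / h) ^ N * (h / d) ^ (22 * N + 1) ≤ C ^ (22 * N + 1) / B := by
  have h3 : h / d ≤ C / B := by
    rw [div_le_div_iff₀ hd hB]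
    rwa [le_div_iff₀ hB] at h1
  have h4 : B / d ≤ C * B ^ 21 := by
    rw [div_le_iff₀ (by positivity)] at h2
    rw [div_le_iff₀ hd]
    calc B = B * 1 := (mul_one B).symm
      _ ≤ B * (d * (C * B ^ 20)) := by gcongr
      _ = _ := by ring
  calc (B / h) ^ N * (h / d) ^ (22 * N + 1)
      = (B / h * (h / d)) ^ N * (h / d) ^ (21 * N + 1) := by
        rw [mul_pow, mul_assoc, ← pow_add]; congr 2; ring
    _ = (B / d) ^ N * (h / d) ^ (21 * N + 1) := by rw [div_mul_div_cancel₀ hh.ne']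
    _ ≤ (C * B ^ 21) ^ N * (C / B) ^ (21 * N + 1) := by gcongr
    _ = C ^ (22 * N + 1) / B := by
        rw [mul_pow, div_pow, ← pow_mul, eq_div_iff hB.ne', mul_div_assoc', div_mul_eq_mul_div,
          div_eq_iff (by positivity)]
        ring

end

set_option maxHeartbeats 1000000 in
/-- Fine estimate: the conjugate of a rational rotation built from the orbit sum is close to the
original map, uniformly in the period. -/
lemma exists_fine (n : ℕ) : ∃ L : ℕ, ∀ K A ε : ℝ, 0 < ε → ∃ (c : ℕ) (C ε' : ℝ), 2 ≤ C ∧ 0 < ε' ∧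
    ∀ (g : ℝ → ℝ) (p : ℤ) (q : ℕ) (y : ℤ → ℝ), PerOrbit g p q y → DistBound g K →
    (∀ i ≤ L, ∀ x, |iteratedDeriv i (sch g) x| ≤ A) →
    (∀ i, 1 ≤ i → i ≤ n → ∀ x, |iteratedDeriv i g x| ≤ A) → 3 ≤ q →
    (∀ k, y (k + 1) - y k ≤ ε') → ∃ w k, Surgery g p q y k w ∧
      (∀ x, DerivBound w x n 1 ((C * Real.exp (5 * K) ^ 2 / (y (k + 1) - y k) ^ 2) ^ c)) ∧
      ∀ f, IsLift f → (∀ x, orbSum g w q (f x) = orbSum g w q x + p * prim w 1) →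
        ∀ x, DerivBound (fun z => f z - g z) x n 1 ε := by
  obtain ⟨cb, Cb, hCb, hsurg⟩ := exists_surgery n
  obtain ⟨cS, hS⟩ := exists_surgery_bound n
  set m₀ := 2 * cb + 20 * n + 24 with hm₀
  set N := m₀ * cS + n + 1 with hN
  set r := 11 * N with hr
  refine ⟨2 * r, fun K A₀ ε hε => ?_⟩
  set A := max A₀ 0 with hA
  have hA0 : 0 ≤ A := le_max_right _ _
  obtain ⟨CK, hCK, hKoebe⟩ := SmallSquares.derivBound_deriv_iterate (2 * r) hA0
  set C := windowConst K r with hC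
  set E := Real.exp (5 * K) with hE
  set Cr := 2 * r * E ^ r with hCr
  set Q₁ := (Cb * E ^ 2 * Cr ^ 2) ^ cb with hQ₁
  set Q₂ := 2 ^ n * (n.factorial * Q₁ * CK ^ n) * (CK * C ^ (n + 2)) with hQ₂
  set Q := Q₁ + Q₂ + Real.exp K * Cr + A + 2 with hQ
  set Q₃ := Q ^ cS * CK * C ^ (22 * N + 1) with hQ₃
  obtain ⟨εw, hεw, hwin⟩ := exists_window K r
    (⌈C⌉₊ + ⌈A * C * (2 * Real.exp 6)⌉₊ + ⌈Q₃⌉₊ + ⌈Q₃ / ε⌉₊ + 1)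
  refine ⟨cb, Cb, min εw (1 / 6), hCb, by positivity, fun g p q y h hK hsch hgA hq hgap => ?_⟩
  obtain ⟨B, M, hNB, hM, a, m, k, d, W⟩ := hwin g p q y h hK (by omega)
    fun k => (hgap k).trans (min_le_left _ _)
  rw [← hC] at W
  obtain ⟨w, hw, hwb⟩ := hsurg g p q y k K h hK hq fun k => (hgap k).trans (min_le_right _ _)
  refine ⟨w, k, hw, hwb, fun f hf hfΩ => ?_⟩
  have hK0 := hK.nonneg
  have hC0 : 0 < C := windowConst_pos hK0 r
  have hE0 : 0 < E := Real.exp_pos _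
  have hr1 : 11 ≤ r := by omega
  have hr0 : (0 : ℝ) < r := by exact_mod_cast (by omega : 0 < r)
  have hCr0 : 0 < Cr := by positivity
  have hQ₁0 : 0 ≤ Q₁ := by positivity
  have hQ₂0 : 0 ≤ Q₂ := by positivity
  have hQ0 : 0 ≤ Real.exp K * Cr := by positivity
  have hB1 : (1 : ℝ) ≤ B := by exact_mod_cast (by omega : 1 ≤ B)
  have hB0 : (0 : ℝ) < B := by linarith
  have ceil : ∀ {x : ℝ}, ⌈x⌉₊ ≤ B → x ≤ B := fun h => (Nat.le_ceil _).trans (by exact_mod_cast h)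
  have hCB : C ≤ B := ceil (by omega)
  obtain ⟨hss, hsum⟩ := W.smallSquares (A := A) h hM (fun x => by
      have := (hsch 0 (Nat.zero_le _) x).trans (le_max_left A₀ 0)
      rwa [iteratedDeriv_zero] at this)
    (by omega) hCB (ceil (by omega))
  set H := y (k + r) - y (k - r) with hH
  have hH0 : 0 < H := sub_pos.2 (h.mono (by omega))
  set s := fun j : ℕ => g^[j] (y (a + m)) - g^[j] (y a) with hs
  have hs1 : ∀ j ≤ q, s j ≤ 1 := hss.le_one
  have hs0 : s 0 ≤ 1 := hs1 0 (Nat.zero_le _)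
  have hs0' : s 0 = y (a + m) - y a := rfl
  have hd0 : 0 < d := lt_of_lt_of_le (by positivity) W.le_d
  have hHd : H + 2 * d ≤ 1 := by linarith [W.left, W.right]
  set X := (B : ℝ) / H with hX
  have hBX : (B : ℝ) ≤ X := by rw [hX, le_div_iff₀ hH0]; nlinarith
  have hX1 : 1 ≤ X := by linarith
  have hHX : 1 / H ≤ X := div_le_div_of_nonneg_right hB1 hH0.le
  set ℓ := y (k + 1) - y k with hℓ
  have hℓ0 : 0 < ℓ := h.gap_pos k
  have hHℓ : H ≤ Cr * ℓ := h.span_near hK (by omega) k r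
  have hℓX : 1 / ℓ ≤ Cr * X := by
    calc 1 / ℓ ≤ Cr * (1 / H) := by
          rw [mul_one_div, div_le_div_iff₀ hℓ0 hH0]; linarith
      _ ≤ Cr * X := by gcongr
  have hdX : 1 / d ≤ C * X ^ 20 := by
    have := W.le_d
    rw [div_le_iff₀ (by positivity)] at this
    rw [div_le_iff₀ hd0]
    calc 1 ≤ d * (C * B ^ 20) := this
      _ ≤ d * (C * X ^ 20) := by gcongr
      _ = _ := mul_comm _ _
  have hd1 : 1 ≤ 1 / d := by rw [le_div_iff₀ hd0]; linarith
  have hD : ∀ z, ∀ i ≤ n, |iteratedDeriv i w z| ≤ Q₁ * X ^ (2 * cb) := fun z i hi => by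
    have := hwb z i hi
    rw [one_pow, mul_one] at this
    refine this.trans ?_
    calc (Cb * E ^ 2 / ℓ ^ 2) ^ cb = (Cb * E ^ 2 * (1 / ℓ) ^ 2) ^ cb := by
          rw [one_div, inv_pow, ← div_eq_mul_inv]
      _ ≤ (Cb * E ^ 2 * (Cr * X) ^ 2) ^ cb := by gcongr
      _ = Q₁ * X ^ (2 * cb) := by rw [hQ₁, mul_pow Cr, ← mul_assoc, mul_pow _ (X ^ 2), ← pow_mul]
  have hmem : ∀ z ∈ Set.Icc (y (k - r)) (y (k + r)), y a ≤ z - d ∧ z + d ≤ y (a + m) :=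
    fun z hz => ⟨by linarith [W.left, hz.1], by linarith [W.right, hz.2]⟩
  have hKo : ∀ j ≤ q, ∀ z ∈ Set.Icc (y (k - r)) (y (k + r)),
      DerivBound (deriv g^[j]) z (2 * r) (1 / d) (CK * (s j / d)) := fun j hj z hz =>
    hKoebe g q _ _ A hss (fun i hi x => (hsch i hi x).trans (le_max_left A₀ 0)) hsum j hj z d hd0
      (hmem z hz).1 (hmem z hz).2
  have hsub : Set.Icc (y (k - 1)) (y (k + 2)) ⊆ Set.Icc (y (k - r)) (y (k + r)) :=
    Set.Icc_subset_Icc (h.mono.monotone (by omega)) (h.mono.monotone (by omega))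
  have hX0 : 0 < X := by linarith
  have hCK0 : 0 < CK := by linarith
  have hΩ : ∀ i, 1 ≤ i → i ≤ n + 1 → ∀ z ∈ Set.Icc (y (k - 1)) (y (k + 2)),
      |iteratedDeriv i (orbSum g w q) z| ≤ Q₂ * X ^ m₀ := by
    intro i hi hi' z hz
    obtain ⟨i, rfl⟩ : ∃ j, i = j + 1 := ⟨i - 1, by omega⟩
    have h1 := derivBound_deriv_orbSum h.lift hw.smooth (q := q) (n := n) (x := z)
      (I := fun i => CK * (s (i + 1) / d)) (by positivity : 0 ≤ 1 / d) hCK hD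
      (fun i hi => (hKo (i + 1) hi z (hsub hz)).mono (by positivity) le_rfl (by omega))
      (fun i hi => mul_le_mul_of_nonneg_left
        (div_le_div_of_nonneg_right (hs1 (i + 1) hi) hd0.le) hCK0.le) i (by omega)
    rw [iteratedDeriv_succ']
    refine h1.trans ?_
    have h2 : ∑ i ∈ Finset.range q, CK * (s (i + 1) / d) ≤ CK * (C * X ^ 4 * (1 / d)) := by
      rw [← Finset.mul_sum, ← Finset.sum_div, div_eq_mul_one_div]
      have h3 : ∑ i ∈ Finset.range q, s (i + 1) ≤ C * X ^ 4 := by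
        refine ((h.sum_span_succ a m).trans W.n_le).trans ?_
        gcongr
      gcongr
    calc _ ≤ 2 ^ n * (n.factorial * (Q₁ * X ^ (2 * cb)) * CK ^ n) *
            (CK * (C * X ^ 4 * (1 / d))) * (1 / d) ^ n := by
          gcongr
          omega
      _ = 2 ^ n * (n.factorial * (Q₁ * X ^ (2 * cb)) * CK ^ n) *
            (CK * (C * X ^ 4)) * (1 / d) ^ (n + 1) := by ring
      _ ≤ 2 ^ n * (n.factorial * (Q₁ * X ^ (2 * cb)) * CK ^ n) *
            (CK * (C * X ^ 4)) * (C * X ^ 20) ^ (n + 1) := by gcongr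
      _ = _ := by rw [hQ₂, hm₀, mul_pow C, ← pow_mul]; ring
  have hXm : ∀ {j : ℕ}, j ≤ m₀ → X ^ j ≤ X ^ m₀ := fun hj => pow_le_pow_right₀ hX1 hj
  have hXm1 : 1 ≤ X ^ m₀ := one_le_pow₀ hX1
  have hbase : ∀ {v}, 0 ≤ v → v ≤ Q → v * X ^ m₀ ≤ Q * X ^ m₀ := fun _ hv => by gcongr
  have hQ2 : 2 ≤ Q := by linarith
  have hret := return_bound (k := k) (r := r) (D := CK * (1 / d) ^ (2 * r + 1)) h (by omega)
    (n := n) (by omega) (by linarith) (fun z hz => by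
      refine (hKo q le_rfl z hz (2 * r) le_rfl).trans ?_
      rw [pow_succ' (1 / d) (2 * r), ← mul_assoc CK]
      exact mul_le_mul_of_nonneg_right (mul_le_mul_of_nonneg_left
        (div_le_div_of_nonneg_right (hs1 q le_rfl) hd0.le) hCK0.le) (by positivity))
  set τ := CK * (1 / d) ^ (2 * r + 1) * H ^ (2 * r + 1 - n) with hτ
  have hτ0 : 0 ≤ τ := by positivity
  have hfin : (Q * X ^ m₀) ^ cS * τ ≤ Q₃ / B := by
    have e1 : H ^ (2 * r + 1 - n) = H ^ (2 * r + 1) * (1 / H) ^ n := by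
      rw [one_div, inv_pow, eq_mul_inv_iff_mul_eq₀ (by positivity), ← pow_add]
      congr 1; omega
    have e2 : 2 * r + 1 = 22 * N + 1 := by omega
    have hsc := scalar_bound hB0 hH0 hd0 hC0 W.span_le W.le_d N
    calc (Q * X ^ m₀) ^ cS * τ
        = Q ^ cS * CK * (X ^ (m₀ * cS) * (1 / H) ^ n * (H / d) ^ (22 * N + 1)) := by
          rw [hτ, e1, e2, mul_pow, ← pow_mul, div_pow H d, one_div_pow d]
          generalize H ^ (22 * N + 1) = z, d ^ (22 * N + 1) = t, (1 / H) ^ n = u,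
            X ^ (m₀ * cS) = v, Q ^ cS = s
          ring
      _ ≤ Q ^ cS * CK * (X ^ (m₀ * cS) * X ^ (n + 1) * (H / d) ^ (22 * N + 1)) := by
          have : (1 / H) ^ n ≤ X ^ (n + 1) :=
            (pow_le_pow_left₀ (by positivity) hHX n).trans (pow_le_pow_right₀ hX1 (by omega))
          gcongr
      _ = Q ^ cS * CK * (X ^ N * (H / d) ^ (22 * N + 1)) := by rw [← pow_add, ← add_assoc]
      _ ≤ Q ^ cS * CK * (C ^ (22 * N + 1) / B) := by gcongr
      _ = _ := by rw [hQ₃]; ring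
  have hb1 : Q₃ / B ≤ 1 := (div_le_one hB0).2 (ceil (by omega))
  have hb2 : Q₃ / B ≤ ε := by
    rw [div_le_iff₀ hB0, ← div_le_iff₀' hε]; exact ceil (by omega)
  intro x
  refine (hS g w p q y k K f (Q * X ^ m₀) τ hw hK hf hfΩ ?_ hτ0 (hfin.trans hb1) ?_ ?_ ?_ ?_
    (fun z hz => hret z (hsub hz)) x).mono zero_le_one (hfin.trans hb2) le_rfl
  · nlinarith
  · intro i hi z
    refine (hD z i hi).trans ((mul_le_mul_of_nonneg_left (hXm (by omega)) hQ₁0).trans ?_)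
    exact hbase hQ₁0 (by linarith)
  · intro z
    have h1 : ℓ ≤ Real.exp K * deriv (orbSum g w q) z := hw.deriv_ge hK z
    have h2 : 1 / (Q * X ^ m₀) ≤ ℓ / Real.exp K := by
      have h3 : 1 / ℓ * Real.exp K ≤ Q * X ^ m₀ := by
        calc 1 / ℓ * Real.exp K ≤ Cr * X * Real.exp K := by gcongr
          _ = Real.exp K * Cr * X ^ 1 := by ring
          _ ≤ Real.exp K * Cr * X ^ m₀ := mul_le_mul_of_nonneg_left (hXm (by omega)) hQ0
          _ ≤ _ := hbase hQ0 (by linarith)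
      have e : ℓ / Real.exp K = 1 / (1 / ℓ * Real.exp K) := by field_simp
      rw [e]
      exact one_div_le_one_div_of_le (by positivity) h3
    refine h2.trans ?_
    rw [div_le_iff₀' (Real.exp_pos K)]
    exact h1
  · intro i hi hi' z hz
    exact (hΩ i hi hi' z hz).trans (hbase hQ₂0 (by linarith))
  · intro i hi hi' z
    refine ((hgA i hi hi' z).trans (le_max_left A₀ 0)).trans ?_
    calc A = A * 1 := (mul_one A).symm
      _ ≤ A * X ^ m₀ := by gcongr
      _ ≤ _ := hbase hA0 (by linarith)

/-- `G` is smoothly conjugate to the rotation by `β`. -/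
def ConjRot (G : ℝ → ℝ) (β : ℝ) : Prop :=
  ∃ Φ, IsLift Φ ∧ ∀ x, Φ (G x) = Φ x + β

lemma IsLift.abs_sub_sub_le {Φ : ℝ → ℝ} (h : IsLift Φ) (x z : ℝ) : |Φ z - Φ x - (z - x)| ≤ 1 := by
  have h1 := Int.floor_le (z - x)
  have h2 := Int.lt_floor_add_one (z - x)
  have h3 := h.add_int x ⌊z - x⌋
  have h4 := h.add_int x (⌊z - x⌋ + 1)
  push_cast at h4
  have h5 := h.strictMono.monotone (show x + ⌊z - x⌋ ≤ z by linarith)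
  have h6 := h.strictMono.monotone (show z ≤ x + (⌊z - x⌋ + 1) by linarith)
  rw [abs_le]
  constructor <;> linarith

lemma ConjRot.isRotNumber {G : ℝ → ℝ} {β : ℝ} (h : ConjRot G β) : IsRotNumber G β := by
  obtain ⟨Φ, hΦ, hG⟩ := h
  intro x
  have hit : ∀ n : ℕ, Φ (G^[n] x) = Φ x + n * β := fun n => by
    induction n with
    | zero => simp
    | succ n ih => rw [Function.iterate_succ_apply', hG, ih]; push_cast; ring
  have hb : ∀ n : ℕ, |(G^[n] x - x) - n * β| ≤ 1 := fun n => by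
    have := hΦ.abs_sub_sub_le x (G^[n] x)
    rw [hit, ← abs_neg] at this
    convert this using 2
    ring
  rw [tendsto_iff_norm_sub_tendsto_zero]
  refine squeeze_zero' (Eventually.of_forall fun n => norm_nonneg _) ?_
    tendsto_one_div_atTop_nhds_zero_nat
  filter_upwards [eventually_gt_atTop 0] with n hn
  have hn' : (0 : ℝ) < n := Nat.cast_pos.2 hn
  have e : (G^[n] x - x) / n - β = (G^[n] x - x - n * β) / n := by field_simp
  rw [Real.norm_eq_abs, e, abs_div, abs_of_pos hn']
  exact div_le_div_of_nonneg_right (hb n) hn'.le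

/-- Maps that conjugate to a rotation through a given lift. -/
lemma IsLift.exists_conj {Φ : ℝ → ℝ} (h : IsLift Φ) (β : ℝ) :
    ∃ G, IsLift G ∧ ∀ x, Φ (G x) = Φ x + β := by
  obtain ⟨Ψ, hΨ, -, h2⟩ := h.exists_inverse
  exact ⟨_, hΨ.comp (h.add_const β), fun x => h2 _⟩

lemma exists_orbSum_crude (n : ℕ) : ∃ c : ℕ, ∀ (g w : ℝ → ℝ) (p : ℤ) (q : ℕ) (y : ℤ → ℝ) (k : ℤ)
    (K X : ℝ), Surgery g p q y k w → DistBound g K → 2 ≤ X → (q : ℝ) ≤ X → Real.exp K ≤ X →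
    (∀ j, 1 / X ≤ y (j + 1) - y j) → (∀ i ≤ n, ∀ x, |iteratedDeriv i (nu g) x| ≤ X) →
    (∀ i ≤ n, ∀ x, |iteratedDeriv i w x| ≤ X) →
    ∀ x, DerivBound (deriv (orbSum g w q)) x n 1 (X ^ c) := by
  obtain ⟨c, hc⟩ := derivBound_iterate_crude n
  refine ⟨n + (n * n + 1 + 2 * c * n) + (1 + 2 * c),
    fun g w p q y k K X h hK hX hqX hKX hgap hnu hw x => ?_⟩
  have hX1 : 1 ≤ X := by linarith
  have hX0 : 0 < X := by linarith
  have hXX : X ≤ X ^ 2 := le_self_pow₀ hX1 two_ne_zero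
  have hd : ∀ i ≤ q, ∀ x, deriv g^[i] x ≤ X ^ 2 := fun i hi x => by
    obtain ⟨j, hj⟩ := h.orb.exists_index x
    refine (h.orb.deriv_iterate_gap hK hi ⟨hj.1, hj.2.le⟩).1.trans ?_
    have h1 : (y (j + i * p + 1) - y (j + i * p)) / (y (j + 1) - y j) ≤ X := by
      rw [div_le_iff₀ (h.orb.gap_pos j)]
      have := hgap j
      rw [div_le_iff₀' hX0] at this
      exact (h.orb.gap_le_one _).trans this
    rw [sq]
    exact mul_le_mul hKX h1 (div_nonneg (h.orb.gap_pos _).le (h.orb.gap_pos _).le) hX0.le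
  have h2 := derivBound_deriv_orbSum h.orb.lift h.smooth (q := q) (n := n) (x := x) (s := 1)
    (I := fun _ => (X ^ 2) ^ c) zero_le_one (one_le_pow₀ (one_le_pow₀ hX1))
    (fun z i hi => hw i hi z)
    (fun i hi => hc g q (X ^ 2) h.orb.lift (by linarith) (fun i hi x => (hnu i hi x).trans hXX)
      (hqX.trans hXX) hd (i + 1) hi x) (fun i _ => by rw [mul_one])
  refine h2.mono zero_le_one ?_ le_rfl
  rw [Finset.sum_const, Finset.card_range, nsmul_eq_mul]
  have h3 := two_pow_le hX n
  have h4 := factorial_le_pow hX n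
  calc (2 : ℝ) ^ n * (n.factorial * X * ((X ^ 2) ^ c) ^ n) * (q * (X ^ 2) ^ c)
      ≤ X ^ n * (X ^ (n * n) * X * ((X ^ 2) ^ c) ^ n) * (X * (X ^ 2) ^ c) := by gcongr
    _ = _ := by
      rw [← pow_mul, ← pow_mul]; ring

/-- A map with a long periodic orbit whose rotation number is a very good approximation of `α`
is close to a map that is smoothly conjugate to the rotation by `α`. -/
lemma exists_conjRot_near {α : ℝ} (hα : Irrational α) (n : ℕ) : ∃ L : ℕ, ∀ K A ε : ℝ, 0 ≤ K →
    0 < ε → ∃ (κ : ℕ) (η : ℝ) (Q : ℕ), 0 < η ∧ ∀ (g : ℝ → ℝ) (p : ℤ) (q : ℕ) (y : ℤ → ℝ),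
    PerOrbit g p q y → DistBound g K → (∀ i ≤ L, ∀ x, |iteratedDeriv i (sch g) x| ≤ A) →
    (∀ i ≤ n, ∀ x, |iteratedDeriv i (nu g) x| ≤ A) →
    (∀ i, 1 ≤ i → i ≤ n → ∀ x, |iteratedDeriv i g x| ≤ A) → Q ≤ q → |α - p / q| < η →
    |α - p / q| ≤ 1 / (q : ℝ) ^ κ →
    ∃ G, IsLift G ∧ ConjRot G α ∧ ∀ x, DerivBound (fun z => G z - g z) x n 1 ε := by
  obtain ⟨L, hL⟩ := exists_fine n
  obtain ⟨cO, hO⟩ := exists_orbSum_crude n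
  obtain ⟨cI, hI⟩ := implicit_sub_bound n
  refine ⟨L, fun K A ε hK0 hε => ?_⟩
  obtain ⟨c, C, ε', hC, hε', hfine⟩ := hL K A (ε / 2) (by positivity)
  obtain ⟨κ₁, hgl⟩ := exists_gap_lower hK0
  obtain ⟨η, hη, N, hgu⟩ := exists_gap_upper hα K hε'
  set m := 1 + κ₁ + (2 + 2 * κ₁) * c with hm
  set M := m * cO + m * 2 with hM
  refine ⟨M * cI + 2, η, N + 3 + ⌈C⌉₊ + ⌈Real.exp (5 * K) ^ 2⌉₊ + ⌈Real.exp K⌉₊ + ⌈A + ε⌉₊ +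
    ⌈2 / ε⌉₊,
    hη, fun g p q y h hK hsch hnu hg hQ hη' hκ => ?_⟩
  have hq3 : 3 ≤ q := by omega
  obtain ⟨w, k, hw, hwb, hf⟩ := hfine g p q y h hK hsch hg hq3 (hgu g p q y h hK hη' (by omega))
  have hq : (3 : ℝ) ≤ q := by exact_mod_cast hq3
  have hq1 : (1 : ℝ) ≤ q := by linarith
  have hq0 : (0 : ℝ) < q := by linarith
  have ceil : ∀ {x : ℝ}, ⌈x⌉₊ ≤ q → x ≤ q := fun h => (Nat.le_ceil _).trans (by exact_mod_cast h)
  have hgap := hgl g p q y h hK (by omega)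
  set X := (q : ℝ) ^ m with hX
  have hpow : ∀ {j : ℕ}, j ≤ m → (q : ℝ) ^ j ≤ X := fun hj => pow_le_pow_right₀ hq1 hj
  have hqX : (q : ℝ) ≤ X := by simpa using hpow (show 1 ≤ m by omega)
  have hX0 : 0 < X := by positivity
  have hX2 : 2 ≤ X := by linarith
  have hX1 : 1 ≤ X := by linarith
  have hgapX : ∀ j, 1 / X ≤ y (j + 1) - y j := fun j =>
    (one_div_le_one_div_of_le (by positivity) (hpow (by omega))).trans (hgap j)
  have hKX : Real.exp K ≤ X := (ceil (by omega)).trans hqX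
  have hAq : A + ε ≤ q := ceil (by omega)
  have hwX : ∀ i ≤ n, ∀ x, |iteratedDeriv i w x| ≤ X := fun i hi x => by
    have := hwb x i hi
    rw [one_pow, mul_one] at this
    refine this.trans (le_trans ?_ (hpow (show (2 + 2 * κ₁) * c ≤ m by omega)))
    rw [pow_mul]
    refine pow_le_pow_left₀ (by positivity) ?_ c
    rw [div_le_iff₀ (pow_pos (h.gap_pos k) 2)]
    have h1 : 1 ≤ (q : ℝ) ^ κ₁ * (y (k + 1) - y k) := by
      have := hgap k
      rwa [div_le_iff₀' (by positivity)] at this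
    calc C * Real.exp (5 * K) ^ 2 ≤ q * q * 1 ^ 2 := by
          rw [one_pow, mul_one]
          exact mul_le_mul (ceil (by omega)) (ceil (by omega)) (by positivity) hq0.le
      _ ≤ q * q * ((q : ℝ) ^ κ₁ * (y (k + 1) - y k)) ^ 2 := by gcongr
      _ = _ := by ring
  have hΩ := hO g w p q y k K X hw hK hX2 hqX hKX hgapX
    (fun i hi x => (hnu i hi x).trans (by linarith)) hwX
  have hc0 := hw.prim_one_pos hK
  have hc1 := hw.prim_one_le
  have hlift := hw.isLift hK
  obtain ⟨F, hFl, hF⟩ := hlift.exists_conj (p / q)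
  obtain ⟨G, hGl, hG⟩ := hlift.exists_conj α
  have hF' : ∀ x, orbSum g w q (F x) = orbSum g w q x + p * prim w 1 := fun x => by
    have := hF x
    field_simp at this
    rw [this, mul_comm]
  have hG' : ∀ x, orbSum g w q (G x) = orbSum g w q (F x) + (α - p / q) * (q * prim w 1) :=
    fun x => by
      have := hG x
      rw [hF']
      field_simp at this ⊢
      rw [this]; ring
  have hFg := hf F hFl hF'
  refine ⟨G, hGl, ⟨_, hlift, hG⟩, fun x => ?_⟩
  have hle : X ^ cO ≤ (q : ℝ) ^ M := by
    rw [hX, ← pow_mul]; exact pow_le_pow_right₀ hq1 (by omega)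
  have hle2 : X ^ 2 ≤ (q : ℝ) ^ M := by
    rw [hX, ← pow_mul]; exact pow_le_pow_right₀ hq1 (by omega)
  have hXX : X ≤ X ^ 2 := le_self_pow₀ hX1 two_ne_zero
  have hB2 : 2 ≤ (q : ℝ) ^ M := by linarith
  have hτ : ((q : ℝ) ^ M) ^ cI * (|α - p / q| * q) ≤ ε / 2 := by
    calc ((q : ℝ) ^ M) ^ cI * (|α - p / q| * q)
        ≤ ((q : ℝ) ^ M) ^ cI * (1 / (q : ℝ) ^ (M * cI + 2) * q) := by gcongr
      _ = 1 / q := by rw [← pow_mul, pow_add]; field_simp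
      _ ≤ ε / 2 := by
        rw [div_le_div_iff₀ hq0 two_pos, one_mul]
        have : 2 / ε ≤ q := ceil (by omega)
        rwa [div_le_iff₀' hε] at this
  have hGF := hI (orbSum g w q) G F (fun _ => (α - p / q) * (q * prim w 1)) x ((q : ℝ) ^ M)
    (|α - p / q| * q) (smooth_orbSum h.lift hw.smooth q) hGl.smooth hFl.smooth contDiff_const
    (hw.deriv_pos hK) hG' hB2 ?_ ?_ ?_ ?_ ?_
  · have e : (fun z => G z - g z) = fun z => (G z - F z) + (F z - g z) := funext fun z => by ring
    rw [e]
    refine ((hGF.mono zero_le_one hτ le_rfl).add (hGl.smooth.sub hFl.smooth)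
      (hFl.smooth.sub h.lift.smooth) (hFg x)).mono zero_le_one (by linarith) le_rfl
  · calc |α - p / q| * q ≤ 1 / (q : ℝ) ^ (M * cI + 2) * q := by gcongr
      _ = 1 / (q : ℝ) ^ (M * cI + 1) := by
        rw [show M * cI + 2 = (M * cI + 1) + 1 by ring, pow_succ]; field_simp
      _ ≤ 1 := by
        rw [div_le_one (by positivity)]; exact one_le_pow₀ hq1
  · intro i hi hi' z _
    obtain ⟨i, rfl⟩ : ∃ j, i = j + 1 := ⟨i - 1, by omega⟩
    rw [iteratedDeriv_succ']
    have := hΩ z i (by omega)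
    rw [one_pow, mul_one] at this
    exact this.trans hle
  · intro z _
    have h1 := hw.deriv_ge hK z
    have h2 := hgapX k
    have h3 := (hw.deriv_pos hK z).le
    rw [div_le_iff₀ (by positivity)] at h2 ⊢
    calc 1 ≤ (y (k + 1) - y k) * X := h2
      _ ≤ Real.exp K * deriv (orbSum g w q) z * X := by gcongr
      _ ≤ X * deriv (orbSum g w q) z * X := by gcongr
      _ = deriv (orbSum g w q) z * X ^ 2 := by ring
      _ ≤ _ := by gcongr
  · intro i hi hi'
    have e : F = fun z => (F z - g z) + g z := funext fun z => by ring
    have h1 := hFg x i hi'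
    rw [one_pow, mul_one] at h1
    rw [e, iteratedDeriv_fun_add (smooth_at (hFl.smooth.sub h.lift.smooth) i x)
      (smooth_at h.lift.smooth i x)]
    refine (abs_add_le _ _).trans ?_
    have h2 := hg i hi hi' x
    linarith
  · intro i hi
    rw [one_pow, mul_one, iteratedDeriv_const]
    split_ifs
    · rw [abs_mul, abs_of_pos (mul_pos hq0 hc0)]
      refine mul_le_mul_of_nonneg_left ?_ (abs_nonneg _)
      nlinarith
    · rw [abs_zero]; positivity

lemma exists_rat_near_of_not_isDiophantine {α : ℝ} (hα : Irrational α) (h : ¬ IsDiophantine α)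
    (κ Q : ℕ) : ∃ (p : ℤ) (q : ℕ), IsCoprime p (q : ℤ) ∧ Q ≤ q ∧ 0 < q ∧
      |α - p / q| ≤ 1 / (q : ℝ) ^ κ := by
  by_contra! hcon
  apply h
  have hev : ∀ᶠ γ : ℝ in 𝓝[>] 0, ∀ q ∈ Finset.range Q, 0 < q → ∀ p : ℤ, γ ≤ |α - p / q| := by
    rw [Filter.eventually_all_finset]
    intro q _
    rcases Nat.eq_zero_or_pos q with rfl | hq
    · exact Eventually.of_forall fun _ h => absurd h (lt_irrefl 0)
    have hq' : (0 : ℝ) < q := Nat.cast_pos.2 hq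
    have hpos : 0 < |α * q - round (α * q)| / q := by
      refine div_pos (abs_pos.2 (sub_ne_zero.2 ?_)) hq'
      exact (hα.mul_natCast hq.ne').ne_int _
    filter_upwards [Ioo_mem_nhdsGT hpos] with γ hγ _ p
    refine hγ.2.le.trans ?_
    rw [div_le_iff₀ hq']
    calc |α * q - round (α * q)| ≤ |α * q - p| := round_le _ _
      _ = |α - p / q| * q := by
        rw [← abs_of_pos hq', ← abs_mul, abs_of_pos hq']; congr 1; field_simp
  obtain ⟨γ, hγ, hγ0⟩ := (hev.and self_mem_nhdsWithin).exists
  refine ⟨min γ 1, by positivity, κ, by positivity, fun p q hq => ?_⟩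
  have hq1 : (1 : ℝ) ≤ q := by exact_mod_cast hq
  have hpow : (1 : ℝ) ≤ (q : ℝ) ^ ((2 : ℝ) + κ) := Real.one_le_rpow hq1 (by positivity)
  obtain ⟨p', q', hcop, hq'0, hq'q, he⟩ : ∃ (p' : ℤ) (q' : ℕ), IsCoprime p' (q' : ℤ) ∧ 0 < q' ∧
      q' ≤ q ∧ (p : ℝ) / q = p' / q' := by
    have hd := Int.gcd_pos_of_ne_zero_right p (by omega : (q : ℤ) ≠ 0)
    obtain ⟨p', hp'⟩ : (Int.gcd p q : ℤ) ∣ p := Int.gcd_dvd_left _ _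
    obtain ⟨q', hq'⟩ : Int.gcd p q ∣ q := by exact_mod_cast Int.gcd_dvd_right p q
    set d := Int.gcd p q with hdd
    refine ⟨p', q', ?_, ?_, ?_, ?_⟩
    · rw [Int.isCoprime_iff_gcd_eq_one]
      have : Int.gcd p q = d * Int.gcd p' q' := by
        conv_lhs => rw [hp', hq', Nat.cast_mul, Int.gcd_mul_left]
        simp
      rw [← hdd] at this
      exact Nat.eq_of_mul_eq_mul_left hd (by linarith)
    · exact Nat.pos_of_ne_zero fun h0 => by simp [h0] at hq'; omega
    · rw [hq']; exact Nat.le_mul_of_pos_left _ hd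
    · rw [hq', hp']
      have : (d : ℝ) ≠ 0 := by positivity
      push_cast
      rw [mul_div_mul_left _ _ this]
  rw [he, div_le_iff₀ (by linarith)]
  rcases lt_or_ge q' Q with hlt | hge
  · calc min γ 1 ≤ γ := min_le_left _ _
      _ ≤ |α - p' / q'| * 1 := by rw [mul_one]; exact hγ q' (Finset.mem_range.2 hlt) hq'0 p'
      _ ≤ _ := by gcongr
  · have h1 := (hcon p' q' hcop hge hq'0).le
    have hq'1 : (0 : ℝ) < q' := Nat.cast_pos.2 hq'0
    rw [div_le_iff₀ (by positivity)] at h1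
    refine (min_le_right _ _).trans (h1.trans ?_)
    refine mul_le_mul_of_nonneg_left ?_ (abs_nonneg _)
    calc (q' : ℝ) ^ κ ≤ (q : ℝ) ^ κ := by gcongr
      _ = (q : ℝ) ^ (κ : ℝ) := (Real.rpow_natCast _ _).symm
      _ ≤ _ := Real.rpow_le_rpow_of_exponent_le hq1 (by linarith)

lemma exists_int_sub_mul_lt {α : ℝ} (hα : Irrational α) {ε : ℝ} (hε : 0 < ε) :
    ∃ (n : ℕ) (m : ℤ), 0 < n ∧ 0 < m - n * α ∧ m - n * α < ε := by
  obtain ⟨M, hM⟩ := exists_nat_gt (1 / ε)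
  have hM0 : 0 < M := Nat.cast_pos.1 ((by positivity : 0 < 1 / ε).trans hM)
  obtain ⟨j, k, hk0, -, hjk⟩ := Real.exists_int_int_abs_mul_sub_le α hM0
  have hlt : 1 / ((M : ℝ) + 1) < ε := by
    rw [div_lt_iff₀ (by positivity)]
    rw [div_lt_iff₀ hε] at hM
    linarith
  lift k to ℕ using hk0.le
  have hk : 0 < k := by exact_mod_cast hk0
  rw [Int.cast_natCast] at hjk
  have hδ := hjk.trans_lt hlt
  set δ := (k : ℝ) * α - j with hδd
  have hne : δ ≠ 0 := sub_ne_zero.2 ((hα.natCast_mul hk.ne').ne_int j)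
  rcases lt_or_gt_of_ne hne with hneg | hpos
  · rw [abs_of_neg hneg] at hδ
    exact ⟨k, j, hk, by linarith, by linarith⟩
  · rw [abs_of_pos hpos] at hδ
    set N := ⌊1 / δ⌋₊ + 1 with hN
    have h1 : 1 < N * δ := by
      have := Nat.lt_floor_add_one (1 / δ)
      rw [div_lt_iff₀ hpos] at this
      rw [hN]; push_cast; exact this
    have h2 : (N - 1) * δ ≤ 1 := by
      have := Nat.floor_le (by positivity : 0 ≤ 1 / δ)
      rw [le_div_iff₀ hpos] at this
      rw [hN]; push_cast; linarith
    rcases le_or_gt δ 1 with hδ1 | hδ1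
    · have hN2 : 1 < N := by
        have : 1 ≤ ⌊1 / δ⌋₊ := Nat.le_floor (by rw [le_div_iff₀ hpos]; simpa using hδ1)
        omega
      refine ⟨(N - 1) * k, 1 + (N - 1 : ℕ) * j, Nat.mul_pos (by omega) hk, ?_, ?_⟩
      · have hirr := (hα.natCast_mul (Nat.mul_pos (show 0 < N - 1 by omega) hk).ne').ne_int
          (1 + (N - 1 : ℕ) * j)
        refine lt_of_le_of_ne ?_ (sub_ne_zero.2 hirr.symm).symm
        push_cast [Nat.cast_sub hN2.le]
        linarith [show ((N : ℝ) - 1) * k * α = (N - 1) * δ + (N - 1) * j by rw [hδd]; ring]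
      · push_cast [Nat.cast_sub hN2.le]
        linarith [show ((N : ℝ) - 1) * k * α = (N - 1) * δ + (N - 1) * j by rw [hδd]; ring]
    · refine ⟨k, ⌊δ⌋ + 1 + j, hk, ?_, ?_⟩
      · push_cast
        linarith [Int.lt_floor_add_one δ]
      · push_cast
        linarith [Int.floor_le δ]

lemma IsLift.add_const_iterate_ge {F : ℝ → ℝ} (h : IsLift F) {ε : ℝ} (hε : 0 ≤ ε) (n : ℕ) (x : ℝ) :
    F^[n] x ≤ (fun z => F z + ε)^[n] x := by
  induction n with
  | zero => simp
  | succ n ih =>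
    rw [Function.iterate_succ_apply', Function.iterate_succ_apply']
    linarith [h.strictMono.monotone ih]

/-- Iterating an upper bound for one displacement. -/
lemma IsLift.iterate_le_of_le {F : ℝ → ℝ} (h : IsLift F) {x : ℝ} {p : ℤ} (hp : F x ≤ x + p)
    (j : ℕ) :
    F^[j] x ≤ x + j * p := by
  induction j with
  | zero => simp
  | succ j ih =>
    rw [Function.iterate_succ_apply]
    have h1 := (h.iterate j).strictMono.monotone hp
    rw [(h.iterate j).add_int] at h1
    push_cast
    linarith

/-- Iterating a lower bound for one displacement. -/
lemma IsLift.le_iterate_of_le {F : ℝ → ℝ} (h : IsLift F) {x : ℝ} {p : ℤ} (hp : x + p ≤ F x)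
    (j : ℕ) :
    x + j * p ≤ F^[j] x := by
  induction j with
  | zero => simp
  | succ j ih =>
    rw [Function.iterate_succ_apply]
    have h1 := (h.iterate j).strictMono.monotone hp
    rw [(h.iterate j).add_int] at h1
    push_cast
    linarith

/-- Adding a positive constant increases an irrational rotation number. -/
lemma exists_le_iterate_add_const {F : ℝ → ℝ} {α : ℝ} (h : IsLift F) (hF : IsRotNumber F α)
    (hα : Irrational α) {ε : ℝ} (hε : 0 < ε) : ∃ η > 0, ∀ (p : ℤ) (q : ℕ), 0 < q →
      (p : ℝ) / q < α + η → p ≤ (fun z => F z + ε)^[q] 0 := by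
  obtain ⟨n, m, hn, hm0, hmε⟩ := exists_int_sub_mul_lt hα hε
  have hn' : (0 : ℝ) < n := Nat.cast_pos.2 hn
  obtain ⟨x, hx⟩ : ∃ x, x - ε < F^[n] x - m := by
    by_contra! hcon
    have hit : ∀ j : ℕ, F^[n * j] 0 ≤ j * (m - ε) := fun j => by
      induction j with
      | zero => simp
      | succ j ih =>
        rw [Nat.mul_succ, add_comm, Function.iterate_add_apply]
        have := hcon (F^[n * j] 0)
        push_cast
        linarith
    have hlim : Tendsto (fun j : ℕ => (F^[n * j] 0 - 0) / ((n * j : ℕ) : ℝ)) atTop (𝓝 α) :=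
      (hF 0).comp (tendsto_id.const_mul_atTop' hn)
    have : α ≤ (m - ε) / n := by
      refine le_of_tendsto hlim ?_
      filter_upwards [eventually_gt_atTop 0] with j hj
      have hj' : (0 : ℝ) < j := Nat.cast_pos.2 hj
      rw [Nat.cast_mul, sub_zero, div_le_div_iff₀ (by positivity) hn']
      have := mul_le_mul_of_nonneg_left (hit j) hn'.le
      linarith
    rw [le_div_iff₀ hn'] at this
    linarith
  set G := fun z => F z + ε with hG
  have hGl : IsLift G := h.add_const ε
  have hx' : x + m ≤ G^[n] x := by
    obtain ⟨n, rfl⟩ : ∃ k, n = k + 1 := ⟨n - 1, by omega⟩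
    rw [Function.iterate_succ_apply'] at hx ⊢
    have := h.strictMono.monotone (h.add_const_iterate_ge hε.le n x)
    change x + m ≤ F (G^[n] x) + ε
    linarith
  refine ⟨m / n - α, by rw [gt_iff_lt, sub_pos, lt_div_iff₀ hn']; linarith, fun p q hq hpq => ?_⟩
  have hq' : (0 : ℝ) < q := Nat.cast_pos.2 hq
  by_contra! hlt
  rw [add_sub_cancel, div_lt_div_iff₀ hq' hn'] at hpq
  have hint : p * n + 1 ≤ m * q := by exact_mod_cast (by exact_mod_cast hpq : p * n < m * q)
  have hint' : (p : ℝ) * n + 1 ≤ m * q := by exact_mod_cast hint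
  have h1 := (hGl.iterate q).iterate_le_of_le (x := 0) (p := p) (by linarith) (n * 2)
  have h2 := (hGl.iterate n).le_iterate_of_le hx' (q * 2)
  rw [← Function.iterate_mul] at h1 h2
  rw [show n * (q * 2) = q * (n * 2) by ring] at h2
  have h3 := (abs_le.1 ((hGl.iterate (q * (n * 2))).abs_sub_sub_le 0 x)).2
  push_cast at h1 h2
  linarith

/-- Periodic points appear after a small change by a constant. -/
lemma exists_add_const_iterate_eq {F : ℝ → ℝ} {α : ℝ} (h : IsLift F) (hF : IsRotNumber F α)
    (hα : Irrational α) {ε : ℝ} (hε : 0 < ε) : ∃ η > 0, ∀ (p : ℤ) (q : ℕ), 0 < q →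
      |α - p / q| < η → ∃ t, |t| ≤ ε ∧ (fun z => F z + t)^[q] 0 = p := by
  obtain ⟨η₁, h1, H1⟩ := exists_le_iterate_add_const h hF hα hε
  have hr : IsLift fun x => -F (-x) := by
    refine ⟨(h.smooth.comp contDiff_neg).neg, fun x => ?_, fun x => ?_⟩
    · have := (((smooth_differentiable h.smooth (-x)).hasDerivAt.comp x
        (hasDerivAt_neg x)).neg).deriv
      simp only [mul_neg, mul_one, neg_neg] at this
      exact this ▸ h.deriv_pos (-x)
    · have := h.add_one (-(x + 1))
      rw [show -(x + 1) + 1 = -x by ring] at this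
      rw [this]; ring
  have hit : ∀ t (n : ℕ) x, (fun x => -F (-x) + t)^[n] x = -(fun z => F z + -t)^[n] (-x) :=
    fun t n x => by
      induction n with
      | zero => simp
      | succ n ih =>
        rw [Function.iterate_succ_apply', Function.iterate_succ_apply', ih]
        simp only [neg_neg]
        ring
  have hrF : IsRotNumber (fun x => -F (-x)) (-α) := fun x => by
    refine ((hF (-x)).neg).congr fun n => ?_
    have := hit 0 n x
    simp only [add_zero, neg_zero] at this
    rw [this]
    ring
  obtain ⟨η₂, h2, H2⟩ := exists_le_iterate_add_const hr hrF hα.neg hε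
  refine ⟨min η₁ η₂, lt_min h1 h2, fun p q hq hpq => ?_⟩
  rw [abs_lt] at hpq
  have hu := H1 p q hq (by linarith [min_le_left η₁ η₂])
  have hl := H2 (-p) q hq (by
    push_cast; rw [neg_div]; linarith [min_le_right η₁ η₂])
  rw [hit, neg_zero] at hl
  push_cast at hl
  have hcont : Continuous fun t => (fun z => F z + t)^[q] 0 := by
    clear hu hl hpq hq
    induction q with
    | zero => exact continuous_const
    | succ q ih =>
      simp only [Function.iterate_succ_apply']
      exact (h.smooth.continuous.comp ih).add continuous_id
  obtain ⟨t, ht, he⟩ := intermediate_value_Icc (by linarith : -ε ≤ ε) hcont.continuousOn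
    (show (p : ℝ) ∈ _ from ⟨by linarith, hu⟩)
  exact ⟨t, abs_le.2 ht, he⟩

/-- Density of the maps smoothly conjugate to an irrational rotation. -/
lemma deriv_periodic {f : ℝ → ℝ} (hp : ∀ x, f (x + 1) = f x) (x : ℝ) :
    deriv f (x + 1) = deriv f x := by
  simpa using iteratedDeriv_periodic hp 1 x

lemma IsLift.deriv_add_one {F : ℝ → ℝ} (h : IsLift F) (x : ℝ) :
    deriv F (x + 1) = deriv F x := by
  rw [← deriv_comp_add_const, show (fun x => F (x + 1)) = fun x => F x + 1 from
    funext h.add_one, deriv_add_const]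

lemma exists_conjRot_approx {F : ℝ → ℝ} {α : ℝ} (h : IsLift F) (hF : IsRotNumber F α)
    (hα : Irrational α) (hL : ¬ IsDiophantine α) (n : ℕ) {ε : ℝ} (hε : 0 < ε) :
    ∃ G, IsLift G ∧ ConjRot G α ∧ ∀ x, DerivBound (fun z => G z - F z) x n 1 ε := by
  obtain ⟨L, hmain⟩ := exists_conjRot_near hα n
  have hnup : ∀ x, nu F (x + 1) = nu F x := deriv_periodic fun x => by
    simp only [h.deriv_add_one]
  have hschp : ∀ x, sch F (x + 1) = sch F x := fun x => by
    simp only [sch, hnup, deriv_periodic hnup]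
  obtain ⟨A₁, hA₁⟩ := exists_iteratedDeriv_bound h.smooth_nu hnup n
  obtain ⟨A₂, hA₂⟩ := exists_iteratedDeriv_bound h.smooth_sch hschp L
  obtain ⟨A₃, hA₃⟩ := exists_iteratedDeriv_bound (smooth_deriv h.smooth) h.deriv_add_one n
  have hA₁0 : 0 ≤ A₁ := (abs_nonneg _).trans (hA₁ 0 (Nat.zero_le _) 0)
  obtain ⟨κ, η, Q, hη, hmain⟩ := hmain A₁ (max A₁ (max A₂ A₃)) (ε / 2) hA₁0 (by positivity)
  obtain ⟨η', hη', ht⟩ := exists_add_const_iterate_eq h hF hα (half_pos hε)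
  obtain ⟨N, hN⟩ := exists_nat_gt (1 / min η η')
  obtain ⟨p, q, hpq, hQq, hq, hap⟩ := exists_rat_near_of_not_isDiophantine hα hL (κ + 1) (Q + N)
  have hmin : 0 < min η η' := lt_min hη hη'
  have hq1 : (1 : ℝ) ≤ q := by exact_mod_cast hq
  have hNq : (N : ℝ) ≤ q := by exact_mod_cast (by omega : N ≤ q)
  have h1 : |α - p / q| ≤ 1 / (q : ℝ) ^ κ := hap.trans
    (one_div_le_one_div_of_le (by positivity) (pow_le_pow_right₀ hq1 (Nat.le_succ κ)))
  have h2 : |α - p / q| < min η η' := by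
    refine hap.trans_lt ((one_div_le_one_div_of_le (by positivity)
      (le_self_pow₀ hq1 (Nat.succ_ne_zero κ))).trans_lt ?_)
    rw [one_div_lt (by positivity) hmin]
    linarith
  obtain ⟨t, htε, h0⟩ := ht p q hq (h2.trans_le (min_le_right _ _))
  have hg := h.add_const t
  have hdg : deriv (fun z => F z + t) = deriv F := funext fun x => deriv_add_const t
  have hig : ∀ i, 1 ≤ i → iteratedDeriv i (fun z => F z + t) = iteratedDeriv i F := by
    rintro (_ | i) hi
    · omega
    · rw [iteratedDeriv_succ', iteratedDeriv_succ', hdg]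
  have hnug : nu (fun z => F z + t) = nu F := by simp only [nu, hdg]
  have hschg : sch (fun z => F z + t) = sch F := funext fun x => by simp only [sch, hnug]
  obtain ⟨y, hy⟩ := exists_perOrbit hg hq hpq h0
  obtain ⟨G, hG, hGα, hGb⟩ := hmain _ p q y hy
    (fun x => by
      have := hA₁ 0 (Nat.zero_le _) x
      rw [iteratedDeriv_zero, ← hnug] at this
      exact this)
    (fun i hi x => hschg ▸ (hA₂ i hi x).trans ((le_max_left _ _).trans (le_max_right _ _)))
    (fun i hi x => hnug ▸ (hA₁ i hi x).trans (le_max_left _ _))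
    (fun i hi hin x => by
      obtain ⟨i, rfl⟩ : ∃ j, i = j + 1 := ⟨i - 1, by omega⟩
      rw [hig _ hi, iteratedDeriv_succ']
      exact (hA₃ i (by omega) x).trans ((le_max_right _ _).trans (le_max_right _ _)))
    (by omega) (h2.trans_le (min_le_left _ _)) h1
  refine ⟨G, hG, hGα, fun x i hi => ?_⟩
  have hsplit : (fun z => G z - F z) = fun z => (G z - (F z + t)) + t := by
    funext z; ring
  have hsm : ContDiff ℝ ∞ fun z => G z - (F z + t) := hG.smooth.sub hg.smooth
  have hb := hGb x i hi
  rw [hsplit, iteratedDeriv_fun_add (smooth_at hsm i x) contDiffAt_const, iteratedDeriv_const]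
  simp only [one_pow, mul_one] at hb ⊢
  refine (abs_add_le _ _).trans ?_
  have : |if i = 0 then t else 0| ≤ ε / 2 := by
    split_ifs
    · exact htε
    · rw [abs_zero]; positivity
  linarith

section Families

variable {X : Type*} [TopologicalSpace X] {u v : X → ℝ → ℝ}

lemma continuous_iteratedDeriv_mul (hu : ∀ x, ContDiff ℝ ∞ (u x)) (hv : ∀ x, ContDiff ℝ ∞ (v x))
    (n : ℕ) (cu : ∀ i ≤ n, Continuous fun p : X × ℝ => iteratedDeriv i (u p.1) p.2)
    (cv : ∀ i ≤ n, Continuous fun p : X × ℝ => iteratedDeriv i (v p.1) p.2) :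
    Continuous fun p : X × ℝ => iteratedDeriv n (fun t => u p.1 t * v p.1 t) p.2 := by
  have : (fun p : X × ℝ => iteratedDeriv n (fun t => u p.1 t * v p.1 t) p.2) = fun p =>
      ∑ i ∈ Finset.range (n + 1), n.choose i * iteratedDeriv i (u p.1) p.2 *
        iteratedDeriv (n - i) (v p.1) p.2 :=
    funext fun p => iteratedDeriv_mul (smooth_at (hu _) n _) (smooth_at (hv _) n _)
  rw [this]
  refine continuous_finsetSum _ fun i hi => ?_
  have hi : i ≤ n := by simpa [Nat.lt_succ_iff] using hi
  exact (continuous_const.mul (cu i hi)).mul (cv _ (Nat.sub_le _ _))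

lemma continuous_iteratedDeriv_comp (n : ℕ) : ∀ {u : X → ℝ → ℝ}, (∀ x, ContDiff ℝ ∞ (u x)) →
    (∀ x, ContDiff ℝ ∞ (v x)) →
    (∀ i ≤ n, Continuous fun p : X × ℝ => iteratedDeriv i (u p.1) p.2) →
    (∀ i ≤ n, Continuous fun p : X × ℝ => iteratedDeriv i (v p.1) p.2) →
    Continuous fun p : X × ℝ => iteratedDeriv n (fun t => u p.1 (v p.1 t)) p.2 := by
  induction n using Nat.strong_induction_on with
  | _ n ih =>
    intro u hu hv cu cv
    rcases n with _ | n
    · simp only [iteratedDeriv_zero]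
      have h1 := cu 0 le_rfl
      have h2 := cv 0 le_rfl
      simp only [iteratedDeriv_zero] at h1 h2
      exact h1.comp (continuous_fst.prodMk h2)
    · have hd : ∀ x, deriv (fun t => u x (v x t)) = fun t => deriv (u x) (v x t) * deriv (v x) t :=
        fun x => funext fun t => ((smooth_differentiable (hu x) _).hasDerivAt.comp t
          (smooth_differentiable (hv x) t).hasDerivAt).deriv
      simp only [iteratedDeriv_succ', hd]
      refine continuous_iteratedDeriv_mul (u := fun x t => deriv (u x) (v x t))
        (fun x => (smooth_deriv (hu x)).comp (hv x)) (fun x => smooth_deriv (hv x)) n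
        (fun i hi => ih i (by omega) (u := fun x => deriv (u x)) (fun x => smooth_deriv (hu x)) hv
          (fun j hj => ?_) fun j hj => cv j (by omega)) fun i hi => ?_
      · simpa only [iteratedDeriv_succ'] using cu (j + 1) (by omega)
      · simpa only [iteratedDeriv_succ'] using cv (i + 1) (by omega)

end Families

lemma _root_.SmoothLift.isLift (F : SmoothLift) : IsLift F.1 := ⟨F.2.1, F.2.2.1, F.2.2.2⟩

/-- A lift, as a point of the space of smooth lifts. -/
def IsLift.toSmoothLift {g : ℝ → ℝ} (h : IsLift g) : SmoothLift :=
  ⟨g, h.smooth, h.deriv_pos, h.add_one⟩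

lemma continuous_eval_iteratedDeriv (r : ℕ) :
    Continuous fun p : SmoothLift × ℝ => iteratedDeriv r p.1.1 p.2 := by
  have h : Continuous fun F : SmoothLift => fun r : ℕ => (⟨iteratedDeriv r F.1,
      F.2.1.continuous_iteratedDeriv r (by exact_mod_cast le_top)⟩ : C(ℝ, ℝ)) :=
    continuous_induced_dom
  exact ((continuous_pi_iff.1 h r).comp continuous_fst).eval continuous_snd

lemma continuous_smoothLift_of_eval {X : Type*} [TopologicalSpace X] {u : X → SmoothLift}
    (h : ∀ r, Continuous fun p : X × ℝ => iteratedDeriv r (u p.1).1 p.2) : Continuous u :=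
  continuous_induced_rng.2 (continuous_pi fun r =>
    ContinuousMap.continuous_of_continuous_uncurry _ (h r))

/-- Composition of lifts. -/
def liftComp (F G : SmoothLift) : SmoothLift := (F.isLift.comp G.isLift).toSmoothLift

lemma continuous_liftComp : Continuous fun p : SmoothLift × SmoothLift => liftComp p.1 p.2 :=
  continuous_smoothLift_of_eval fun r =>
    continuous_iteratedDeriv_comp (X := SmoothLift × SmoothLift) (v := fun p => p.2.1)
      (u := fun p => p.1.1) r (fun p => p.1.isLift.smooth) (fun p => p.2.isLift.smooth)
      (fun i _ => (continuous_eval_iteratedDeriv i).comp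
        ((continuous_fst.comp continuous_fst).prodMk continuous_snd))
      (fun i _ => (continuous_eval_iteratedDeriv i).comp
        ((continuous_snd.comp continuous_fst).prodMk continuous_snd))

/-- The translation by `s`, as a lift. -/
def liftTranslation (s : ℝ) : SmoothLift := (IsLift.id.add_const s).toSmoothLift

lemma continuous_liftTranslation : Continuous liftTranslation := by
  refine continuous_smoothLift_of_eval fun r => ?_
  rcases r with _ | r
  · simp only [iteratedDeriv_zero]
    exact continuous_snd.add continuous_fst
  · have : ∀ s, iteratedDeriv (r + 1) (liftTranslation s).1 = iteratedDeriv r fun _ => (1 : ℝ) :=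
      fun s => by
        rw [iteratedDeriv_succ']
        congr 1
        funext x
        exact ((hasDerivAt_id x).add_const s).deriv
    simp only [this, iteratedDeriv_const]
    exact continuous_const

/-- The lift `F^[n] + s`. -/
def liftIterate (n : ℕ) (s : ℝ) (F : SmoothLift) : SmoothLift :=
  ((F.isLift.iterate n).add_const s).toSmoothLift

lemma continuous_liftIterate (n : ℕ) (s : ℝ) : Continuous (liftIterate n s) := by
  have h0 : Continuous (liftIterate n 0) := by
    induction n with
    | zero =>
      convert continuous_const (y := liftTranslation 0) using 1
      rfl
    | succ n ih =>
      convert continuous_liftComp.comp (continuous_id.prodMk ih) using 1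
      funext F
      refine Subtype.ext (funext fun x => ?_)
      change F.1^[n + 1] x + 0 = F.1 (F.1^[n] x + 0)
      rw [add_zero, add_zero, Function.iterate_succ_apply']
  convert continuous_liftComp.comp ((continuous_const (y := liftTranslation s)).prodMk h0) using 1
  funext F
  refine Subtype.ext (funext fun x => ?_)
  change F.1^[n] x + s = F.1^[n] x + 0 + s
  rw [add_zero]

lemma tendsto_smoothLift {G : ℕ → SmoothLift} {F : SmoothLift} {b : ℕ → ℝ}
    (hb : Tendsto b atTop (𝓝 0))
    (h : ∀ k, ∀ x, DerivBound (fun z => (G k).1 z - F.1 z) x k 1 (b k)) :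
    Tendsto G atTop (𝓝 F) := by
  rw [nhds_induced, tendsto_comap_iff, tendsto_pi_nhds]
  intro r
  rw [ContinuousMap.tendsto_iff_tendstoLocallyUniformly]
  apply TendstoUniformly.tendstoLocallyUniformly
  rw [Metric.tendstoUniformly_iff]
  intro ε hε
  filter_upwards [hb.eventually (gt_mem_nhds hε), eventually_ge_atTop r] with k hk hrk x
  have := h k x r hrk
  rw [iteratedDeriv_fun_sub (smooth_at (G k).isLift.smooth r x)
    (smooth_at F.isLift.smooth r x), one_pow, mul_one] at this
  rw [dist_comm, Real.dist_eq]
  exact this.trans_lt hk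

/-- All derivatives of a lift, together with the reciprocal of the first one. -/
noncomputable def jetInv (F : SmoothLift) : (ℕ → C(ℝ, ℝ)) × C(ℝ, ℝ) :=
  (fun r => ⟨iteratedDeriv r F.1, (smooth_iteratedDeriv F.isLift.smooth r).continuous⟩,
    ⟨fun x => (deriv F.1 x)⁻¹, (smooth_deriv F.isLift.smooth).continuous.inv₀
      fun x => (F.isLift.deriv_pos x).ne'⟩)

lemma isEmbedding_jetInv : IsEmbedding jetInv := by
  have h2 : Continuous fun F : SmoothLift => (jetInv F).2 := by
    refine ContinuousMap.continuous_of_continuous_uncurry _ ?_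
    have := continuous_eval_iteratedDeriv 1
    simp only [iteratedDeriv_one] at this
    exact this.inv₀ fun p => (p.1.isLift.deriv_pos p.2).ne'
  have h1 : IsInducing fun F : SmoothLift => (jetInv F).1 := ⟨rfl⟩
  refine ⟨IsInducing.of_comp (h1.continuous.prodMk h2) continuous_fst h1, fun F G h => ?_⟩
  have h0 : iteratedDeriv 0 F.1 = iteratedDeriv 0 G.1 :=
    congrArg (fun z : (ℕ → C(ℝ, ℝ)) × C(ℝ, ℝ) => (z.1 0 : ℝ → ℝ)) h
  rw [iteratedDeriv_zero, iteratedDeriv_zero] at h0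
  exact Subtype.ext h0

lemma isClosed_range_jetInv : IsClosed (Set.range jetInv) := by
  have hr : Set.range jetInv = {z | (∀ r x, ∫ t in (0 : ℝ)..x, z.1 (r + 1) t = z.1 r x - z.1 r 0) ∧
      (∀ x, z.2 x * z.1 1 x = 1) ∧ (∀ x, 0 ≤ z.1 1 x) ∧ ∀ x, z.1 0 (x + 1) = z.1 0 x + 1} := by
    ext z
    constructor
    · rintro ⟨F, rfl⟩
      have hF := F.isLift
      refine ⟨fun r x => ?_, fun x => ?_, fun x => ?_, fun x => ?_⟩
      · refine intervalIntegral.integral_eq_sub_of_hasDerivAt (fun t _ => ?_)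
          ((smooth_iteratedDeriv hF.smooth (r + 1)).continuous.intervalIntegrable _ _)
        change HasDerivAt (iteratedDeriv r F.1) (iteratedDeriv (r + 1) F.1 t) t
        rw [iteratedDeriv_succ]
        exact (smooth_differentiable (smooth_iteratedDeriv hF.smooth r) t).hasDerivAt
      · change (deriv F.1 x)⁻¹ * iteratedDeriv 1 F.1 x = 1
        rw [iteratedDeriv_one, inv_mul_cancel₀ (hF.deriv_pos x).ne']
      · change 0 ≤ iteratedDeriv 1 F.1 x
        rw [iteratedDeriv_one]
        exact (hF.deriv_pos x).le
      · exact hF.add_one x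
    · rintro ⟨hint, hinv, hpos, hadd⟩
      have hd : ∀ r x, HasDerivAt (z.1 r) (z.1 (r + 1) x) x := fun r x => by
        have h1 : (z.1 r : ℝ → ℝ) = fun x => (∫ t in (0 : ℝ)..x, z.1 (r + 1) t) + z.1 r 0 :=
          funext fun x => by rw [hint, sub_add_cancel]
        rw [h1]
        exact (intervalIntegral.integral_hasDerivAt_right
          ((z.1 (r + 1)).continuous.intervalIntegrable _ _)
          ((z.1 (r + 1)).continuous.stronglyMeasurableAtFilter _ _)
          (z.1 (r + 1)).continuous.continuousAt).add_const _
      have hi : ∀ r, iteratedDeriv r (z.1 0) = z.1 r := fun r => by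
        induction r with
        | zero => exact iteratedDeriv_zero
        | succ r ih =>
          rw [iteratedDeriv_succ, ih]
          exact funext fun x => (hd r x).deriv
      have hL : IsLift (z.1 0) := by
        refine ⟨contDiff_of_differentiable_iteratedDeriv fun m _ => ?_, fun x => ?_, hadd⟩
        · rw [hi]
          exact fun x => (hd m x).differentiableAt
        · rw [(hd 0 x).deriv]
          refine lt_of_le_of_ne (hpos x) fun h0 => ?_
          have := hinv x
          rw [zero_add] at h0
          rw [← h0, mul_zero] at this
          exact zero_ne_one this
      refine ⟨hL.toSmoothLift, Prod.ext (funext fun r => ?_) ?_⟩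
      · exact ContinuousMap.ext fun x => congrFun (hi r) x
      · refine ContinuousMap.ext fun x => ?_
        change (deriv (z.1 0) x)⁻¹ = z.2 x
        rw [(hd 0 x).deriv]
        exact (eq_inv_of_mul_eq_one_left (hinv x)).symm
  have hev : ∀ r x, Continuous fun z : (ℕ → C(ℝ, ℝ)) × C(ℝ, ℝ) => z.1 r x := fun r x =>
    ((continuous_apply r).comp continuous_fst).eval_const x
  have hev' : ∀ x, Continuous fun z : (ℕ → C(ℝ, ℝ)) × C(ℝ, ℝ) => z.2 x := fun x =>
    continuous_snd.eval_const x
  rw [hr]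
  simp only [Set.ofPred_and, Set.ofPred_forall]
  refine ((isClosed_iInter fun r => isClosed_iInter fun x => isClosed_eq ?_
      ((hev r x).sub (hev r 0))).inter ((isClosed_iInter fun x => isClosed_eq
      ((hev' x).mul (hev 1 x)) continuous_const).inter ((isClosed_iInter fun x =>
      isClosed_le continuous_const (hev 1 x)).inter (isClosed_iInter fun x => isClosed_eq
      (hev 0 _) ((hev 0 x).add continuous_const)))))
  refine intervalIntegral.continuous_parametric_intervalIntegral_of_continuous' ?_ 0 x
  exact (((continuous_apply (r + 1)).comp continuous_fst).comp continuous_fst).eval continuous_snd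

lemma isCompletelyMetrizableSpace_smoothLift :
    TopologicalSpace.IsCompletelyMetrizableSpace SmoothLift :=
  (IsClosedEmbedding.mk isEmbedding_jetInv isClosed_range_jetInv).IsCompletelyMetrizableSpace

lemma not_countable_closure_of_preperfect {X : Type*} [TopologicalSpace X]
    [TopologicalSpace.IsCompletelyMetrizableSpace X] {S : Set X} (hS : Preperfect S)
    (hne : S.Nonempty) :
    ¬ (closure S).Countable := by
  let _ := TopologicalSpace.upgradeIsCompletelyMetrizable X
  obtain ⟨f, hf, -, hinj⟩ := hS.perfect_closure.exists_nat_bool_injection hne.closure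
  intro hc
  have h1 := ((hc.mono hf).preimage_of_injOn hinj.injOn).mono
    fun (x : ℕ → Bool) (_ : x ∈ Set.univ) => (Set.mem_range_self x : f x ∈ Set.range f)
  rw [Set.countable_univ_iff, ← Cardinal.mk_le_aleph0_iff] at h1
  exact Cardinal.aleph0_lt_continuum.not_ge (by simpa using h1)

lemma ConjRot.exists_liftIterate_mem {α : ℝ} (hα : Irrational α) {G : SmoothLift}
    (hG : ConjRot G.1 α) {V : Set SmoothLift} (hV : V ∈ 𝓝 (liftTranslation 0)) :
    ∃ n, 0 < n ∧ ∃ m : ℤ, liftIterate n m G ∈ V := by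
  obtain ⟨Φ, hΦ, hc⟩ := hG
  obtain ⟨H, hH, hHΦ, hΦH⟩ := hΦ.exists_inverse
  set γ : ℝ → SmoothLift := fun s =>
    liftComp hH.toSmoothLift (liftComp (liftTranslation s) hΦ.toSmoothLift) with hγ
  have hγc : Continuous γ := continuous_liftComp.comp (continuous_const.prodMk
    (continuous_liftComp.comp (continuous_liftTranslation.prodMk continuous_const)))
  have hγ0 : γ 0 = liftTranslation 0 := by
    refine Subtype.ext (funext fun x => ?_)
    change H (Φ x + 0) = x + 0
    rw [add_zero, add_zero, hHΦ]
  rw [← hγ0] at hV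
  obtain ⟨ε, hε, hball⟩ := Metric.mem_nhds_iff.1 (hγc.continuousAt hV)
  obtain ⟨n, m, hn, h1, h2⟩ := exists_int_sub_mul_lt hα hε
  refine ⟨n, hn, -m, ?_⟩
  have hmem : γ (n * α - m) ∈ V := hball (by
    rw [Metric.mem_ball, Real.dist_eq, sub_zero, abs_sub_comm, abs_of_pos h1]
    exact h2)
  convert hmem
  refine Subtype.ext (funext fun x => ?_)
  change G.1^[n] x + ((-m : ℤ) : ℝ) = H (Φ x + (n * α - m))
  have hit : ∀ k : ℕ, Φ (G.1^[k] x) = Φ x + k * α := fun k => by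
    induction k with
    | zero => simp
    | succ k ih => rw [Function.iterate_succ_apply', hc, ih]; push_cast; ring
  rw [← hHΦ (G.1^[n] x + ((-m : ℤ) : ℝ)), hΦ.add_int, hit]
  congr 1
  push_cast
  ring

lemma IsIterateLift.liftIterate_comp {F : SmoothLift} {G : ℝ → ℝ} (h : IsIterateLift F.1 G)
    (n : ℕ) (m : ℤ) : IsIterateLift F.1 fun x => F.1^[n] (G x) + m := by
  obtain ⟨l, k, h | h⟩ := h
  · refine ⟨n + l, k + m, Or.inl fun x => ?_⟩
    simp only [h]
    rw [(F.isLift.iterate n).add_int, Function.iterate_add_apply]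
    push_cast
    ring
  · rcases le_total l n with hln | hln
    · obtain ⟨j, rfl⟩ := Nat.exists_eq_add_of_le' hln
      refine ⟨j, k + m, Or.inl fun x => ?_⟩
      simp only
      rw [Function.iterate_add_apply, h, (F.isLift.iterate j).add_int]
      push_cast
      ring
    · obtain ⟨j, rfl⟩ := Nat.exists_eq_add_of_le' hln
      refine ⟨j, k + m, Or.inr fun x => ?_⟩
      simp only
      rw [(F.isLift.iterate j).add_int, ← Function.iterate_add_apply, h]
      push_cast
      ring

lemma iterate_add_int_ne {F : ℝ → ℝ} {α : ℝ} (h : IsLift F) (hF : IsRotNumber F α)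
    (hα : Irrational α) {n : ℕ} (hn : 0 < n) (m : ℤ) (x : ℝ) : F^[n] x + m ≠ x := by
  intro hx
  have hit : ∀ k : ℕ, F^[n * k] x = x - k * m := fun k => by
    induction k with
    | zero => simp
    | succ k ih =>
      rw [Nat.mul_succ, add_comm, Function.iterate_add_apply, ih]
      have := (h.iterate n).add_int x (-(k * m))
      push_cast at this ⊢
      rw [sub_eq_add_neg, this]
      linarith
  have hlim := (hF x).comp
    (tendsto_id.const_mul_atTop' hn : Tendsto (fun k : ℕ => n * k) atTop atTop)
  have heq : (fun k : ℕ => (F^[n * k] x - x) / ((n * k : ℕ) : ℝ)) =ᶠ[atTop]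
      fun _ => ((-m : ℤ) : ℝ) / (n : ℝ) := by
    filter_upwards [eventually_gt_atTop 0] with k hk
    rw [hit]
    push_cast
    field_simp
    ring
  have := tendsto_nhds_unique (hlim.congr' heq) tendsto_const_nhds
  exact hα ⟨((-m : ℤ) : ℚ) / (n : ℚ), by rw [this]; push_cast; rfl⟩

lemma preperfect_isIterateLift {α : ℝ} (hα : Irrational α) {F : SmoothLift}
    (hF : IsRotNumber F.1 α) (h : ∀ V ∈ 𝓝 (liftTranslation 0), ∃ n, 0 < n ∧ ∃ m : ℤ,
      liftIterate n m F ∈ V) : Preperfect {G : SmoothLift | IsIterateLift F.1 G.1} := by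
  rw [preperfect_iff_nhds]
  intro G hG U hU
  have h1 : Continuous fun H => liftComp H G :=
    continuous_liftComp.comp (continuous_id.prodMk continuous_const)
  have h0 : liftComp (liftTranslation 0) G = G := Subtype.ext (funext fun x => add_zero _)
  rw [← h0] at hU
  obtain ⟨n, hn, m, hmem⟩ := h _ (h1.continuousAt hU)
  refine ⟨liftComp (liftIterate n m F) G, ⟨hmem, IsIterateLift.liftIterate_comp hG n m⟩, ?_⟩
  intro heq
  exact iterate_add_int_ne F.isLift hF hα hn m (G.1 0) (congrFun (congrArg Subtype.val heq) 0)

end Yoccoz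

/-- **Yoccoz.** For any Liouville number `α`, the set of smooth circle diffeomorphisms `f`
with rotation number `α` whose centralizer subgroup `Z₀^∞(f)` — the closure, in the `C^∞`
topology, of the group of iterates of `f` — is uncountable, is generic (contains a dense
`G_δ`) in the space `F_α^∞` with the `C^∞` topology. -/
theorem yoccoz_generic_uncountable_Z0 (α : ℝ) (hirr : Irrational α)
    (hLiouville : ¬ IsDiophantine α) :
    ∃ R : Set {F : SmoothLift // IsRotNumber F.1 α},
      IsGδ R ∧ Dense R ∧
      ∀ F ∈ R, ¬ (closure {G : SmoothLift | IsIterateLift F.1.1 G.1}).Countable := by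
  have := Yoccoz.isCompletelyMetrizableSpace_smoothLift
  let _ := TopologicalSpace.upgradeIsCompletelyMetrizable SmoothLift
  obtain ⟨B, hB⟩ := (𝓝 (Yoccoz.liftTranslation 0)).exists_antitone_basis
  refine ⟨⋂ k, {F | ∃ n, 0 < n ∧ ∃ m : ℤ, Yoccoz.liftIterate n m F.1 ∈ interior (B k)},
    .iInter fun k => IsOpen.isGδ ?_, fun F => ?_, fun F hF => ?_⟩
  · simp only [Set.ofPred_exists, Set.ofPred_and]
    refine isOpen_iUnion fun n => isOpen_const.inter (isOpen_iUnion fun m => ?_)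
    exact isOpen_interior.preimage
      ((Yoccoz.continuous_liftIterate n m).comp continuous_subtype_val)
  · have hap := fun k : ℕ => Yoccoz.exists_conjRot_approx F.1.isLift F.2 hirr hLiouville k
      (Nat.one_div_pos_of_nat (α := ℝ) (n := k))
    choose G hG hGα hGF using hap
    have hlim : Tendsto (fun k => (⟨(hG k).toSmoothLift, (hGα k).isRotNumber⟩ :
        {F : SmoothLift // IsRotNumber F.1 α})) atTop (𝓝 F) :=
      tendsto_subtype_rng.2
        (Yoccoz.tendsto_smoothLift tendsto_one_div_add_atTop_nhds_zero_nat hGF)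
    refine mem_closure_of_tendsto hlim (Eventually.of_forall fun k => Set.mem_iInter.2 fun j => ?_)
    exact Yoccoz.ConjRot.exists_liftIterate_mem hirr (hGα k)
      (interior_mem_nhds.2 (hB.1.mem_of_mem trivial))
  · refine Yoccoz.not_countable_closure_of_preperfect
      (Yoccoz.preperfect_isIterateLift hirr F.2 fun V hV => ?_) ⟨F.1, 1, 0, Or.inl fun x => ?_⟩
    · obtain ⟨k, -, hk⟩ := hB.1.mem_iff.1 hV
      obtain ⟨n, hn, m, h⟩ := Set.mem_iInter.1 hF k
      exact ⟨n, hn, m, hk (interior_subset h)⟩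
    · simp
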